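/- (Nikolskii–Stechkin-type inequality, one-dimensional case.) Let λ > −1/2, σ > 0, m ∈ ℕ and 1 ≤ p ≤ ∞. There is a constant C, depending only on λ and m, such that for every entire function f on ℂ of exponential type at most σ with ‖f‖_{L^p(ℝ,dμ)} < ∞ and every t with 0 < t ≤ 1/(2σ), one has ‖Δ_λ^m f‖_{L^p(ℝ,dμ)} ≤ C t^{−2m} ‖**Δ_t^m f‖_{L^p(ℝ,dμ)}, where Δ_λ^m is the m-th iterate of the Dunkl Laplacian applied to the restriction of f to ℝ. -/

import Mathlib

open MeasureTheory Real
open scoped NNReal ENNReal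

noncomputable section

namespace Dunkl1DStmt14

/-- `b_λ = (2^λ Γ(λ+1))⁻¹`. -/
def blam (lam : ℝ) : ℝ := ((2 : ℝ) ^ lam * Real.Gamma (lam + 1))⁻¹

/-- `c_λ = Γ(λ+1)/(√π Γ(λ+1/2))`. -/
def clam (lam : ℝ) : ℝ := Real.Gamma (lam + 1) / (Real.sqrt Real.pi * Real.Gamma (lam + 1/2))

/-- The measure `dμ(x) = (b_λ/2)|x|^{2λ+1} dx` on `ℝ`. -/
def μw (lam : ℝ) : Measure ℝ :=
  volume.withDensity fun x => ENNReal.ofReal (blam lam / 2 * |x| ^ (2 * lam + 1))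

/-- The measure `dν_λ(t) = b_λ t^{2λ+1} dt` on `(0,∞)`. -/
def νw (lam : ℝ) : Measure ℝ :=
  (volume.restrict (Set.Ioi 0)).withDensity fun t => ENNReal.ofReal (blam lam * t ^ (2 * lam + 1))

/-- The one-dimensional Dunkl-type generalized translation operator
`T^t f(x) = (c_λ/2) ∫_0^π [f(A)(1+B) + f(−A)(1−B)] sin^{2λ}φ dφ`,
`A = √(x² + t² − 2xt cos φ)`, `B = (x − t cos φ)/A` (with `B = 0` when `A = 0`, which is Lean's
division convention). -/
def T (lam t : ℝ) (f : ℝ → ℂ) (x : ℝ) : ℂ :=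
  ((clam lam / 2 : ℝ) : ℂ) *
    ∫ φ in Set.Ioo (0 : ℝ) Real.pi,
      ((f (Real.sqrt (x ^ 2 + t ^ 2 - 2 * x * t * Real.cos φ)) *
          (1 + (((x - t * Real.cos φ) /
            Real.sqrt (x ^ 2 + t ^ 2 - 2 * x * t * Real.cos φ) : ℝ) : ℂ)) +
        f (-Real.sqrt (x ^ 2 + t ^ 2 - 2 * x * t * Real.cos φ)) *
          (1 - (((x - t * Real.cos φ) /
            Real.sqrt (x ^ 2 + t ^ 2 - 2 * x * t * Real.cos φ) : ℝ) : ℂ))) *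
        ((Real.sin φ ^ (2 * lam) : ℝ) : ℂ))


/-- The one-dimensional Dunkl operator `DF(x) = F′(x) + (λ+1/2)(F(x) − F(−x))/x` (at `x = 0`
Lean's convention `z/0 = 0` is used; for restrictions of entire functions this agrees with the
real-analytic extension off the single point `0`). -/
def Dop (lam : ℝ) (F : ℝ → ℂ) (x : ℝ) : ℂ :=
  deriv F x + ((lam + 1/2 : ℝ) : ℂ) * (F x - F (-x)) / (x : ℂ)

/-- The `m`-th iterate of the one-dimensional Dunkl Laplacian `Δ_λ = D ∘ D`. -/
def lapIter (lam : ℝ) (m : ℕ) (F : ℝ → ℂ) : ℝ → ℂ :=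
  (fun G => Dop lam (Dop lam G))^[m] F

/-- The symmetric difference
`**Δ_t^m f = C(2m,m)⁻¹ ∑_{s=−m}^m (−1)^s C(2m, m−s) T^{st} f`. -/
def symmDiff (lam : ℝ) (m : ℕ) (t : ℝ) (F : ℝ → ℂ) (x : ℝ) : ℂ :=
  ((Nat.choose (2 * m) m : ℂ))⁻¹ *
    ∑ s ∈ Finset.Icc (-(m : ℤ)) (m : ℤ),
      (-1 : ℂ) ^ s * (Nat.choose (2 * m) ((m : ℤ) - s).toNat : ℂ) * T lam ((s : ℝ) * t) F x

/-- `f` is an entire function on `ℂ` of exponential type at most `σ`. -/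
def IsExpType (σ : ℝ) (f : ℂ → ℂ) : Prop :=
  AnalyticOnNhd ℂ f Set.univ ∧
    ∀ ε > (0 : ℝ), ∃ c : ℝ, ∀ z : ℂ, ‖f z‖ ≤ c * Real.exp ((σ + ε) * ‖z‖)




lemma clam_pos {lam : ℝ} (hlam : -(1/2 : ℝ) < lam) : 0 < clam lam := by
  unfold clam
  have h1 := Real.Gamma_pos_of_pos (show 0 < lam + 1 by linarith)
  have h2 := Real.Gamma_pos_of_pos (show 0 < lam + 1/2 by linarith)
  have h3 := Real.sqrt_pos.2 Real.pi_pos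
  positivity

lemma blam_pos {lam : ℝ} (hlam : -(1/2 : ℝ) < lam) : 0 < blam lam := by
  unfold blam
  have h1 := Real.Gamma_pos_of_pos (show 0 < lam + 1 by linarith)
  positivity

lemma sin_rpow_intervalIntegrable {s : ℝ} (hs : -1 < s) :
    IntervalIntegrable (fun φ : ℝ => Real.sin φ ^ s) volume 0 Real.pi := by
  by_cases h0 : 0 ≤ s
  · apply ContinuousOn.intervalIntegrable
    exact (Real.continuous_sin.rpow_const (fun _ => Or.inr h0)).continuousOn
  · push Not at h0
    have h1 : IntervalIntegrable (fun φ : ℝ => φ ^ s) volume 0 Real.pi :=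
      intervalIntegral.intervalIntegrable_rpow' hs
    have h2 : IntervalIntegrable (fun φ : ℝ => (Real.pi - φ) ^ s) volume 0 Real.pi := by
      have := (h1.comp_sub_left Real.pi).symm
      simpa using this
    have h3 : IntervalIntegrable (fun φ : ℝ => (2/Real.pi) ^ s * (φ ^ s + (Real.pi - φ) ^ s))
        volume 0 Real.pi := (h1.add h2).const_mul _
    rw [intervalIntegrable_iff_integrableOn_Ioo_of_le Real.pi_pos.le] at h3 ⊢
    refine Integrable.mono' h3 ?_ ?_
    · exact (Real.measurable_sin.pow_const s).aestronglyMeasurable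
    · refine (ae_restrict_iff' measurableSet_Ioo).2 (Filter.Eventually.of_forall fun φ hφ => ?_)
      have hp := Real.pi_pos
      have hsin : 0 < Real.sin φ := Real.sin_pos_of_pos_of_lt_pi hφ.1 hφ.2
      rw [Real.norm_of_nonneg (Real.rpow_nonneg hsin.le _)]
      have hφ1 := hφ.1
      have hφ2 : 0 < Real.pi - φ := by linarith [hφ.2]
      have hA : 0 ≤ φ ^ s := Real.rpow_nonneg hφ1.le _
      have hB : 0 ≤ (Real.pi - φ) ^ s := Real.rpow_nonneg hφ2.le _
      have hC : 0 ≤ (2/Real.pi) ^ s := by positivity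
      rcases le_total φ (Real.pi/2) with h | h
      · have := Real.mul_le_sin hφ1.le h
        calc Real.sin φ ^ s ≤ (2/Real.pi * φ) ^ s :=
              Real.rpow_le_rpow_of_nonpos (by positivity) this h0.le
          _ = (2/Real.pi) ^ s * φ ^ s := Real.mul_rpow (by positivity) hφ1.le
          _ ≤ _ := by nlinarith
      · have := Real.mul_le_sin hφ2.le (by linarith)
        rw [Real.sin_pi_sub] at this
        calc Real.sin φ ^ s ≤ (2/Real.pi * (Real.pi - φ)) ^ s :=
              Real.rpow_le_rpow_of_nonpos (by positivity) this h0.le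
          _ = (2/Real.pi) ^ s * (Real.pi - φ) ^ s := Real.mul_rpow (by positivity) hφ2.le
          _ ≤ _ := by nlinarith

/-- the angular measure -/
def om (lam : ℝ) : Measure ℝ :=
  (volume.restrict (Set.Ioo 0 Real.pi)).withDensity
    fun φ => ENNReal.ofReal (clam lam * Real.sin φ ^ (2 * lam))

lemma om_dens_meas (lam : ℝ) : Measurable (fun φ : ℝ => clam lam * Real.sin φ ^ (2 * lam)) :=
  (Real.measurable_sin.pow_const _).const_mul _

lemma om_dens_int {lam : ℝ} (hlam : -(1/2 : ℝ) < lam) :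
    IntegrableOn (fun φ : ℝ => clam lam * Real.sin φ ^ (2 * lam)) (Set.Ioo 0 Real.pi) := by
  have := (sin_rpow_intervalIntegrable (s := 2 * lam) (by linarith)).const_mul (clam lam)
  rwa [intervalIntegrable_iff_integrableOn_Ioo_of_le Real.pi_pos.le] at this

lemma om_finite {lam : ℝ} (hlam : -(1/2 : ℝ) < lam) : IsFiniteMeasure (om lam) := by
  refine ⟨?_⟩
  rw [om, withDensity_apply _ MeasurableSet.univ, Measure.restrict_univ]
  exact (om_dens_int hlam).lintegral_lt_top

lemma om_integral {E : Type*} [NormedAddCommGroup E] [NormedSpace ℝ E] {lam : ℝ}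
    (hlam : -(1/2 : ℝ) < lam) (q : ℝ → E) :
    ∫ φ, q φ ∂(om lam) =
      ∫ φ in Set.Ioo 0 Real.pi, (clam lam * Real.sin φ ^ (2 * lam)) • q φ := by
  rw [om, integral_withDensity_eq_integral_toReal_smul (om_dens_meas lam).ennreal_ofReal
    (by simp)]
  refine setIntegral_congr_fun measurableSet_Ioo fun φ hφ => ?_
  have hsin : 0 < Real.sin φ := Real.sin_pos_of_pos_of_lt_pi hφ.1 hφ.2
  have := clam_pos hlam
  rw [ENNReal.toReal_ofReal (by positivity)]

lemma om_integrable {E : Type*} [NormedAddCommGroup E]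
    {lam : ℝ} (hlam : -(1/2 : ℝ) < lam) {q : ℝ → E} (hq : Continuous q) :
    Integrable q (om lam) := by
  have := om_finite hlam
  obtain ⟨C, hC⟩ := (isCompact_Icc (a := (0:ℝ)) (b := Real.pi)).exists_bound_of_continuousOn
    hq.continuousOn
  refine Integrable.of_bound (Continuous.aestronglyMeasurable hq) C ?_
  have : ∀ᵐ φ ∂(volume.restrict (Set.Ioo 0 Real.pi)), ‖q φ‖ ≤ C :=
    (ae_restrict_iff' measurableSet_Ioo).2
      (Filter.Eventually.of_forall fun φ hφ => hC φ (Set.Ioo_subset_Icc_self hφ))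
  exact (withDensity_absolutelyContinuous _ _).ae_le this

/-- mass -/
def w0 (lam : ℝ) : ℝ := (om lam).real Set.univ

lemma om_pos_integral {lam : ℝ} (hlam : -(1/2 : ℝ) < lam) {q : ℝ → ℝ} (hq : Continuous q)
    (h0 : ∀ φ, 0 ≤ q φ) (h1 : ∀ φ ∈ Set.Ioo (0:ℝ) 1, 0 < q φ) :
    0 < ∫ φ, q φ ∂(om lam) := by
  rw [om_integral hlam]
  have hi : IntegrableOn (fun φ => (clam lam * Real.sin φ ^ (2 * lam)) • q φ)
      (Set.Ioo 0 Real.pi) := by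
    obtain ⟨C, hC⟩ := (isCompact_Icc (a := (0:ℝ)) (b := Real.pi)).exists_bound_of_continuousOn
      hq.continuousOn
    refine Integrable.mul_bdd (c := C) (om_dens_int hlam) hq.aestronglyMeasurable ?_
    exact (ae_restrict_iff' measurableSet_Ioo).2
      (Filter.Eventually.of_forall fun φ hφ => hC φ (Set.Ioo_subset_Icc_self hφ))
  have hc := clam_pos hlam
  rw [setIntegral_pos_iff_support_of_nonneg_ae ?_ hi]
  · have hsub : Set.Ioo (0:ℝ) 1 ⊆ (Function.support fun φ =>
        (clam lam * Real.sin φ ^ (2 * lam)) • q φ) ∩ Set.Ioo 0 Real.pi := by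
      intro φ hφ
      have h3 : φ < Real.pi := lt_trans hφ.2 (by linarith [Real.pi_gt_three])
      have hsin : 0 < Real.sin φ := Real.sin_pos_of_pos_of_lt_pi hφ.1 h3
      have := h1 φ hφ
      refine ⟨?_, hφ.1, h3⟩
      simp only [Function.mem_support, smul_eq_mul]
      positivity
    refine lt_of_lt_of_le ?_ (measure_mono hsub)
    simp
  · refine (ae_restrict_iff' measurableSet_Ioo).2 (Filter.Eventually.of_forall fun φ hφ => ?_)
    have hsin : 0 < Real.sin φ := Real.sin_pos_of_pos_of_lt_pi hφ.1 hφ.2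
    have := h0 φ
    simp only [Pi.zero_apply, smul_eq_mul]
    positivity

lemma w0_pos {lam : ℝ} (hlam : -(1/2 : ℝ) < lam) : 0 < w0 lam := by
  have := om_pos_integral hlam (q := fun _ => 1) continuous_const (by simp) (by simp)
  simpa [w0] using this

/-- integration by parts -/
lemma om_parts {lam : ℝ} (hlam : -(1/2 : ℝ) < lam) {q q' : ℝ → ℝ}
    (hq : ∀ φ, HasDerivAt q (q' φ) φ) (hq' : Continuous q') :
    (2 * lam + 1) * ∫ φ, q φ * Real.cos φ ∂(om lam) = - ∫ φ, q' φ * Real.sin φ ∂(om lam) := by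
  have hqc : Continuous q := continuous_iff_continuousAt.2 fun x => (hq x).continuousAt
  have i1 : Integrable (fun φ => q φ * Real.cos φ) (om lam) := om_integrable hlam (hqc.mul Real.continuous_cos)
  have i2 : Integrable (fun φ => q' φ * Real.sin φ) (om lam) := om_integrable hlam (hq'.mul Real.continuous_sin)
  rw [eq_neg_iff_add_eq_zero, ← integral_const_mul, ← integral_add (i1.const_mul _) i2,
    om_integral hlam]
  have hintg : IntervalIntegrable (fun φ => (clam lam * Real.sin φ ^ (2 * lam)) •
      ((2 * lam + 1) * (q φ * Real.cos φ) + q' φ * Real.sin φ)) volume 0 Real.pi := by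
    have h := ((sin_rpow_intervalIntegrable (s := 2 * lam) (by linarith)).const_mul (clam lam))
    refine h.mul_continuousOn ?_
    fun_prop
  rw [← integral_Ioc_eq_integral_Ioo, ← intervalIntegral.integral_of_le Real.pi_pos.le]
  have key := intervalIntegral.integral_eq_sub_of_hasDerivAt_of_le Real.pi_pos.le
    (f := fun φ => clam lam * (q φ * Real.sin φ ^ (2 * lam + 1)))
    (f' := fun φ => (clam lam * Real.sin φ ^ (2 * lam)) •
      ((2 * lam + 1) * (q φ * Real.cos φ) + q' φ * Real.sin φ)) ?_ ?_ hintg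
  · rw [key]
    simp [Real.zero_rpow (show 2 * lam + 1 ≠ 0 by linarith)]
  · refine Continuous.continuousOn ?_
    exact continuous_const.mul (hqc.mul (Real.continuous_sin.rpow_const
      (fun _ => Or.inr (by linarith))))
  · intro φ hφ
    have hsin : 0 < Real.sin φ := Real.sin_pos_of_pos_of_lt_pi hφ.1 hφ.2
    have h1 := ((hq φ).mul ((Real.hasDerivAt_sin φ).rpow_const (p := 2 * lam + 1)
      (Or.inl hsin.ne'))).const_mul (clam lam)
    refine h1.congr_deriv ?_
    rw [show 2 * lam + 1 - 1 = 2 * lam by ring, Real.rpow_add_one hsin.ne']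
    simp only [smul_eq_mul]
    ring

/-- `α_l` -/
def al (lam : ℝ) : ℕ → ℝ
  | 0 => 1
  | (l+1) => (2 * l + 2) * (2 * l + 2 * lam + 2) * al lam l

/-- `α'_l` -/
def al' (lam : ℝ) (l : ℕ) : ℝ := (2 * l + 2 * lam + 2) * al lam l

lemma al_ge {lam : ℝ} (hlam : -(1/2 : ℝ) < lam) (l : ℕ) : ((2*l).factorial : ℝ) ≤ al lam l := by
  induction l with
  | zero => simp [al]
  | succ l ih =>
    rw [show 2 * (l+1) = 2 * l + 1 + 1 by ring, Nat.factorial_succ, Nat.factorial_succ, al]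
    push_cast
    have h1 : (0:ℝ) < (2*l).factorial := by positivity
    have h2 : (0:ℝ) ≤ l := by positivity
    have : ((2:ℝ) * l + 1) * (2*l).factorial ≤ (2 * l + 2 * lam + 2) * al lam l :=
      mul_le_mul (by linarith) ih h1.le (by linarith)
    nlinarith

lemma al_pos {lam : ℝ} (hlam : -(1/2 : ℝ) < lam) (l : ℕ) : 0 < al lam l :=
  lt_of_lt_of_le (by positivity) (al_ge hlam l)

lemma al'_ge {lam : ℝ} (hlam : -(1/2 : ℝ) < lam) (l : ℕ) :
    ((2*l+1).factorial : ℝ) ≤ al' lam l := by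
  rw [Nat.factorial_succ, al']
  push_cast
  have h2 : (0:ℝ) ≤ l := by positivity
  exact mul_le_mul (by linarith) (al_ge hlam l) (by positivity) (by linarith)

lemma al'_pos {lam : ℝ} (hlam : -(1/2 : ℝ) < lam) (l : ℕ) : 0 < al' lam l :=
  lt_of_lt_of_le (by positivity) (al'_ge hlam l)

lemma al_succ (lam : ℝ) (l : ℕ) : al lam (l+1) = (2 * l + 2) * al' lam l := by
  rw [al, al']; ring

lemma moment {lam : ℝ} (hlam : -(1/2 : ℝ) < lam) (k : ℕ) :
    ∫ φ, Real.cos φ ^ (2*k) ∂(om lam) = w0 lam * (2*k).factorial / al lam k := by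
  induction k with
  | zero => simp [al, w0]
  | succ k ih =>
    have h := om_parts hlam (q := fun φ => Real.cos φ ^ (2*k+1))
      (q' := fun φ => ((2*k+1 : ℕ):ℝ) * Real.cos φ ^ (2*k) * (- Real.sin φ))
      (fun φ => (Real.hasDerivAt_cos φ).pow (2*k+1)) (by fun_prop)
    have e1 : (∫ φ, ((2*k+1 : ℕ):ℝ) * Real.cos φ ^ (2*k) * (- Real.sin φ) * Real.sin φ ∂(om lam))
        = (2*k+1) * (∫ φ, Real.cos φ ^ (2*(k+1)) ∂(om lam))
          - (2*k+1) * ∫ φ, Real.cos φ ^ (2*k) ∂(om lam) := by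
      rw [← integral_const_mul, ← integral_const_mul, ← integral_sub]
      · congr 1
        ext φ
        have := Real.sin_sq φ
        push_cast
        have e : Real.cos φ ^ (2*(k+1)) = Real.cos φ ^ (2*k) * Real.cos φ ^ 2 := by ring
        rw [e]
        linear_combination (-(2 * k+1) * Real.cos φ ^ (2*k)) * this
      · exact om_integrable hlam (by fun_prop)
      · exact om_integrable hlam (by fun_prop)
    have e2 : (∫ φ, Real.cos φ ^ (2*k+1) * Real.cos φ ∂(om lam)) =
        ∫ φ, Real.cos φ ^ (2*(k+1)) ∂(om lam) := by
      congr 1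
    rw [e1, e2, ih] at h
    have hk : (0:ℝ) ≤ k := by positivity
    have h3 : (2 * (k:ℝ) + 2 * lam + 2) ≠ 0 := by linarith
    have ha := (al_pos hlam k).ne'
    rw [al, show 2 * (k+1) = 2 * k + 1 + 1 by ring, Nat.factorial_succ, Nat.factorial_succ]
    rw [show 2 * (k+1) = 2 * k + 1 + 1 by ring] at h
    push_cast
    have hb : (2 * (k:ℝ) + 2) ≠ 0 := by positivity
    rw [eq_div_iff (mul_ne_zero (mul_ne_zero hb h3) ha)]
    have h4 : w0 lam * ((2*k).factorial : ℝ) / al lam k * al lam k = w0 lam * ((2*k).factorial : ℝ) :=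
      div_mul_cancel₀ _ ha
    linear_combination (2 * (k:ℝ) + 2) * al lam k * h + (2 * (k:ℝ) + 2) * (2 * k + 1) * h4





lemma om_hasDerivAt {𝕜 : Type*} [RCLike 𝕜] {lam : ℝ} (hlam : -(1/2 : ℝ) < lam)
    {q q' : 𝕜 → ℝ → 𝕜} (hq : ∀ x, Continuous (q x))
    (hq' : Continuous (fun z : 𝕜 × ℝ => q' z.1 z.2))
    (hd : ∀ x φ, HasDerivAt (fun x => q x φ) (q' x φ) x) (x : 𝕜) :
    HasDerivAt (fun x => ∫ φ, q x φ ∂(om lam)) (∫ φ, q' x φ ∂(om lam)) x := by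
  have := om_finite hlam
  obtain ⟨C, hC⟩ := ((isCompact_closedBall x 1).prod (isCompact_Icc (a := (0:ℝ)) (b := Real.pi))).exists_bound_of_continuousOn
    hq'.continuousOn
  refine (hasDerivAt_integral_of_dominated_loc_of_deriv_le (bound := fun _ => C)
    (s := Metric.ball x 1) (Metric.ball_mem_nhds x one_pos)
    (Filter.Eventually.of_forall fun y => (hq y).aestronglyMeasurable) (om_integrable hlam (hq x))
    (Continuous.aestronglyMeasurable (by fun_prop)) ?_ (integrable_const C) ?_).2
  · have : ∀ᵐ φ ∂(volume.restrict (Set.Ioo 0 Real.pi)), ∀ y ∈ Metric.ball x 1, ‖q' y φ‖ ≤ C :=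
      (ae_restrict_iff' measurableSet_Ioo).2
        (Filter.Eventually.of_forall fun φ hφ y hy => hC (y, φ)
          ⟨Metric.ball_subset_closedBall hy, Set.Ioo_subset_Icc_self hφ⟩)
    exact (withDensity_absolutelyContinuous _ _).ae_le this
  · exact Filter.Eventually.of_forall fun φ y _ => hd y φ

/-- even monomial mean -/
def U (lam t : ℝ) (l : ℕ) (x : ℝ) : ℝ :=
  ∫ φ, (x^2 + t^2 - 2*x*t*Real.cos φ)^l ∂(om lam)
/-- odd monomial mean -/
def V (lam t : ℝ) (l : ℕ) (x : ℝ) : ℝ :=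
  ∫ φ, (x^2 + t^2 - 2*x*t*Real.cos φ)^l * (x - t * Real.cos φ) ∂(om lam)

lemma U_deriv {lam : ℝ} (hlam : -(1/2 : ℝ) < lam) (t : ℝ) (l : ℕ) (x : ℝ) :
    HasDerivAt (U lam t (l+1)) ((2*l+2) * V lam t l x) x := by
  have h := om_hasDerivAt (𝕜 := ℝ) hlam (q := fun x φ => (x^2 + t^2 - 2*x*t*Real.cos φ)^(l+1))
    (q' := fun x φ => ((l:ℝ)+1) * (x^2 + t^2 - 2*x*t*Real.cos φ)^l * (2*x - 2*t*Real.cos φ))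
    (by intro x; fun_prop) (by fun_prop) (by
      intro x φ
      have h1 : HasDerivAt (fun x : ℝ => x^2 + t^2 - 2*x*t*Real.cos φ) (2*x - 2*t*Real.cos φ) x := by
        have := (((hasDerivAt_id x).pow 2).add_const (t^2)).sub
          ((((hasDerivAt_id x).const_mul 2).mul_const t).mul_const (Real.cos φ))
        refine this.congr_deriv ?_
        simp
      have := h1.pow (l+1)
      refine this.congr_deriv ?_
      simp) x
  refine h.congr_deriv ?_
  rw [V, ← integral_const_mul]
  congr 1; ext φ; ring

lemma V_deriv {lam : ℝ} (hlam : -(1/2 : ℝ) < lam) (t : ℝ) (l : ℕ) (x : ℝ) :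
    ∃ V', HasDerivAt (V lam t l) V' x ∧
      x * V' + (2*lam+1) * V lam t l x = (2*l+2*lam+2) * x * U lam t l x := by
  have hR : ∀ x φ : ℝ, HasDerivAt (fun x : ℝ => x^2 + t^2 - 2*x*t*Real.cos φ) (2*x - 2*t*Real.cos φ) x := by
    intro x φ
    have := (((hasDerivAt_id x).pow 2).add_const (t^2)).sub
      ((((hasDerivAt_id x).const_mul 2).mul_const t).mul_const (Real.cos φ))
    refine this.congr_deriv ?_
    simp
  have h := om_hasDerivAt (𝕜 := ℝ) hlam
    (q := fun x φ => (x^2 + t^2 - 2*x*t*Real.cos φ)^l * (x - t*Real.cos φ))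
    (q' := fun x φ => (l:ℝ) * (x^2 + t^2 - 2*x*t*Real.cos φ)^(l-1) * (2*x - 2*t*Real.cos φ)
      * (x - t*Real.cos φ) + (x^2 + t^2 - 2*x*t*Real.cos φ)^l)
    (by intro x; fun_prop) (by fun_prop) (by
      intro x φ
      have := ((hR x φ).pow l).mul ((hasDerivAt_id x).sub_const (t * Real.cos φ))
      refine this.congr_deriv ?_
      simp) x
  refine ⟨_, h, ?_⟩
  have hp := om_parts hlam (q := fun φ => (x^2 + t^2 - 2*x*t*Real.cos φ)^l)
    (q' := fun φ => (l:ℝ) * (x^2 + t^2 - 2*x*t*Real.cos φ)^(l-1) * (2*x*t*Real.sin φ)) (by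
      intro φ
      have h1 : HasDerivAt (fun φ : ℝ => x^2 + t^2 - 2*x*t*Real.cos φ) (2*x*t*Real.sin φ) φ := by
        have := ((Real.hasDerivAt_cos φ).const_mul (2*x*t)).const_sub (x^2+t^2)
        refine this.congr_deriv ?_
        ring
      exact h1.pow l) (by fun_prop)
  have e1 : (∫ φ, (x^2 + t^2 - 2*x*t*Real.cos φ)^l * Real.cos φ ∂(om lam)) * t =
      x * U lam t l x - V lam t l x := by
    rw [U, V, ← integral_const_mul, ← integral_sub, ← integral_mul_const]
    · congr 1; ext φ; ring
    · exact om_integrable hlam (by fun_prop)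
    · exact om_integrable hlam (by fun_prop)
  have e2 : (∫ φ, ((l:ℝ) * (x^2 + t^2 - 2*x*t*Real.cos φ)^(l-1) * (2*x - 2*t*Real.cos φ)
      * (x - t*Real.cos φ) + (x^2 + t^2 - 2*x*t*Real.cos φ)^l) ∂(om lam)) * x =
      (2*l+1) * x * U lam t l x -
      t * (∫ φ, (l:ℝ) * (x^2 + t^2 - 2*x*t*Real.cos φ)^(l-1) * (2*x*t*Real.sin φ) * Real.sin φ ∂(om lam)) := by
    rw [U, ← integral_const_mul, ← integral_const_mul, ← integral_sub, ← integral_mul_const]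
    · congr 1; ext φ
      rcases l with _ | l
      · simp
      · simp only [Nat.add_sub_cancel]
        have := Real.sin_sq φ
        rw [pow_succ]
        push_cast
        linear_combination (2 * t^2 * x * ((l:ℝ)+1) * (x^2 + t^2 - 2*x*t*Real.cos φ)^l ) * this
    · exact om_integrable hlam (by fun_prop)
    · exact om_integrable hlam (by fun_prop)
  linear_combination e2 - t * hp + (2*lam+1) * e1

/-- closed forms -/
def uc (lam t : ℝ) (l : ℕ) (x : ℝ) : ℝ :=
  ∑ kj ∈ Finset.HasAntidiagonal.antidiagonal l, t^(2*kj.1) / al lam kj.1 * (x^(2*kj.2) / al lam kj.2)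
/-- closed forms -/
def vc (lam t : ℝ) (l : ℕ) (x : ℝ) : ℝ :=
  ∑ kj ∈ Finset.HasAntidiagonal.antidiagonal l, t^(2*kj.1) / al lam kj.1 * (x^(2*kj.2+1) / al' lam kj.2)

lemma uc_deriv {lam : ℝ} (hlam : -(1/2 : ℝ) < lam) (t : ℝ) (l : ℕ) (x : ℝ) :
    HasDerivAt (uc lam t (l+1)) (vc lam t l x) x := by
  have e : uc lam t (l+1) = fun x => t^(2*(l+1)) / al lam (l+1) +
      ∑ kj ∈ Finset.HasAntidiagonal.antidiagonal l, t^(2*kj.1) / al lam kj.1 * (x^(2*kj.2+2) / al lam (kj.2+1)) := by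
    ext x
    rw [uc, Finset.Nat.sum_antidiagonal_succ']
    simp [al, mul_add]
  rw [e, vc]
  refine (HasDerivAt.fun_sum fun kj _ => ?_).const_add _
  have h := (((hasDerivAt_pow (2*kj.2+2) x).div_const (al lam (kj.2+1))).const_mul
    (t^(2*kj.1) / al lam kj.1))
  refine h.congr_deriv ?_
  rw [al_succ]
  have h1 := (al'_pos hlam kj.2).ne'
  have h2 := (al_pos hlam kj.1).ne'
  have h3 : (2 * (kj.2:ℝ) + 2) ≠ 0 := by positivity
  push_cast
  rw [mul_div_mul_left _ _ h3]

lemma vc_deriv {lam : ℝ} (hlam : -(1/2 : ℝ) < lam) (t : ℝ) (l : ℕ) (x : ℝ) :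
    ∃ v', HasDerivAt (vc lam t l) v' x ∧ x * v' + (2*lam+1) * vc lam t l x = x * uc lam t l x := by
  refine ⟨∑ kj ∈ Finset.HasAntidiagonal.antidiagonal l, t^(2*kj.1) / al lam kj.1 *
    (((2*kj.2+1:ℕ):ℝ) * x^(2*kj.2) / al' lam kj.2), ?_, ?_⟩
  · exact HasDerivAt.fun_sum fun kj _ => (((hasDerivAt_pow (2*kj.2+1) x).div_const _).const_mul _)
  · rw [vc, uc, Finset.mul_sum, Finset.mul_sum, Finset.mul_sum, ← Finset.sum_add_distrib]
    refine Finset.sum_congr rfl fun kj _ => ?_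
    have h1 := (al_pos hlam kj.2).ne'
    have h2 := (al_pos hlam kj.1).ne'
    have h3 : 2 * (kj.2:ℝ) + 2 * lam + 2 ≠ 0 := by
      have : (0:ℝ) ≤ kj.2 := by positivity
      linarith
    rw [al']
    push_cast
    rw [← mul_div_mul_left (x^(2*kj.2)) (al lam kj.2) h3]
    ring

lemma ode_unique_pos {lam : ℝ} (hlam : -(1/2 : ℝ) < lam) {d : ℝ → ℝ}
    (hd : ∀ x, ∃ d', HasDerivAt d d' x ∧ x * d' + (2*lam+1) * d x = 0) (x : ℝ) (hx : 0 < x) :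
    d x = 0 := by
  have hc : Continuous d := continuous_iff_continuousAt.2 fun x => (hd x).choose_spec.1.continuousAt
  obtain ⟨c, hc1, hc2⟩ := exists_hasDerivAt_eq_slope (fun y => y^(2*lam+1) * d y) (fun _ => 0) hx
    ((Real.continuous_rpow_const (by linarith)).mul hc).continuousOn (by
      intro y hy
      obtain ⟨d', h1, h2⟩ := hd y
      have hy0 : 0 < y := hy.1
      have h3 := (Real.hasDerivAt_rpow_const (x := y) (p := 2*lam+1) (Or.inl hy0.ne')).mul h1
      refine h3.congr_deriv ?_
      rw [show 2 * lam + 1 - 1 = 2 * lam by ring, Real.rpow_add_one hy0.ne']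
      linear_combination y^(2*lam) * h2)
  simp only [Real.zero_rpow (show 2 * lam + 1 ≠ 0 by linarith), zero_mul, sub_zero] at hc2
  have h5 : x^(2*lam+1) * d x = 0 := by
    rw [eq_div_iff hx.ne', zero_mul] at hc2
    exact hc2.symm
  exact (mul_eq_zero.1 h5).resolve_left (by positivity)

lemma ode_unique {lam : ℝ} (hlam : -(1/2 : ℝ) < lam) {d : ℝ → ℝ}
    (hd : ∀ x, ∃ d', HasDerivAt d d' x ∧ x * d' + (2*lam+1) * d x = 0) (x : ℝ) :
    d x = 0 := by
  rcases lt_trichotomy x 0 with h | h | h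
  · have := ode_unique_pos hlam (d := fun y => d (-y)) (by
      intro y
      obtain ⟨d', h1, h2⟩ := hd (-y)
      refine ⟨-d', ?_, by linear_combination h2⟩
      have h1' : HasDerivAt d d' (-y) := h1
      have := HasDerivAt.scomp y h1' (hasDerivAt_neg y)
      refine this.congr_deriv ?_
      simp) (-x) (by linarith)
    simpa using this
  · subst h
    obtain ⟨d', h1, h2⟩ := hd 0
    rw [zero_mul, zero_add] at h2
    exact (mul_eq_zero.1 h2).resolve_left (by linarith)
  · exact ode_unique_pos hlam hd x h

lemma V_of_U {lam : ℝ} (hlam : -(1/2 : ℝ) < lam) (t : ℝ) (l : ℕ)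
    (hU : ∀ x, U lam t l x = w0 lam * al lam l * uc lam t l x) (x : ℝ) :
    V lam t l x = w0 lam * al' lam l * vc lam t l x := by
  have := ode_unique hlam (d := fun x => V lam t l x - w0 lam * al' lam l * vc lam t l x) (by
    intro y
    obtain ⟨V', h1, h2⟩ := V_deriv hlam t l y
    obtain ⟨v', h3, h4⟩ := vc_deriv hlam t l y
    refine ⟨_, h1.sub (h3.const_mul (w0 lam * al' lam l)), ?_⟩
    rw [hU y] at h2
    have e : al' lam l = (2 * l + 2 * lam + 2) * al lam l := rfl
    rw [e]
    linear_combination h2 - w0 lam * ((2 * l + 2 * lam + 2) * al lam l) * h4) x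
  linarith

lemma U_zero (lam t : ℝ) (l : ℕ) : U lam t l 0 = w0 lam * t^(2*l) := by
  simp [U, w0, pow_mul]

lemma uc_zero (lam t : ℝ) (l : ℕ) : uc lam t (l+1) 0 = t^(2*(l+1)) / al lam (l+1) := by
  rw [uc, Finset.Nat.sum_antidiagonal_succ']
  simp [al]

lemma UV_closed {lam : ℝ} (hlam : -(1/2 : ℝ) < lam) (t : ℝ) (l : ℕ) :
    ∀ x, U lam t l x = w0 lam * al lam l * uc lam t l x := by
  induction l with
  | zero => intro x; simp [U, uc, al, w0]
  | succ l ih =>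
    have hd : ∀ y, HasDerivAt (fun x => U lam t (l+1) x - w0 lam * al lam (l+1) * uc lam t (l+1) x) 0 y := by
      intro y
      refine ((U_deriv hlam t l y).sub ((uc_deriv hlam t l y).const_mul _)).congr_deriv ?_
      rw [V_of_U hlam t l ih, al_succ]; ring
    intro x
    have := is_const_of_deriv_eq_zero (fun y => (hd y).differentiableAt) (fun y => (hd y).deriv) x 0
    rw [U_zero, uc_zero] at this
    have h1 := (al_pos hlam (l+1)).ne'
    have h2 : w0 lam * t ^ (2 * (l + 1)) - w0 lam * al lam (l + 1) * (t ^ (2 * (l + 1)) / al lam (l + 1)) = 0 := by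
      field_simp
      ring
    linarith





lemma hs_congr {f g : ℕ → ℂ} {a : ℂ} (hf : HasSum f a) (h : ∀ l, f l = g l) : HasSum g a := by
  rwa [← funext h]

/-- growth -/
def Bd (ρ C : ℝ) (b : ℕ → ℂ) : Prop := ∀ k, ‖b k‖ ≤ C * ρ^(2*k)

/-- shift -/
def sh (k : ℕ) (b : ℕ → ℂ) : ℕ → ℂ := fun l => b (l + k)

/-- general term -/
def tm (lam : ℝ) (b d : ℕ → ℂ) (l : ℕ) (z : ℂ) : ℂ :=
  b l * z^(2*l) / (al lam l : ℂ) + d l * z^(2*l+1) / (al' lam l : ℂ)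

/-- the entire function with given Dunkl coefficients -/
def P (lam : ℝ) (b d : ℕ → ℂ) (z : ℂ) : ℂ := ∑' l, tm lam b d l z

lemma Bd.nonneg {ρ C : ℝ} {b : ℕ → ℂ} (h : Bd ρ C b) : 0 ≤ C := by
  have := (norm_nonneg _).trans (h 0)
  simpa using this

lemma Bd.mono {ρ C C' : ℝ} {b : ℕ → ℂ} (hρ : 0 ≤ ρ) (h : Bd ρ C b) (hC : C ≤ C') : Bd ρ C' b :=
  fun k => (h k).trans (mul_le_mul_of_nonneg_right hC (by positivity))

lemma Bd.sh {ρ C : ℝ} {b : ℕ → ℂ} (h : Bd ρ C b) (k : ℕ) : Bd ρ (C * ρ^(2*k)) (sh k b) := by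
  intro l
  refine (h (l+k)).trans (le_of_eq ?_)
  ring

lemma tm_bound' {lam : ℝ} (hlam : -(1/2 : ℝ) < lam) {ρ C : ℝ} (hρ : 0 ≤ ρ) {b d : ℕ → ℂ} (hb : Bd ρ C b)
    (hd : Bd ρ C d) (l : ℕ) (X Y : ℂ) {R : ℝ} (hR : 0 ≤ R) (hX : ‖X‖ ≤ R^(2*l)) (hY : ‖Y‖ ≤ R^(2*l+1)) :
    ‖b l * X / (al lam l : ℂ) + d l * Y / (al' lam l : ℂ)‖
      ≤ C * (1 + R) * ((ρ * R)^(2*l) / (2*l).factorial) := by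
  have hC := hb.nonneg
  have h1 := al_ge hlam l
  have h2 : ((2*l).factorial : ℝ) ≤ al' lam l :=
    le_trans (by exact_mod_cast Nat.factorial_le (by omega)) (al'_ge hlam l)
  have f1 : (0:ℝ) < (2*l).factorial := by positivity
  have e1 : ‖b l * X / (al lam l : ℂ)‖ ≤ C * ρ^(2*l) * R^(2*l) / (2*l).factorial := by
    rw [norm_div, norm_mul, Complex.norm_real, Real.norm_of_nonneg (al_pos hlam l).le]
    gcongr
    exact hb l
  have e2 : ‖d l * Y / (al' lam l : ℂ)‖ ≤ C * ρ^(2*l) * R^(2*l+1) / (2*l).factorial := by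
    rw [norm_div, norm_mul, Complex.norm_real, Real.norm_of_nonneg (al'_pos hlam l).le]
    gcongr
    exact hd l
  refine (norm_add_le _ _).trans ((add_le_add e1 e2).trans (le_of_eq ?_))
  rw [mul_pow]
  ring

lemma tm_bound {lam : ℝ} (hlam : -(1/2 : ℝ) < lam) {ρ C : ℝ} (hρ : 0 ≤ ρ) {b d : ℕ → ℂ} (hb : Bd ρ C b)
    (hd : Bd ρ C d) (l : ℕ) (z : ℂ) {R : ℝ} (hz : ‖z‖ ≤ R) :
    ‖tm lam b d l z‖ ≤ C * (1 + R) * ((ρ * R)^(2*l) / (2*l).factorial) := by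
  refine tm_bound' hlam hρ hb hd l _ _ ((norm_nonneg z).trans hz) ?_ ?_ <;>
  · rw [norm_pow]; gcongr

lemma sum_cosh (x : ℝ) : Summable (fun l : ℕ => x^(2*l) / (2*l).factorial) :=
  (Real.hasSum_cosh x).summable

lemma tm_summable {lam : ℝ} (hlam : -(1/2 : ℝ) < lam) {ρ C : ℝ} (hρ : 0 ≤ ρ) {b d : ℕ → ℂ} (hb : Bd ρ C b)
    (hd : Bd ρ C d) (z : ℂ) : Summable (fun l => tm lam b d l z) :=
  Summable.of_norm_bounded ((sum_cosh (ρ * ‖z‖)).mul_left (C * (1 + ‖z‖)))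
    (fun l => tm_bound hlam hρ hb hd l z le_rfl)

lemma P_bound {lam : ℝ} (hlam : -(1/2 : ℝ) < lam) {ρ C : ℝ} (hρ : 0 ≤ ρ) {b d : ℕ → ℂ} (hb : Bd ρ C b)
    (hd : Bd ρ C d) (z : ℂ) {R : ℝ} (hz : ‖z‖ ≤ R) :
    ‖P lam b d z‖ ≤ C * (1 + R) * Real.cosh (ρ * R) :=
  tsum_of_norm_bounded ((Real.hasSum_cosh (ρ * R)).mul_left (C * (1 + R)))
    (fun l => tm_bound hlam hρ hb hd l z hz)

lemma P_diff {lam : ℝ} (hlam : -(1/2 : ℝ) < lam) {ρ C : ℝ} (hρ : 0 ≤ ρ) {b d : ℕ → ℂ} (hb : Bd ρ C b)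
    (hd : Bd ρ C d) : Differentiable ℂ (P lam b d) := by
  intro z
  have h := Complex.differentiableOn_tsum_of_summable_norm
    (F := fun l z => tm lam b d l z) (U := Metric.ball (0:ℂ) (‖z‖+1))
    ((sum_cosh (ρ * (‖z‖+1))).mul_left (C * (1 + (‖z‖+1))))
    (fun l => by unfold tm; fun_prop) Metric.isOpen_ball
    (fun l w hw => tm_bound hlam hρ hb hd l w (by
      rw [mem_ball_zero_iff] at hw; exact hw.le))
  exact (h.differentiableAt (Metric.isOpen_ball.mem_nhds (by simp)))

lemma P_cont {lam : ℝ} (hlam : -(1/2 : ℝ) < lam) {ρ C : ℝ} (hρ : 0 ≤ ρ) {b d : ℕ → ℂ} (hb : Bd ρ C b)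
    (hd : Bd ρ C d) : Continuous (fun x : ℝ => P lam b d x) :=
  (P_diff hlam hρ hb hd).continuous.comp Complex.continuous_ofReal

/-- antidiagonal rearrangement -/
lemma hasSum_antidiag {g : ℕ × ℕ → ℂ} (hg : Summable g) :
    HasSum (fun l => ∑ kj ∈ Finset.HasAntidiagonal.antidiagonal l, g kj) (∑' p, g p) := by
  have h1 : Summable (g ∘ Finset.HasAntidiagonal.sigmaAntidiagonalEquivProd (A := ℕ)) :=
    (Equiv.summable_iff _).2 hg
  have h2 := h1.hasSum.sigma (fun l => (hasSum_fintype _))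
  rw [← (Finset.HasAntidiagonal.sigmaAntidiagonalEquivProd (A := ℕ)).tsum_eq]
  refine hs_congr h2 fun l => ?_
  exact (Finset.sum_coe_sort (Finset.HasAntidiagonal.antidiagonal l) g)

lemma T_eq {lam : ℝ} (hlam : -(1/2 : ℝ) < lam) (t : ℝ) (f : ℝ → ℂ) (x : ℝ) :
    T lam t f x = (1/2 : ℂ) * ∫ φ,
      (f (Real.sqrt (x ^ 2 + t ^ 2 - 2 * x * t * Real.cos φ)) *
          (1 + (((x - t * Real.cos φ) /
            Real.sqrt (x ^ 2 + t ^ 2 - 2 * x * t * Real.cos φ) : ℝ) : ℂ)) +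
        f (-Real.sqrt (x ^ 2 + t ^ 2 - 2 * x * t * Real.cos φ)) *
          (1 - (((x - t * Real.cos φ) /
            Real.sqrt (x ^ 2 + t ^ 2 - 2 * x * t * Real.cos φ) : ℝ) : ℂ))) ∂(om lam) := by
  rw [T, om_integral hlam, ← integral_const_mul, ← integral_const_mul]
  congr 1
  ext φ
  rw [Complex.real_smul]
  push_cast
  ring

lemma R_nonneg (x t φ : ℝ) : 0 ≤ x ^ 2 + t ^ 2 - 2 * x * t * Real.cos φ := by
  have := Real.sin_sq_add_cos_sq φ
  nlinarith [sq_nonneg (x - t * Real.cos φ), mul_nonneg (sq_nonneg t) (sq_nonneg (Real.sin φ))]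

lemma R_sqrt_le (x t φ : ℝ) : Real.sqrt (x ^ 2 + t ^ 2 - 2 * x * t * Real.cos φ) ≤ |x| + |t| := by
  rw [Real.sqrt_le_left (by positivity)]
  have h1 := abs_le.1 (Real.abs_cos_le_one φ)
  have h2 := abs_mul_abs_self x
  have h3 := abs_mul_abs_self t
  have h4 : |x * t * Real.cos φ| ≤ |x| * |t| := by
    rw [abs_mul, abs_mul]
    exact mul_le_of_le_one_right (by positivity) (Real.abs_cos_le_one φ)
  have h5 := neg_abs_le (x * t * Real.cos φ)
  nlinarith

lemma B_eq (x t φ : ℝ) (l : ℕ) :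
    ((x - t * Real.cos φ) / Real.sqrt (x ^ 2 + t ^ 2 - 2 * x * t * Real.cos φ)) *
      (Real.sqrt (x ^ 2 + t ^ 2 - 2 * x * t * Real.cos φ))^(2*l+1) =
      (x ^ 2 + t ^ 2 - 2 * x * t * Real.cos φ)^l * (x - t * Real.cos φ) := by
  have h0 := R_nonneg x t φ
  by_cases h : Real.sqrt (x ^ 2 + t ^ 2 - 2 * x * t * Real.cos φ) = 0
  · have h1 := (Real.sqrt_eq_zero h0).1 h
    have h2 : (x - t * Real.cos φ) = 0 := by
      have := Real.sin_sq_add_cos_sq φ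
      have h3 : (x - t * Real.cos φ)^2 + t^2 * Real.sin φ^2 = 0 := by
        linear_combination h1 + t^2 * this
      have h4 : (x - t * Real.cos φ)^2 ≤ 0 := by nlinarith [mul_nonneg (sq_nonneg t) (sq_nonneg (Real.sin φ))]
      exact pow_eq_zero_iff (two_ne_zero) |>.1 (le_antisymm h4 (sq_nonneg _))
    rw [h2]; simp
  · rw [pow_succ (Real.sqrt _), pow_mul (Real.sqrt _), Real.sq_sqrt h0]
    generalize Real.sqrt (x ^ 2 + t ^ 2 - 2 * x * t * Real.cos φ) = A at *
    field_simp

/-- the two-parameter family -/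
def fam (lam t : ℝ) (b d : ℕ → ℂ) (x : ℂ) (p : ℕ × ℕ) : ℂ :=
  ((t^(2*p.1) / al lam p.1 : ℝ) : ℂ) * tm lam (sh p.1 b) (sh p.1 d) p.2 x

lemma fam_bound {lam : ℝ} (hlam : -(1/2 : ℝ) < lam) {ρ C : ℝ} (hρ : 0 ≤ ρ) {b d : ℕ → ℂ} (hb : Bd ρ C b)
    (hd : Bd ρ C d) (t : ℝ) (x : ℂ) (p : ℕ × ℕ) :
    ‖fam lam t b d x p‖ ≤ C * (1 + ‖x‖) *
      (((ρ * t)^(2*p.1) / (2*p.1).factorial) * ((ρ * ‖x‖)^(2*p.2) / (2*p.2).factorial)) := by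
  rw [fam, norm_mul, Complex.norm_real, Real.norm_eq_abs, abs_of_nonneg (div_nonneg
    (by rw [pow_mul]; positivity) (al_pos hlam _).le)]
  have h1 := tm_bound hlam hρ (hb.sh p.1) (hd.sh p.1) p.2 x le_rfl
  have h2 := al_ge hlam p.1
  have h0 : 0 ≤ t^(2*p.1) := by rw [pow_mul]; positivity
  have hC := hb.nonneg
  calc _ ≤ t^(2*p.1) / (2*p.1).factorial * (C * ρ^(2*p.1) * (1 + ‖x‖) * ((ρ * ‖x‖)^(2*p.2) / (2*p.2).factorial)) := by
        gcongr
    _ = _ := by rw [mul_pow]; ring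

lemma fam_summable {lam : ℝ} (hlam : -(1/2 : ℝ) < lam) {ρ C : ℝ} (hρ : 0 ≤ ρ) {b d : ℕ → ℂ} (hb : Bd ρ C b)
    (hd : Bd ρ C d) (t : ℝ) (x : ℂ) : Summable (fam lam t b d x) := by
  refine Summable.of_norm_bounded ?_ (fam_bound hlam hρ hb hd t x)
  refine Summable.mul_left _ ?_
  exact (sum_cosh (ρ * t)).mul_of_nonneg (sum_cosh (ρ * ‖x‖))
    (fun l => by simp only [Pi.zero_apply]; rw [pow_mul]; positivity) (fun l => by simp only [Pi.zero_apply]; positivity)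

lemma T_hasSum {lam : ℝ} (hlam : -(1/2 : ℝ) < lam) {ρ C : ℝ} (hρ : 0 ≤ ρ) {b d : ℕ → ℂ} (hb : Bd ρ C b)
    (hd : Bd ρ C d) (t x : ℝ) :
    HasSum (fun l => b l * (U lam t l x : ℂ) / (al lam l : ℂ) + d l * (V lam t l x : ℂ) / (al' lam l : ℂ))
      (T lam t (fun x => P lam b d x) x) := by
  have := om_finite hlam
  rw [T_eq hlam, ← integral_const_mul]
  have h := hasSum_integral_of_dominated_convergence (μ := om lam)
    (F := fun l φ => b l * (((x ^ 2 + t ^ 2 - 2 * x * t * Real.cos φ)^l : ℝ) : ℂ) / (al lam l : ℂ) +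
      d l * (((x ^ 2 + t ^ 2 - 2 * x * t * Real.cos φ)^l * (x - t * Real.cos φ) : ℝ) : ℂ) / (al' lam l : ℂ))
    (f := fun φ => (1/2 : ℂ) * (P lam b d (Real.sqrt (x ^ 2 + t ^ 2 - 2 * x * t * Real.cos φ) : ℝ) *
          (1 + (((x - t * Real.cos φ) /
            Real.sqrt (x ^ 2 + t ^ 2 - 2 * x * t * Real.cos φ) : ℝ) : ℂ)) +
        P lam b d (-Real.sqrt (x ^ 2 + t ^ 2 - 2 * x * t * Real.cos φ) : ℝ) *
          (1 - (((x - t * Real.cos φ) /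
            Real.sqrt (x ^ 2 + t ^ 2 - 2 * x * t * Real.cos φ) : ℝ) : ℂ))))
    (bound := fun l _ => C * (1 + (|x|+|t|)) * ((ρ * (|x|+|t|))^(2*l) / (2*l).factorial)) ?_ ?_ ?_ ?_ ?_
  · refine hs_congr h fun l => ?_
    rw [integral_add, integral_div, integral_div, integral_const_mul, integral_const_mul,
      integral_complex_ofReal, integral_complex_ofReal]
    · rfl
    · exact om_integrable hlam (by fun_prop)
    · exact om_integrable hlam (by fun_prop)
  · intro l
    exact Continuous.aestronglyMeasurable (by fun_prop)
  · intro l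
    refine Filter.Eventually.of_forall fun φ => ?_
    have h1 := R_sqrt_le x t φ
    have h0 := R_nonneg x t φ
    refine tm_bound' hlam hρ hb hd l _ _ (by positivity) ?_ ?_
    · rw [Complex.norm_real, Real.norm_of_nonneg (by positivity), pow_mul]
      gcongr
      rw [← Real.sqrt_le_left (by positivity)]
      exact h1
    · have h3 : |x - t * Real.cos φ| ≤ |x| + |t| := by
        refine (norm_sub_le x (t * Real.cos φ)).trans ?_
        simp only [Real.norm_eq_abs]
        refine add_le_add le_rfl ?_
        rw [abs_mul]
        exact mul_le_of_le_one_right (by positivity) (Real.abs_cos_le_one φ)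
      rw [Complex.norm_real, norm_mul, Real.norm_of_nonneg (by positivity), pow_succ (|x| + |t|), pow_mul (|x| + |t|)]
      gcongr
      · rw [← Real.sqrt_le_left (by positivity)]
        exact h1
      · exact h3
  · exact Filter.Eventually.of_forall fun φ => (sum_cosh _).mul_left _
  · exact integrable_const _
  · refine Filter.Eventually.of_forall fun φ => ?_
    have h0 := R_nonneg x t φ
    have e1 := ((tm_summable hlam hρ hb hd (Real.sqrt (x ^ 2 + t ^ 2 - 2 * x * t * Real.cos φ) : ℝ)).hasSum.mul_right (1 + (((x - t * Real.cos φ) /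
            Real.sqrt (x ^ 2 + t ^ 2 - 2 * x * t * Real.cos φ) : ℝ) : ℂ)))
    have e2 := ((tm_summable hlam hρ hb hd (-Real.sqrt (x ^ 2 + t ^ 2 - 2 * x * t * Real.cos φ) : ℝ)).hasSum.mul_right (1 - (((x - t * Real.cos φ) /
            Real.sqrt (x ^ 2 + t ^ 2 - 2 * x * t * Real.cos φ) : ℝ) : ℂ)))
    have e3 := (e1.add e2).mul_left (1/2 : ℂ)
    refine hs_congr e3 fun l => ?_
    rw [← B_eq x t φ l]
    have e4 : (x ^ 2 + t ^ 2 - 2 * x * t * Real.cos φ)^l =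
      (Real.sqrt (x ^ 2 + t ^ 2 - 2 * x * t * Real.cos φ))^(2*l) := by rw [pow_mul, Real.sq_sqrt h0]
    rw [e4]
    generalize (x - t * Real.cos φ) / Real.sqrt (x ^ 2 + t ^ 2 - 2 * x * t * Real.cos φ) = B
    generalize Real.sqrt (x ^ 2 + t ^ 2 - 2 * x * t * Real.cos φ) = A
    simp only [tm]
    push_cast
    rw [Even.neg_pow (by simp), Odd.neg_pow (by simp)]
    ring

lemma T_tsum {lam : ℝ} (hlam : -(1/2 : ℝ) < lam) {ρ C : ℝ} (hρ : 0 ≤ ρ) {b d : ℕ → ℂ} (hb : Bd ρ C b)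
    (hd : Bd ρ C d) (t x : ℝ) :
    T lam t (fun x => P lam b d x) x = w0 lam * ∑' p, fam lam t b d x p := by
  have h1 := (hasSum_antidiag (fam_summable hlam hρ hb hd t x)).mul_left (w0 lam : ℂ)
  refine (T_hasSum hlam hρ hb hd t x).unique (hs_congr h1 fun l => ?_)
  rw [V_of_U hlam t l (UV_closed hlam t l), UV_closed hlam t l, uc, vc]
  have ha : (al lam l : ℂ) ≠ 0 := by exact_mod_cast (al_pos hlam l).ne'
  have ha' : (al' lam l : ℂ) ≠ 0 := by exact_mod_cast (al'_pos hlam l).ne'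
  push_cast
  rw [show ∀ X : ℂ, b l * (w0 lam * al lam l * X) / al lam l = w0 lam * (b l * X) by
    intro X; field_simp]
  rw [show ∀ X : ℂ, d l * (w0 lam * al' lam l * X) / al' lam l = w0 lam * (d l * X) by
    intro X; field_simp]
  rw [← mul_add]
  congr 1
  rw [Finset.mul_sum, Finset.mul_sum, ← Finset.sum_add_distrib]
  refine Finset.sum_congr rfl fun kj hkj => ?_
  have : kj.2 + kj.1 = l := by
    rw [add_comm]; exact Finset.HasAntidiagonal.mem_antidiagonal.1 hkj
  simp only [fam, tm, sh, this]
  push_cast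
  ring

lemma T_sum1 {lam : ℝ} (hlam : -(1/2 : ℝ) < lam) {ρ C : ℝ} (hρ : 0 ≤ ρ) {b d : ℕ → ℂ} (hb : Bd ρ C b)
    (hd : Bd ρ C d) (t x : ℝ) :
    T lam t (fun x => P lam b d x) x =
      ∑' k, ((w0 lam * (t^(2*k) / al lam k) : ℝ) : ℂ) * P lam (sh k b) (sh k d) x := by
  rw [T_tsum hlam hρ hb hd, (fam_summable hlam hρ hb hd t x).tsum_prod, ← tsum_mul_left]
  congr 1
  ext k
  simp only [fam]
  rw [tsum_mul_left, P]
  push_cast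
  ring

/-- translated coefficients -/
def tr (lam t : ℝ) (b : ℕ → ℂ) (l : ℕ) : ℂ := ∑' k, ((w0 lam * (t^(2*k) / al lam k) : ℝ) : ℂ) * b (l + k)

lemma tr_term_bound {lam : ℝ} (hlam : -(1/2 : ℝ) < lam) {ρ C : ℝ} (hρ : 0 ≤ ρ) {b : ℕ → ℂ} (hb : Bd ρ C b)
    (t : ℝ) (l k : ℕ) : ‖((w0 lam * (t^(2*k) / al lam k) : ℝ) : ℂ) * b (l + k)‖ ≤
      w0 lam * C * ρ^(2*l) * ((ρ * t)^(2*k) / (2*k).factorial) := by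
  have h0 : 0 ≤ t^(2*k) := by rw [pow_mul]; positivity
  have hw := w0_pos hlam
  have ha := al_pos hlam k
  have h2 := al_ge hlam k
  have hC := hb.nonneg
  rw [norm_mul, Complex.norm_real, Real.norm_of_nonneg (by positivity)]
  calc _ ≤ w0 lam * (t^(2*k) / (2*k).factorial) * (C * ρ^(2*(l+k))) := by
        gcongr
        exact hb (l+k)
    _ = _ := by rw [mul_pow]; ring

lemma tr_summable {lam : ℝ} (hlam : -(1/2 : ℝ) < lam) {ρ C : ℝ} (hρ : 0 ≤ ρ) {b : ℕ → ℂ} (hb : Bd ρ C b)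
    (t : ℝ) (l : ℕ) : Summable fun k => ((w0 lam * (t^(2*k) / al lam k) : ℝ) : ℂ) * b (l + k) :=
  Summable.of_norm_bounded ((sum_cosh _).mul_left _) (tr_term_bound hlam hρ hb t l)

lemma tr_Bd {lam : ℝ} (hlam : -(1/2 : ℝ) < lam) {ρ C : ℝ} (hρ : 0 ≤ ρ) {b : ℕ → ℂ} (hb : Bd ρ C b)
    (t : ℝ) : Bd ρ (w0 lam * C * Real.cosh (ρ * t)) (tr lam t b) := by
  intro l
  refine (tsum_of_norm_bounded ((Real.hasSum_cosh (ρ * t)).mul_left _)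
    (tr_term_bound hlam hρ hb t l)).trans (le_of_eq ?_)
  ring

lemma T_sum2 {lam : ℝ} (hlam : -(1/2 : ℝ) < lam) {ρ C : ℝ} (hρ : 0 ≤ ρ) {b d : ℕ → ℂ} (hb : Bd ρ C b)
    (hd : Bd ρ C d) (t x : ℝ) :
    T lam t (fun x => P lam b d x) x = P lam (tr lam t b) (tr lam t d) x := by
  have hs := fam_summable hlam hρ hb hd t x
  rw [T_tsum hlam hρ hb hd, hs.tsum_prod, ← Summable.tsum_comm (f := fun k j => fam lam t b d x (k, j)) hs, ← tsum_mul_left, P]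
  congr 1
  ext j
  rw [tm, tr, tr, mul_div_assoc, mul_div_assoc, ← tsum_mul_right, ← tsum_mul_right,
    ← Summable.tsum_add, ← tsum_mul_left]
  · congr 1
    ext k
    simp only [fam, tm, sh]
    push_cast
    ring
  · exact (tr_summable hlam hρ hb t j).mul_right _
  · exact (tr_summable hlam hρ hd t j).mul_right _

lemma sh_tr (lam t : ℝ) (b : ℕ → ℂ) (k : ℕ) : sh k (tr lam t b) = tr lam t (sh k b) := by
  ext l
  simp only [sh, tr]
  congr 1
  ext j
  rw [add_right_comm]

lemma T_cont {lam : ℝ} (hlam : -(1/2 : ℝ) < lam) {ρ C : ℝ} (hρ : 0 ≤ ρ) {b d : ℕ → ℂ} (hb : Bd ρ C b)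
    (hd : Bd ρ C d) (t : ℝ) : Continuous (T lam t (fun x => P lam b d x)) := by
  rw [funext (T_sum2 hlam hρ hb hd t)]
  exact P_cont hlam hρ (tr_Bd hlam hρ hb t) (tr_Bd hlam hρ hd t)

lemma P_sum {ι : Type*} (s : Finset ι) {lam : ℝ} (hlam : -(1/2 : ℝ) < lam) {ρ : ℝ} {C : ι → ℝ} (hρ : 0 ≤ ρ)
    {b d : ι → ℕ → ℂ} (c : ι → ℂ)
    (hb : ∀ i, Bd ρ (C i) (b i)) (hd : ∀ i, Bd ρ (C i) (d i)) (z : ℂ) :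
    P lam (fun l => ∑ i ∈ s, c i * b i l) (fun l => ∑ i ∈ s, c i * d i l) z =
      ∑ i ∈ s, c i * P lam (b i) (d i) z := by
  simp only [P]
  simp_rw [← tsum_mul_left]
  rw [← Summable.tsum_finsetSum]
  · congr 1
    ext l
    simp only [tm, Finset.sum_mul, Finset.sum_div]
    rw [← Finset.sum_add_distrib]
    refine Finset.sum_congr rfl fun i _ => ?_
    ring
  · intro i _
    exact (tm_summable hlam hρ (hb i) (hd i) z).mul_left _

lemma Bd_sum {ι : Type*} (s : Finset ι) {ρ : ℝ} {C : ι → ℝ} (hρ : 0 ≤ ρ)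
    {b : ι → ℕ → ℂ} (c : ι → ℂ) (hb : ∀ i, Bd ρ (C i) (b i)) :
    Bd ρ (∑ i ∈ s, ‖c i‖ * C i) (fun l => ∑ i ∈ s, c i * b i l) := by
  intro l
  refine (norm_sum_le _ _).trans ?_
  rw [Finset.sum_mul]
  refine Finset.sum_le_sum fun i _ => ?_
  rw [norm_mul, mul_assoc]
  exact mul_le_mul_of_nonneg_left (hb i l) (norm_nonneg _)





lemma tm_deriv (lam : ℝ) (b d : ℕ → ℂ) (l : ℕ) (z : ℂ) :
    deriv (tm lam b d l) z = b l * ((2*l : ℕ) * z^(2*l-1)) / (al lam l : ℂ)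
      + d l * ((2*l+1 : ℕ) * z^(2*l)) / (al' lam l : ℂ) := by
  have h := ((((hasDerivAt_pow (2*l) z).const_mul (b l)).div_const (al lam l : ℂ)).add
    (((hasDerivAt_pow (2*l+1) z).const_mul (d l)).div_const (al' lam l : ℂ)))
  exact h.deriv

lemma Bd_zero {ρ C : ℝ} (hρ : 0 ≤ ρ) (hC : 0 ≤ C) : Bd ρ C 0 := by
  intro k
  simp only [Pi.zero_apply, norm_zero]
  positivity

lemma Dop_P {lam : ℝ} (hlam : -(1/2 : ℝ) < lam) {ρ C : ℝ} (hρ : 0 ≤ ρ) {b d : ℕ → ℂ} (hb : Bd ρ C b)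
    (hd : Bd ρ C d) {x : ℝ} (hx : x ≠ 0) :
    Dop lam (fun x : ℝ => P lam b d x) x = P lam d (sh 1 b) x := by
  have hxc : (x:ℂ) ≠ 0 := by exact_mod_cast hx
  have hD : deriv (fun x : ℝ => P lam b d x) x = deriv (P lam b d) x :=
    ((P_diff hlam hρ hb hd x).hasDerivAt.comp_ofReal).deriv
  have h1 : HasSum (fun l => deriv (tm lam b d l) x) (deriv (P lam b d) x) :=
    Complex.hasSum_deriv_of_summable_norm
    (F := fun l z => tm lam b d l z) (U := Metric.ball (0:ℂ) (‖(x:ℂ)‖+1))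
    ((sum_cosh (ρ * (‖(x:ℂ)‖+1))).mul_left (C * (1 + (‖(x:ℂ)‖+1))))
    (fun l => by unfold tm; fun_prop) Metric.isOpen_ball
    (fun l w hw => tm_bound hlam hρ hb hd l w (by
      rw [mem_ball_zero_iff] at hw; exact hw.le)) (by simp)
  have h2 := ((tm_summable hlam hρ hb hd x).hasSum.sub
    (tm_summable hlam hρ hb hd (-x : ℝ)).hasSum).mul_left ((lam + 1/2 : ℝ) : ℂ) |>.div_const (x:ℂ)
  have h3 := h1.add h2
  rw [Dop, hD]
  refine h3.unique ?_
  have hC := hb.nonneg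
  have hE := (tm_summable hlam hρ hd (Bd_zero hρ hC) x).hasSum
  have hO := (tm_summable hlam hρ (Bd_zero hρ (by positivity)) (hb.sh 1) x).hasSum
  have hO' : HasSum (fun l => b l * ((2*l : ℕ) * (x:ℂ)^(2*l-1)) / (al lam l : ℂ))
      (∑' l, tm lam 0 (sh 1 b) l x) := by
    rw [← hasSum_nat_add_iff' 1]
    simp only [Finset.sum_range_one, mul_zero, Nat.cast_zero, zero_mul, zero_div, sub_zero]
    refine hs_congr hO fun l => ?_
    have e := al_succ lam l
    have ha := (al'_pos hlam l).ne'
    rw [e]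
    have h4 : ((2 * l + 2 : ℝ)) ≠ 0 := by positivity
    have h4' : (2 * (l:ℂ) + 2) ≠ 0 := by exact_mod_cast h4
    have ha' : (al' lam l : ℂ) ≠ 0 := by exact_mod_cast ha
    simp only [tm, sh, Pi.zero_apply]
    rw [show 2 * (l+1) - 1 = 2 * l + 1 by omega]
    push_cast
    rw [show (2:ℂ) * (l + 1) = 2 * l + 2 by ring]
    field_simp
    ring
  have h5 : P lam d (sh 1 b) x = ∑' l, tm lam d 0 l x + ∑' l, tm lam 0 (sh 1 b) l x := by
    rw [P, ← Summable.tsum_add hE.summable hO.summable]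
    congr 1; ext l; simp [tm]
  rw [h5]
  refine hs_congr (hE.add hO') fun l => ?_
  rw [tm_deriv]
  simp only [tm, Pi.zero_apply]
  have ha : (al lam l : ℂ) ≠ 0 := by exact_mod_cast (al_pos hlam l).ne'
  have h6 : (1 + l + lam : ℝ) ≠ 0 := by
    have : (0:ℝ) ≤ l := by positivity
    linarith
  have h6' : (1 + (l:ℂ) + lam) ≠ 0 := by exact_mod_cast h6
  have e : (al' lam l : ℂ) = 2 * (1 + l + lam) * al lam l := by
    rw [al']; push_cast; ring
  rw [e]
  push_cast
  rw [Even.neg_pow (by simp), Odd.neg_pow (by simp), pow_succ]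
  field_simp
  ring

lemma Dop_congr {lam : ℝ} {F G : ℝ → ℂ} (h : ∀ x, x ≠ 0 → F x = G x) {x : ℝ} (hx : x ≠ 0) :
    Dop lam F x = Dop lam G x := by
  have h1 : F =ᶠ[nhds x] G := by
    filter_upwards [isOpen_ne.mem_nhds hx] with y hy using h y hy
  rw [Dop, Dop, h1.deriv_eq, h x hx, h (-x) (neg_ne_zero.2 hx)]

lemma lapIter_P {lam : ℝ} (hlam : -(1/2 : ℝ) < lam) {ρ C : ℝ} (hρ : 0 ≤ ρ) {b d : ℕ → ℂ} (hb : Bd ρ C b)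
    (hd : Bd ρ C d) (m : ℕ) {x : ℝ} (hx : x ≠ 0) :
    lapIter lam m (fun x : ℝ => P lam b d x) x = P lam (sh m b) (sh m d) x := by
  induction m generalizing x with
  | zero => simp [lapIter]; rfl
  | succ m ih =>
    have e : lapIter lam (m+1) (fun x : ℝ => P lam b d x) =
      Dop lam (Dop lam (lapIter lam m (fun x : ℝ => P lam b d x))) := by
      simp only [lapIter, Function.iterate_succ', Function.comp]
    rw [e]
    have hb' := hb.sh m
    have hd' := hd.sh m
    have hC := hb'.nonneg
    have e1 : ∀ y : ℝ, y ≠ 0 → Dop lam (lapIter lam m (fun x : ℝ => P lam b d x)) y =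
        P lam (sh m d) (sh 1 (sh m b)) y := fun y hy => by
      rw [Dop_congr (fun z hz => ih hz) hy]
      exact Dop_P hlam hρ hb' hd' hy
    rw [Dop_congr e1 hx]
    have hb2 := hb'.sh 1
    rw [Dop_P hlam hρ (hd'.mono hρ (le_max_left _ (C * ρ^(2*m) * ρ^(2*1))))
      (hb2.mono hρ (le_max_right _ _)) hx]
    congr 1 <;> (ext l; simp only [sh]; congr 1; ring)

lemma al_le {lam : ℝ} (hlam : -(1/2 : ℝ) < lam) {N : ℕ} (hN : 2 * lam + 1 ≤ N) (l : ℕ) :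
    al lam l ≤ (2*l).factorial * ((l:ℝ)+1)^N := by
  induction l with
  | zero => simp [al]
  | succ l ih =>
    have h1 : 2 * (l:ℝ) + 2 * lam + 2 ≤ (2 * l + 1) * (1 + N * (1 / ((l:ℝ)+1))) := by
      have hl : (0:ℝ) ≤ l := by positivity
      have : (N:ℝ) ≤ (2 * l + 1) * (N * (1 / ((l:ℝ)+1))) := by
        rw [mul_one_div, mul_div_assoc', le_div_iff₀ (by positivity)]
        nlinarith [Nat.cast_nonneg (α := ℝ) N, mul_nonneg (Nat.cast_nonneg (α := ℝ) N) hl]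
      nlinarith
    have h2 : 1 + N * (1 / ((l:ℝ)+1)) ≤ (1 + 1 / ((l:ℝ)+1))^N :=
      one_add_mul_le_pow (by have : 0 ≤ 1 / ((l:ℝ)+1) := by positivity
                             linarith) N
    have h3 : (1 + 1 / ((l:ℝ)+1))^N * ((l:ℝ)+1)^N = ((l:ℝ)+1+1)^N := by
      rw [← mul_pow]; congr 1; field_simp
    rw [al, show 2 * (l+1) = 2 * l + 1 + 1 by ring, Nat.factorial_succ, Nat.factorial_succ]
    push_cast
    have h4 : (0:ℝ) ≤ 2 * l + 2 * lam + 2 := by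
      have hl : (0:ℝ) ≤ l := by positivity
      linarith
    calc (2 * (l:ℝ) + 2) * (2 * l + 2 * lam + 2) * al lam l
        ≤ (2 * (l:ℝ) + 2) * (2 * l + 2 * lam + 2) * ((2*l).factorial * ((l:ℝ)+1)^N) := by gcongr
      _ ≤ (2 * (l:ℝ) + 2) * ((2 * l + 1) * (1 + 1 / ((l:ℝ)+1))^N) * ((2*l).factorial * ((l:ℝ)+1)^N) := by
          gcongr
          exact h1.trans (by gcongr)
      _ = _ := by rw [← h3]; ring

lemma poly_le_pow (N : ℕ) {q : ℝ} (hq : 1 < q) : ∃ C : ℝ, 0 < C ∧ ∀ l : ℕ, ((l:ℝ)+1)^N ≤ C * q^l := by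
  have h := (isLittleO_pow_const_const_pow_of_one_lt (R := ℝ) N hq).isBigO
  have h' := (h.comp_tendsto (Filter.tendsto_add_atTop_nat 1))
  rw [← Nat.cofinite_eq_atTop] at h'
  obtain ⟨C, hC, hb⟩ := Asymptotics.bound_of_isBigO_cofinite h'
  refine ⟨C * q, by positivity, fun l => ?_⟩
  have := hb (x := l) (by simp [Function.comp]; positivity)
  simp only [Function.comp, norm_pow, Real.norm_eq_abs, abs_of_pos (zero_lt_one.trans hq)] at this
  rw [abs_of_nonneg (by positivity)] at this
  push_cast at this
  refine this.trans (le_of_eq (by ring))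

/-- From exponential growth of `u r^n` deduce a factorial bound. -/
lemma fact_of_exp {u c κ ρ : ℝ} (hκ : 0 ≤ κ) (hρ : κ < ρ) (n : ℕ)
    (h : ∀ r : ℝ, 0 < r → u * r^n ≤ c * Real.exp (κ * r)) :
    u * n.factorial ≤ c * ρ / (ρ - κ) * ρ^n := by
  have hρ0 : 0 < ρ := lt_of_le_of_lt hκ hρ
  have i1 : ∫ r in Set.Ioi (0:ℝ), r^(((n:ℝ)+1)-1) * Real.exp (-(ρ * r)) = (1/ρ)^((n:ℝ)+1) * Real.Gamma ((n:ℝ)+1) :=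
    Real.integral_rpow_mul_exp_neg_mul_Ioi (by positivity) hρ0
  have e0 : ∀ r : ℝ, r^(((n:ℝ)+1)-1) = r^n := fun r => by
    rw [add_sub_cancel_right, Real.rpow_natCast]
  simp_rw [e0] at i1
  rw [Real.Gamma_nat_eq_factorial, show (n:ℝ)+1 = ((n+1:ℕ):ℝ) by push_cast; ring, Real.rpow_natCast] at i1
  have i2 : ∫ r in Set.Ioi (0:ℝ), Real.exp (-((ρ-κ) * r)) = 1 / (ρ-κ) := by
    have := integral_exp_mul_Ioi (a := -(ρ-κ)) (by linarith) 0
    simp only [mul_zero, Real.exp_zero] at this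
    simp_rw [← neg_mul]
    rw [this, neg_div_neg_eq]
  have j1 : IntegrableOn (fun r : ℝ => r^n * Real.exp (-(ρ * r))) (Set.Ioi 0) := by
    refine Integrable.of_integral_ne_zero ?_
    rw [i1]; positivity
  have j2 : IntegrableOn (fun r : ℝ => Real.exp (-((ρ-κ) * r))) (Set.Ioi 0) := by
    refine Integrable.of_integral_ne_zero ?_
    rw [i2]
    have : 0 < ρ - κ := by linarith
    positivity
  have h2 : ∫ r in Set.Ioi (0:ℝ), u * (r^n * Real.exp (-(ρ * r))) ≤
      ∫ r in Set.Ioi (0:ℝ), c * Real.exp (-((ρ-κ) * r)) := by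
    refine setIntegral_mono_on (j1.const_mul u) (j2.const_mul c) measurableSet_Ioi fun r hr => ?_
    have h3 := mul_le_mul_of_nonneg_right (h r hr) (Real.exp_pos (-(ρ * r))).le
    calc u * (r^n * Real.exp (-(ρ * r))) = u * r^n * Real.exp (-(ρ * r)) := by ring
      _ ≤ _ := h3
      _ = c * Real.exp (-((ρ-κ) * r)) := by
        rw [mul_assoc, ← Real.exp_add]; congr 2; ring
  rw [integral_const_mul, integral_const_mul, i1, i2] at h2
  have h5 : 0 < ρ - κ := by linarith
  have h4 := mul_le_mul_of_nonneg_right h2 (show 0 ≤ ρ^(n+1) by positivity)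
  calc u * n.factorial = u * ((1/ρ)^(n+1) * n.factorial) * ρ^(n+1) := by
        rw [div_pow, one_pow]; field_simp
    _ ≤ _ := h4
    _ = _ := by rw [pow_succ]; field_simp

lemma expand_coef {σ : ℝ} (hσ : 0 < σ) {f : ℂ → ℂ} (hf : IsExpType σ f) :
    ∃ C : ℝ, 0 ≤ C ∧ ∀ n, ‖iteratedDeriv n f 0‖ ≤ C * (11/10*σ)^n := by
  obtain ⟨c, hc⟩ := hf.2 (σ/20) (by positivity)
  have hd : Differentiable ℂ f := fun z => (hf.1 z (Set.mem_univ z)).differentiableAt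
  have hc0 : 0 ≤ c := by
    have := (norm_nonneg _).trans (hc 0)
    simpa using this
  refine ⟨c * (11/10*σ) / (11/10*σ - (σ+σ/20)), div_nonneg (by positivity) (by linarith), fun n => ?_⟩
  have h := fact_of_exp (u := ‖iteratedDeriv n f 0‖ / n.factorial) (c := c) (κ := σ+σ/20) (ρ := 11/10*σ)
    (by positivity) (by linarith) n (by
      intro r hr
      have h1 := Complex.norm_iteratedDeriv_le_of_forall_mem_sphere_norm_le n hr (f := f) (c := 0)
        (C := c * Real.exp ((σ + σ/20) * r)) hd.diffContOnCl (by
          intro z hz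
          have := hc z
          rwa [mem_sphere_zero_iff_norm.1 hz] at this)
      rw [div_mul_eq_mul_div, div_le_iff₀ (by positivity)]
      rw [le_div_iff₀ (by positivity)] at h1
      linarith)
  rwa [div_mul_cancel₀ _ (by positivity)] at h

lemma expand_r1 {lam : ℝ} (hlam : -(1/2 : ℝ) < lam) : ∃ K : ℝ, 0 < K ∧
    ∀ l : ℕ, al lam l / ((2*l).factorial : ℝ) ≤ K * (12/11:ℝ)^(2*l) := by
  obtain ⟨N, hN⟩ := exists_nat_ge (2*lam+1)
  obtain ⟨K, hK, hpoly⟩ := poly_le_pow N (q := 12/11) (by norm_num)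
  have hq : ∀ l : ℕ, (12/11:ℝ)^l ≤ (12/11:ℝ)^(2*l) := fun l => pow_le_pow_right₀ (by norm_num) (by omega)
  refine ⟨K, hK, fun l => ?_⟩
  rw [div_le_iff₀ (by positivity)]
  calc al lam l ≤ (2*l).factorial * ((l:ℝ)+1)^N := al_le hlam hN l
    _ ≤ (2*l).factorial * (K * (12/11:ℝ)^(2*l)) := 
      mul_le_mul_of_nonneg_left ((hpoly l).trans (mul_le_mul_of_nonneg_left (hq l) hK.le)) (by positivity)
    _ = _ := by ring

lemma expand_r2 {lam : ℝ} (hlam : -(1/2 : ℝ) < lam) {K : ℝ} (hK : 0 < K)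
    (r1 : ∀ l : ℕ, al lam l / ((2*l).factorial : ℝ) ≤ K * (12/11:ℝ)^(2*l)) (l : ℕ) :
    al' lam l / ((2*l+1).factorial : ℝ) ≤ (2*lam+2) * K * (12/11:ℝ)^(2*l) := by
  have h1 : al' lam l / ((2*l+1).factorial : ℝ) = (2*l+2*lam+2)/(2*l+1) * (al lam l / ((2*l).factorial : ℝ)) := by
    rw [Nat.factorial_succ, al']; push_cast; field_simp
  have h2 : (2*l+2*lam+2)/(2*(l:ℝ)+1) ≤ 2*lam+2 := by
    rw [div_le_iff₀ (by positivity)]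
    have : (0:ℝ) ≤ l := by positivity
    nlinarith
  rw [h1, mul_assoc]
  have := al_pos hlam l
  exact mul_le_mul h2 (r1 l) (by positivity) (by linarith)

lemma expand_B1 {lam : ℝ} (hlam : -(1/2 : ℝ) < lam) {K C σ : ℝ} (hK : 0 < K)
    (r1 : ∀ l : ℕ, al lam l / ((2*l).factorial : ℝ) ≤ K * (12/11:ℝ)^(2*l))
    {u : ℕ → ℂ} (hu : ∀ n, ‖u n‖ ≤ C * (11/10*σ)^n) :
    Bd (6/5*σ) (K*C) (fun l => al lam l / ((2*l).factorial : ℂ) * u (2*l)) := by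
  intro l
  have ha := al_pos hlam l
  rw [norm_mul, norm_div, Complex.norm_real, Complex.norm_natCast, Real.norm_of_nonneg ha.le]
  calc _ ≤ (K * (12/11:ℝ)^(2*l)) * (C * (11/10*σ)^(2*l)) :=
        mul_le_mul (r1 l) (hu _) (norm_nonneg _) (by positivity)
    _ = K * C * ((12/11)*(11/10*σ))^(2*l) := by rw [mul_pow (12/11:ℝ)]; ring
    _ = _ := by rw [show (12/11)*(11/10*σ) = 6/5*σ by ring]

lemma expand_B2 {lam : ℝ} (hlam : -(1/2 : ℝ) < lam) {K C σ : ℝ} (hK : 0 < K)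
    (r2 : ∀ l : ℕ, al' lam l / ((2*l+1).factorial : ℝ) ≤ (2*lam+2) * K * (12/11:ℝ)^(2*l))
    {u : ℕ → ℂ} (hu : ∀ n, ‖u n‖ ≤ C * (11/10*σ)^n) :
    Bd (6/5*σ) ((2*lam+2)*K*C*(11/10*σ)) (fun l => al' lam l / ((2*l+1).factorial : ℂ) * u (2*l+1)) := by
  intro l
  have ha := al'_pos hlam l
  have h2 : 0 ≤ 2*lam+2 := by linarith
  rw [norm_mul, norm_div, Complex.norm_real, Complex.norm_natCast, Real.norm_of_nonneg ha.le]
  calc _ ≤ ((2*lam+2) * K * (12/11:ℝ)^(2*l)) * (C * (11/10*σ)^(2*l+1)) :=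
        mul_le_mul (r2 l) (hu _) (norm_nonneg _) (by positivity)
    _ = (2*lam+2) * K * C * (11/10*σ) * ((12/11)*(11/10*σ))^(2*l) := by rw [mul_pow (12/11:ℝ), pow_succ]; ring
    _ = _ := by rw [show (12/11)*(11/10*σ) = 6/5*σ by ring]

lemma even_odd_hasSum {u : ℕ → ℂ} {s : ℂ} (h : HasSum u s) : s = ∑' l, (u (2*l) + u (2*l+1)) := by
  have hs := h.summable
  have s1 : Summable fun k => u (2*k) := hs.comp_injective (i := fun k => 2*k) (fun a b h => by simpa using h)
  have s2 : Summable fun k => u (2*k+1) := hs.comp_injective (i := fun k => 2*k+1) (fun a b h => by simpa using h)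
  rw [Summable.tsum_add s1 s2, tsum_even_add_odd s1 s2, h.tsum_eq]

lemma expand_alg (A A' F G X Y z1 z2 : ℂ) (hA : A ≠ 0) (hA' : A' ≠ 0) :
    F⁻¹ * z1 * X + G⁻¹ * z2 * Y = A / F * X * z1 / A + A' / G * Y * z2 / A' := by
  have e1 : A / F * X * z1 / A = (A * A⁻¹) * (F⁻¹ * z1 * X) := by ring
  have e2 : A' / G * Y * z2 / A' = (A' * A'⁻¹) * (G⁻¹ * z2 * Y) := by ring
  rw [e1, e2, mul_inv_cancel₀ hA, mul_inv_cancel₀ hA', one_mul, one_mul]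

lemma expand_P {lam : ℝ} (hlam : -(1/2 : ℝ) < lam) {f : ℂ → ℂ} (hd : Differentiable ℂ f) (z : ℂ) :
    f z = P lam (fun l => al lam l / ((2*l).factorial : ℂ) * iteratedDeriv (2*l) f 0)
      (fun l => al' lam l / ((2*l+1).factorial : ℂ) * iteratedDeriv (2*l+1) f 0) z := by
  have h := Complex.hasSum_taylorSeries_of_entire hd 0 z
  have h' := even_odd_hasSum h
  refine h'.trans (tsum_congr fun l => ?_)
  have ha : (al lam l : ℂ) ≠ 0 := by exact_mod_cast (al_pos hlam l).ne'
  have ha' : (al' lam l : ℂ) ≠ 0 := by exact_mod_cast (al'_pos hlam l).ne'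
  simp only [smul_eq_mul, sub_zero, tm, ← mul_assoc]
  exact expand_alg _ _ _ _ _ _ _ _ ha ha'

lemma expand {lam : ℝ} (hlam : -(1/2 : ℝ) < lam) {σ : ℝ} (hσ : 0 < σ) {f : ℂ → ℂ} (hf : IsExpType σ f) :
    ∃ (b d : ℕ → ℂ) (C : ℝ), Bd (6/5*σ) C b ∧ Bd (6/5*σ) C d ∧ ∀ z, f z = P lam b d z := by
  obtain ⟨C, hC, hcoef⟩ := expand_coef hσ hf
  have hd : Differentiable ℂ f := fun z => (hf.1 z (Set.mem_univ z)).differentiableAt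
  obtain ⟨K, hK, r1⟩ := expand_r1 hlam
  have r2 := expand_r2 hlam hK r1
  have hρ : 0 ≤ 6/5*σ := by positivity
  exact ⟨_, _, max (K*C) ((2*lam+2)*K*C*(11/10*σ)), (expand_B1 hlam hK r1 hcoef).mono hρ (le_max_left _ _),
    (expand_B2 hlam hK r2 hcoef).mono hρ (le_max_right _ _), expand_P hlam hd⟩



/-- the radius -/
def AA (t x φ : ℝ) : ℝ := Real.sqrt (x ^ 2 + t ^ 2 - 2 * x * t * Real.cos φ)

lemma AA_cont (t : ℝ) : Continuous (fun q : ℝ × ℝ => AA t q.1 q.2) := by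
  unfold AA; fun_prop

lemma lintegral_om {lam : ℝ} {G : ℝ → ℝ≥0∞} (hG : Measurable G) :
    ∫⁻ φ, G φ ∂(om lam) = ∫⁻ φ in Set.Ioo 0 Real.pi, ENNReal.ofReal (clam lam * Real.sin φ ^ (2 * lam)) * G φ := by
  rw [om, lintegral_withDensity_eq_lintegral_mul _ (om_dens_meas lam).ennreal_ofReal hG]
  rfl

lemma μw_dens_meas (lam : ℝ) : Measurable fun x : ℝ => ENNReal.ofReal (blam lam / 2 * |x| ^ (2 * lam + 1)) :=
  (((measurable_id.abs).pow_const _).const_mul _).ennreal_ofReal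

lemma lintegral_μ {lam : ℝ} (hlam : -(1/2 : ℝ) < lam) {G : ℝ → ℝ≥0∞} (hG : Measurable G) :
    ∫⁻ x, G x ∂(μw lam) = ENNReal.ofReal (blam lam / 2) *
      ((∫⁻ r in Set.Ioi (0:ℝ), ENNReal.ofReal (r^(2*lam+1)) * G r) +
       (∫⁻ r in Set.Ioi (0:ℝ), ENNReal.ofReal (r^(2*lam+1)) * G (-r))) := by
  have hb := blam_pos hlam
  rw [μw, lintegral_withDensity_eq_lintegral_mul _ (μw_dens_meas lam) hG]
  have hm : Measurable fun x : ℝ => ENNReal.ofReal (|x| ^ (2 * lam + 1)) * G x :=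
    ((measurable_id.abs).pow_const _).ennreal_ofReal.mul hG
  have e1 : ∫⁻ x, ((fun x : ℝ => ENNReal.ofReal (blam lam / 2 * |x| ^ (2 * lam + 1))) * G) x
      = ENNReal.ofReal (blam lam / 2) * ∫⁻ x, ENNReal.ofReal (|x| ^ (2 * lam + 1)) * G x := by
    rw [← lintegral_const_mul _ hm]
    refine lintegral_congr fun x => ?_
    simp only [Pi.mul_apply]
    rw [ENNReal.ofReal_mul (by positivity), mul_assoc]
  rw [e1, ← lintegral_add_compl _ (measurableSet_Ioi (a := (0:ℝ)))]
  congr 2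
  · refine setLIntegral_congr_fun measurableSet_Ioi fun r hr => ?_
    simp only [abs_of_pos (Set.mem_Ioi.1 hr)]
  · rw [Set.compl_Ioi, setLIntegral_congr (Iio_ae_eq_Iic (a := (0:ℝ)) (μ := volume)).symm]
    have := (Measure.measurePreserving_neg (volume : Measure ℝ)).setLIntegral_comp_preimage
      (measurableSet_Iio (a := (0:ℝ))) hm
    rw [← this]
    have e : (Neg.neg : ℝ → ℝ) ⁻¹' Set.Iio 0 = Set.Ioi 0 := by ext x; simp
    rw [e]
    refine setLIntegral_congr_fun measurableSet_Ioi fun r hr => ?_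
    simp only [abs_neg, abs_of_pos (Set.mem_Ioi.1 hr)]

/-- the half-plane integrand -/
def hpi (lam : ℝ) (h : ℝ → ℝ≥0∞) (q : ℝ × ℝ) : ℝ≥0∞ :=
  h (Real.sqrt (q.1^2 + q.2^2)) * (Set.Ioi (0:ℝ)).indicator (fun y => ENNReal.ofReal (clam lam * y^(2*lam))) q.2

lemma hpi_meas {lam : ℝ} {h : ℝ → ℝ≥0∞} (hh : Measurable h) : Measurable (hpi lam h) := by
  unfold hpi
  refine (hh.comp (by fun_prop)).mul ?_
  refine Measurable.comp (g := (Set.Ioi (0:ℝ)).indicator (fun y => ENNReal.ofReal (clam lam * y^(2*lam)))) ?_ measurable_snd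
  exact (((measurable_id.pow_const _).const_mul _).ennreal_ofReal).indicator measurableSet_Ioi

lemma polar_om {lam : ℝ} (hlam : -(1/2 : ℝ) < lam) {h : ℝ → ℝ≥0∞} (hh : Measurable h) (t : ℝ) :
    ∫⁻ r in Set.Ioi (0:ℝ), ENNReal.ofReal (r^(2*lam+1)) * ∫⁻ φ, h (AA t r φ) ∂(om lam) =
      ∫⁻ q : ℝ × ℝ, hpi lam h (q.1 - t, q.2) := by
  have hc := clam_pos hlam
  have hm : Measurable fun q : ℝ × ℝ => hpi lam h (q.1 - t, q.2) := (hpi_meas hh).comp (by fun_prop)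
  rw [← lintegral_comp_polarCoord_symm]
  have htar : polarCoord.target = Set.Ioi (0:ℝ) ×ˢ Set.Ioo (-Real.pi) Real.pi := rfl
  rw [htar, Measure.volume_eq_prod, ← Measure.prod_restrict, lintegral_prod]
  swap
  · refine Measurable.aemeasurable ?_
    simp only [polarCoord_symm_apply, smul_eq_mul]
    refine (measurable_fst.ennreal_ofReal).mul ((hpi_meas hh).comp ?_)
    fun_prop
  refine setLIntegral_congr_fun measurableSet_Ioi fun r hr => ?_
  have hr : 0 < r := hr
  have hAm : Measurable fun φ => h (AA t r φ) := hh.comp (by unfold AA; fun_prop)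
  simp only
  rw [lintegral_om hAm]
  have hm2 : Measurable fun φ => ENNReal.ofReal (clam lam * Real.sin φ ^ (2 * lam)) * h (AA t r φ) :=
    (om_dens_meas lam).ennreal_ofReal.mul hAm
  rw [← lintegral_const_mul _ hm2, ← lintegral_indicator measurableSet_Ioo, ← lintegral_indicator measurableSet_Ioo]
  refine lintegral_congr fun φ => ?_
  by_cases h1 : φ ∈ Set.Ioo 0 Real.pi
  · have h2 : φ ∈ Set.Ioo (-Real.pi) Real.pi := ⟨by linarith [h1.1, Real.pi_pos], h1.2⟩
    have hs : 0 < Real.sin φ := Real.sin_pos_of_mem_Ioo h1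
    have hrs : r * Real.sin φ ∈ Set.Ioi (0:ℝ) := mul_pos hr hs
    rw [Set.indicator_of_mem h1, Set.indicator_of_mem h2]
    simp only [polarCoord_symm_apply, smul_eq_mul, hpi]
    rw [Set.indicator_of_mem hrs]
    have e1 : (r * Real.cos φ - t)^2 + (r * Real.sin φ)^2 = r^2 + t^2 - 2*r*t*Real.cos φ := by
      have := Real.sin_sq_add_cos_sq φ
      linear_combination r^2 * this
    rw [e1, Real.mul_rpow hr.le hs.le, Real.rpow_add hr, Real.rpow_one]
    rw [show clam lam * (r ^ (2*lam) * Real.sin φ ^ (2*lam)) = r ^ (2*lam) * (clam lam * Real.sin φ ^ (2*lam)) by ring]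
    rw [ENNReal.ofReal_mul (p := r ^ (2*lam)) (by positivity), ENNReal.ofReal_mul (p := r ^ (2*lam)) (q := clam lam * Real.sin φ ^ (2*lam)) (by positivity), AA]
    ring
  · rw [Set.indicator_of_notMem h1]
    by_cases h2 : φ ∈ Set.Ioo (-Real.pi) Real.pi
    · rw [Set.indicator_of_mem h2]
      have h3 : φ ≤ 0 := by
        by_contra h4; exact h1 ⟨not_le.1 h4, h2.2⟩
      have hs : Real.sin φ ≤ 0 := Real.sin_nonpos_of_nonpos_of_neg_pi_le h3 h2.1.le
      have hrs : r * Real.sin φ ∉ Set.Ioi (0:ℝ) := fun h5 => by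
        have := mul_nonpos_of_nonneg_of_nonpos hr.le hs
        exact absurd (Set.mem_Ioi.1 h5) (not_lt.2 this)
      simp only [polarCoord_symm_apply, smul_eq_mul, hpi]
      rw [Set.indicator_of_notMem hrs, mul_zero, mul_zero]
    · rw [Set.indicator_of_notMem h2]

lemma polar_inv {lam : ℝ} (hlam : -(1/2 : ℝ) < lam) {h : ℝ → ℝ≥0∞} (hh : Measurable h) (t : ℝ) :
    ∫⁻ r in Set.Ioi (0:ℝ), ENNReal.ofReal (r^(2*lam+1)) * ∫⁻ φ, h (AA t r φ) ∂(om lam) =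
    ∫⁻ r in Set.Ioi (0:ℝ), ENNReal.ofReal (r^(2*lam+1)) * ∫⁻ φ, h (AA 0 r φ) ∂(om lam) := by
  rw [polar_om hlam hh, polar_om hlam hh]
  have h1 := lintegral_sub_right_eq_self (μ := (volume : Measure (ℝ × ℝ))) (hpi lam h) (t, 0)
  have h2 := lintegral_sub_right_eq_self (μ := (volume : Measure (ℝ × ℝ))) (hpi lam h) (0, 0)
  simp only [Prod.sub_def, sub_zero] at h1 h2 ⊢
  rw [h1]

lemma AA_neg (t r φ : ℝ) : AA t (-r) φ = AA (-t) r φ := by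
  unfold AA; congr 1; ring

lemma AA_zero (x φ : ℝ) : AA 0 x φ = |x| := by
  unfold AA; rw [← Real.sqrt_sq_eq_abs]; congr 1; ring

lemma abs_meas : Measurable fun x : ℝ => |x| := measurable_id.abs

lemma AA_avg {lam : ℝ} (hlam : -(1/2 : ℝ) < lam) {h : ℝ → ℝ≥0∞} (hh : Measurable h) (t : ℝ) :
    ∫⁻ x, ∫⁻ φ, h (AA t x φ) ∂(om lam) ∂(μw lam) = (om lam) Set.univ * ∫⁻ x, h |x| ∂(μw lam) := by
  have := om_finite hlam
  have hm : ∀ t, Measurable fun x => ∫⁻ φ, h (AA t x φ) ∂(om lam) := fun t =>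
    Measurable.lintegral_prod_right (f := fun x φ => h (AA t x φ)) (hh.comp (AA_cont t).measurable)
  have key : ∫⁻ x, ∫⁻ φ, h (AA t x φ) ∂(om lam) ∂(μw lam) = ∫⁻ x, ∫⁻ φ, h (AA 0 x φ) ∂(om lam) ∂(μw lam) := by
    rw [lintegral_μ hlam (hm t), lintegral_μ hlam (hm 0), polar_inv hlam hh t]
    simp_rw [AA_neg]
    rw [polar_inv hlam hh (-t), neg_zero]
  rw [key]
  simp_rw [AA_zero, lintegral_const]
  have hm3 : Measurable fun x : ℝ => h |x| := hh.comp abs_meas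
  rw [lintegral_mul_const _ hm3, mul_comm]

instance sf (lam : ℝ) : SFinite (μw lam) := by unfold μw; infer_instance

lemma AA_map {lam : ℝ} (hlam : -(1/2 : ℝ) < lam) (t : ℝ) :
    Measure.map (fun q : ℝ × ℝ => AA t q.1 q.2) ((μw lam).prod (om lam)) =
      (om lam) Set.univ • Measure.map (fun x => |x|) (μw lam) := by
  have := om_finite hlam
  ext E hE
  have hi : Measurable (E.indicator (fun _ => (1:ℝ≥0∞))) := measurable_const.indicator hE
  have hi2 : Measurable fun q : ℝ × ℝ => E.indicator (fun _ => (1:ℝ≥0∞)) (AA t q.1 q.2) := hi.comp (AA_cont t).measurable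
  rw [← lintegral_indicator_one hE, Pi.one_def, lintegral_map hi (AA_cont t).measurable, lintegral_prod _ hi2.aemeasurable]
  have h2 := AA_avg hlam hi t
  rw [h2, Measure.smul_apply, smul_eq_mul, ← lintegral_indicator_one hE, Pi.one_def, lintegral_map hi abs_meas]

lemma μw_neg (lam : ℝ) : MeasurePreserving (Neg.neg : ℝ → ℝ) (μw lam) (μw lam) := by
  refine ⟨measurable_neg, ?_⟩
  ext E hE
  rw [Measure.map_apply measurable_neg hE, μw, withDensity_apply _ hE, withDensity_apply _ (measurable_neg hE)]
  have := (Measure.measurePreserving_neg (volume : Measure ℝ)).setLIntegral_comp_preimage hE (μw_dens_meas lam)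
  rw [← this]
  simp only [abs_neg]

lemma rpow_le_max (W p : ℝ≥0∞) (hp : 1 ≤ p) : W ^ (1 / p).toReal ≤ max 1 W := by
  have h1 : (1 / p).toReal ≤ 1 := by
    have : 1 / p ≤ 1 := by rw [one_div]; exact ENNReal.inv_le_one.2 hp
    exact ENNReal.toReal_le_of_le_ofReal (by norm_num) (by simpa using this)
  calc W ^ (1 / p).toReal ≤ (max 1 W) ^ (1 / p).toReal :=
        ENNReal.rpow_le_rpow (le_max_right _ _) ENNReal.toReal_nonneg
    _ ≤ (max 1 W) ^ (1:ℝ) := ENNReal.rpow_le_rpow_of_exponent_le (le_max_left _ _) h1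
    _ = _ := ENNReal.rpow_one _

lemma B_abs (x t φ : ℝ) : |(x - t * Real.cos φ) / AA t x φ| ≤ 1 := by
  rw [abs_div]
  refine div_le_one_of_le₀ ?_ (abs_nonneg _)
  rw [AA, abs_of_nonneg (Real.sqrt_nonneg _)]
  refine Real.abs_le_sqrt ?_
  have := Real.sin_sq_add_cos_sq φ
  nlinarith [mul_nonneg (sq_nonneg t) (sq_nonneg (Real.sin φ))]

lemma T_le {lam : ℝ} (hlam : -(1/2 : ℝ) < lam) (t : ℝ) (F : ℝ → ℂ) (x : ℝ) :
    ‖T lam t F x‖ₑ ≤ ∫⁻ φ, ‖(‖F (AA t x φ)‖ + ‖F (-AA t x φ)‖ : ℝ)‖ₑ ∂(om lam) := by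
  rw [T_eq hlam, ← integral_const_mul]
  refine (enorm_integral_le_lintegral_enorm _).trans (lintegral_mono fun φ => ?_)
  rw [enorm_le_iff_norm_le]
  have hB := B_abs x t φ
  change ‖(1/2:ℂ) * (F (AA t x φ) * (1 + (((x - t * Real.cos φ) / AA t x φ : ℝ) : ℂ)) +
    F (-AA t x φ) * (1 - (((x - t * Real.cos φ) / AA t x φ : ℝ) : ℂ)))‖ ≤ _
  generalize (x - t * Real.cos φ) / AA t x φ = B at *
  have n1 : ‖(1:ℂ) + (B:ℂ)‖ ≤ 2 := by
    refine (norm_add_le _ _).trans ?_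
    rw [norm_one, Complex.norm_real, Real.norm_eq_abs]; linarith
  have n2 : ‖(1:ℂ) - (B:ℂ)‖ ≤ 2 := by
    refine (norm_sub_le _ _).trans ?_
    rw [norm_one, Complex.norm_real, Real.norm_eq_abs]; linarith
  rw [Real.norm_of_nonneg (by positivity), norm_mul]
  have n3 := norm_add_le (F (AA t x φ) * (1 + (B:ℂ))) (F (-AA t x φ) * (1 - (B:ℂ)))
  rw [norm_mul, norm_mul] at n3
  have n4 := mul_le_mul_of_nonneg_left n1 (norm_nonneg (F (AA t x φ)))
  have n5 := mul_le_mul_of_nonneg_left n2 (norm_nonneg (F (-AA t x φ)))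
  have : ‖(1/2:ℂ)‖ = 1/2 := by norm_num
  rw [this]
  linarith

lemma pairing {lam : ℝ} (hlam : -(1/2 : ℝ) < lam) : ∃ K : ℝ, 0 < K ∧ ∀ (F : ℝ → ℂ), Continuous F →
    ∀ g : ℝ → ℂ, Measurable g → ∀ (p q : ℝ≥0∞) [ENNReal.HolderTriple p q 1], 1 ≤ p → 1 ≤ q → ∀ t : ℝ,
    ‖∫ x, T lam t F x * g x ∂(μw lam)‖ₑ ≤ ENNReal.ofReal K * eLpNorm F p (μw lam) * eLpNorm g q (μw lam) := by
  have := om_finite hlam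
  set W : ℝ≥0∞ := max 1 ((om lam) Set.univ) with hW
  have hWt : W ≠ ⊤ := max_ne_top (by simp) (measure_ne_top _ _)
  have hW1 : 1 ≤ W := le_max_left _ _
  have hWp : 0 < W.toReal := ENNReal.toReal_pos (by positivity) hWt
  refine ⟨2 * (W.toReal * W.toReal), by positivity, fun F hF g hg p q _ hp hq t => ?_⟩
  set N : ℝ → ℝ := fun r => ‖F r‖ + ‖F (-r)‖ with hN
  have hNc : Continuous N := by fun_prop
  set A : ℝ × ℝ → ℝ := fun z => AA t z.1 z.2
  have hA : Continuous A := AA_cont t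
  have hne : (om lam) Set.univ ≠ 0 := fun h => by
    have := w0_pos hlam
    rw [w0, measureReal_def, h] at this
    simp at this
  -- the two norms on the product space
  have a1 : eLpNorm (N ∘ A) p ((μw lam).prod (om lam)) ≤ W * (2 * eLpNorm F p (μw lam)) := by
    rw [← eLpNorm_map_measure hNc.aestronglyMeasurable hA.measurable.aemeasurable, AA_map hlam,
      eLpNorm_smul_measure_of_ne_zero hne, eLpNorm_map_measure hNc.aestronglyMeasurable abs_meas.aemeasurable, smul_eq_mul]
    refine mul_le_mul' (rpow_le_max _ _ hp) ?_
    have e1 : N ∘ (fun x : ℝ => |x|) = (fun x => ‖F x‖) + (fun x => ‖F (-x)‖) := by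
      ext x
      simp only [hN, Function.comp, Pi.add_apply]
      rcases le_total 0 x with h | h
      · rw [abs_of_nonneg h]
      · rw [abs_of_nonpos h, neg_neg, add_comm]
    rw [e1]
    refine (eLpNorm_add_le (by fun_prop) (by fun_prop) hp).trans ?_
    rw [eLpNorm_norm, two_mul]
    have e2 : eLpNorm (fun x => ‖F (-x)‖) p (μw lam) = eLpNorm F p (μw lam) := by
      rw [eLpNorm_norm (fun x => F (-x))]
      exact eLpNorm_comp_measurePreserving (g := F) hF.aestronglyMeasurable (μw_neg lam)
    rw [e2]
  have a2 : eLpNorm (fun z : ℝ × ℝ => g z.1) q ((μw lam).prod (om lam)) ≤ W * eLpNorm g q (μw lam) := by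
    have := eLpNorm_map_measure (g := g) (f := Prod.fst) (p := q) (μ := (μw lam).prod (om lam))
      hg.aestronglyMeasurable measurable_fst.aemeasurable
    rw [Measure.map_fst_prod, eLpNorm_smul_measure_of_ne_zero hne] at this
    change eLpNorm (g ∘ Prod.fst) q ((μw lam).prod (om lam)) ≤ _
    rw [← this, smul_eq_mul]
    exact mul_le_mul' (rpow_le_max _ _ hq) le_rfl
  have a3 := eLpNorm_smul_le_mul_eLpNorm (p := p) (q := q) (r := 1) (μ := (μw lam).prod (om lam)) (φ := N ∘ A)
    (f := fun z : ℝ × ℝ => g z.1) (hg.comp measurable_fst).aestronglyMeasurable (hNc.comp hA).aestronglyMeasurable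
  have a4 : ‖∫ x, T lam t F x * g x ∂(μw lam)‖ₑ ≤ eLpNorm ((N ∘ A) • fun z : ℝ × ℝ => g z.1) 1 ((μw lam).prod (om lam)) := by
    refine (enorm_integral_le_lintegral_enorm _).trans ?_
    rw [eLpNorm_one_eq_lintegral_enorm, lintegral_prod]
    swap
    · exact (((hNc.comp hA).measurable.smul (hg.comp measurable_fst)).enorm).aemeasurable
    refine lintegral_mono fun x => ?_
    simp only [Pi.smul_apply', Function.comp, enorm_smul, enorm_mul]
    rw [lintegral_mul_const]
    · exact mul_le_mul' (T_le hlam t F x) le_rfl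
    · exact (hNc.comp (hA.comp (by fun_prop : Continuous fun φ : ℝ => (x, φ)))).measurable.enorm
  refine a4.trans (a3.trans ((mul_le_mul' a1 a2).trans (le_of_eq ?_)))
  rw [ENNReal.ofReal_mul (by norm_num), ENNReal.ofReal_mul (by positivity), ENNReal.ofReal_toReal hWt, ENNReal.ofReal_ofNat]
  ring



/-- even entire function with even derivatives `a` at zero -/
def Ev (a : ℕ → ℂ) (z : ℂ) : ℂ := ∑' k, a k * z^(2*k) / ((2*k).factorial : ℂ)

lemma Ev_term {κ C : ℝ} (hκ : 0 ≤ κ) {a : ℕ → ℂ} (ha : Bd κ C a) (k : ℕ) (z : ℂ) {R : ℝ} (hz : ‖z‖ ≤ R) :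
    ‖a k * z^(2*k) / ((2*k).factorial : ℂ)‖ ≤ C * ((κ * R)^(2*k) / (2*k).factorial) := by
  have hC := ha.nonneg
  rw [norm_div, norm_mul, norm_pow, Complex.norm_natCast, mul_pow]
  calc ‖a k‖ * ‖z‖^(2*k) / (2*k).factorial ≤ (C * κ^(2*k)) * R^(2*k) / (2*k).factorial := by
        gcongr; exact ha k
    _ = _ := by ring

lemma Ev_summable {κ C : ℝ} (hκ : 0 ≤ κ) {a : ℕ → ℂ} (ha : Bd κ C a) (z : ℂ) :
    Summable fun k => a k * z^(2*k) / ((2*k).factorial : ℂ) :=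
  Summable.of_norm_bounded ((sum_cosh (κ * ‖z‖)).mul_left C) fun k => Ev_term hκ ha k z le_rfl

lemma cosh_le_exp {x : ℝ} (hx : 0 ≤ x) : Real.cosh x ≤ Real.exp x := by
  rw [Real.cosh_eq]
  have : Real.exp (-x) ≤ Real.exp x := Real.exp_le_exp.2 (by linarith)
  linarith

lemma Ev_bound {κ C : ℝ} (hκ : 0 ≤ κ) {a : ℕ → ℂ} (ha : Bd κ C a) (z : ℂ) :
    ‖Ev a z‖ ≤ C * Real.exp (κ * ‖z‖) := by
  have hC := ha.nonneg
  have h := tsum_of_norm_bounded ((Real.hasSum_cosh (κ * ‖z‖)).mul_left C) (fun k => Ev_term hκ ha k z le_rfl)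
  exact h.trans (mul_le_mul_of_nonneg_left (cosh_le_exp (by positivity)) hC)

lemma Ev_diff {κ C : ℝ} (hκ : 0 ≤ κ) {a : ℕ → ℂ} (ha : Bd κ C a) : Differentiable ℂ (Ev a) := by
  intro z
  have h := Complex.differentiableOn_tsum_of_summable_norm
    (F := fun k z => a k * z^(2*k) / ((2*k).factorial : ℂ)) (U := Metric.ball (0:ℂ) (‖z‖+1))
    ((sum_cosh (κ * (‖z‖+1))).mul_left C)
    (fun l => by fun_prop) Metric.isOpen_ball
    (fun l w hw => Ev_term hκ ha l w (by
      rw [mem_ball_zero_iff] at hw; exact hw.le))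
  exact (h.differentiableAt (Metric.isOpen_ball.mem_nhds (by simp)))

lemma Ev_neg (a : ℕ → ℂ) (z : ℂ) : Ev a (-z) = Ev a z := by
  unfold Ev
  refine tsum_congr fun k => ?_
  rw [Even.neg_pow (by simp)]

lemma PL_aux {κ C M : ℝ} (hκ : 0 ≤ κ) {a : ℕ → ℂ} (ha : Bd κ C a) (hM : ∀ s : ℝ, ‖Ev a s‖ ≤ M)
    (w : ℂ) (hw : 0 ≤ w.re) : ‖Ev a (Complex.I * w)‖ ≤ M * Real.exp (κ * w.re) := by
  have hC := ha.nonneg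
  have hd := Ev_diff hκ ha
  have hdf : Differentiable ℂ fun w => Ev a (Complex.I * w) * Complex.exp (-(κ:ℂ) * w) := by
    refine Differentiable.mul (hd.comp (by fun_prop)) (by fun_prop)
  have hn : ∀ w : ℂ, ‖Complex.exp (-(κ:ℂ) * w)‖ = Real.exp (-κ * w.re) := fun w => by
    rw [Complex.norm_exp]; congr 1; simp
  have h := PhragmenLindelof.right_half_plane_of_bounded_on_real (C := M) (z := w)
    (f := fun w => Ev a (Complex.I * w) * Complex.exp (-(κ:ℂ) * w)) hdf.diffContOnCl ?_ ?_ ?_ hw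
  · simp only [norm_mul, hn] at h
    rw [neg_mul, Real.exp_neg, ← div_eq_mul_inv, div_le_iff₀ (Real.exp_pos _)] at h
    exact h
  · refine ⟨1, by norm_num, κ, ?_⟩
    refine Asymptotics.IsBigO.of_bound C ?_
    refine Filter.Eventually.filter_mono inf_le_right ?_
    rw [Filter.eventually_principal]
    intro z hz
    have hz : 0 < z.re := hz
    simp only [norm_mul, hn, Real.rpow_one]
    rw [Real.norm_of_nonneg (Real.exp_pos _).le]
    have h1 := Ev_bound hκ ha (Complex.I * z)
    rw [norm_mul, Complex.norm_I, one_mul] at h1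
    have h2 : Real.exp (-κ * z.re) ≤ 1 := Real.exp_le_one_iff.2 (by nlinarith)
    calc _ ≤ (C * Real.exp (κ * ‖z‖)) * 1 := mul_le_mul h1 h2 (Real.exp_pos _).le (by positivity)
      _ = _ := mul_one _
  · refine Filter.isBoundedUnder_of_eventually_le (a := C) ?_
    filter_upwards [Filter.eventually_ge_atTop (0:ℝ)] with x hx
    simp only [norm_mul, hn]
    have h1 := Ev_bound hκ ha (Complex.I * x)
    rw [norm_mul, Complex.norm_I, one_mul, Complex.norm_real, Real.norm_of_nonneg hx] at h1
    calc _ ≤ (C * Real.exp (κ * x)) * Real.exp (-κ * x) := by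
            rw [Complex.ofReal_re]; gcongr
      _ = C := by rw [mul_assoc, ← Real.exp_add]; simp
  · intro x
    simp only [norm_mul, hn]
    have : Complex.I * (x * Complex.I) = ((-x : ℝ) : ℂ) := by
      push_cast; linear_combination (x:ℂ) * Complex.I_mul_I
    rw [this]
    have h0 : ((x:ℂ) * Complex.I).re = 0 := by simp
    rw [h0, mul_zero, Real.exp_zero, mul_one]
    exact hM _

lemma PL {κ C M : ℝ} (hκ : 0 ≤ κ) {a : ℕ → ℂ} (ha : Bd κ C a) (hM : ∀ s : ℝ, ‖Ev a s‖ ≤ M)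
    (z : ℂ) : ‖Ev a z‖ ≤ M * Real.exp (κ * |z.im|) := by
  rcases le_total 0 z.im with h | h
  · have := PL_aux hκ ha hM (-Complex.I * z) (by simpa using h)
    have e : Complex.I * (-Complex.I * z) = z := by linear_combination -z * Complex.I_mul_I
    rw [e] at this
    rw [abs_of_nonneg h]
    simpa using this
  · have := PL_aux hκ ha hM (Complex.I * z) (by simpa using h)
    have e : Complex.I * (Complex.I * z) = -z := by linear_combination z * Complex.I_mul_I
    rw [e, Ev_neg] at this
    rw [abs_of_nonpos h]
    simpa using this

/-! ### Euler operators -/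

lemma class_deriv {f : ℂ → ℂ} (hf : Differentiable ℂ f) {M κ : ℝ} {j : ℕ} (hM : 0 ≤ M) (hκ : 0 ≤ κ)
    (h : ∀ z, ‖f z‖ ≤ M * (1+‖z‖)^j * Real.exp (κ * |z.im|)) (z : ℂ) :
    ‖deriv f z‖ ≤ (2^j * Real.exp κ) * M * (1+‖z‖)^j * Real.exp (κ * |z.im|) := by
  refine (Complex.norm_deriv_le_of_forall_mem_sphere_norm_le (R := 1) one_pos hf.diffContOnCl
    (C := (2^j * Real.exp κ) * M * (1+‖z‖)^j * Real.exp (κ * |z.im|)) ?_).trans (by rw [div_one])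
  intro w hw
  rw [mem_sphere_iff_norm] at hw
  have h1 : ‖w‖ ≤ 1 + ‖z‖ := by
    have := norm_add_le (w - z) z
    rw [sub_add_cancel, hw] at this; exact this
  have h2 : |w.im| ≤ |z.im| + 1 := by
    have h3 := Complex.abs_im_le_norm (w - z)
    rw [hw, Complex.sub_im] at h3
    have := abs_add_le (w.im - z.im) z.im
    rw [sub_add_cancel] at this; linarith
  have hz := norm_nonneg z
  calc ‖f w‖ ≤ M * (1+‖w‖)^j * Real.exp (κ * |w.im|) := h w
    _ ≤ M * (2 * (1+‖z‖))^j * Real.exp (κ * (|z.im|+1)) := by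
        gcongr; linarith
    _ = _ := by rw [mul_pow, mul_add, Real.exp_add, mul_one]; ring

lemma Bd_euler {κ C : ℝ} (hκ : 0 ≤ κ) {a : ℕ → ℂ} (ha : Bd κ C a) (c : ℝ) (hc : 0 ≤ c) :
    ∃ C', Bd (2*κ) C' (fun k => ((k + c : ℝ) : ℂ) * a k) := by
  have hC := ha.nonneg
  obtain ⟨K, hK, h⟩ := poly_le_pow 1 (q := 4) (by norm_num)
  refine ⟨(1 + c) * K * C, fun k => ?_⟩
  rw [norm_mul, Complex.norm_real, Real.norm_of_nonneg (by positivity)]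
  have h1 : (k:ℝ) + c ≤ (1 + c) * (K * 4^k) := by
    have := h k
    rw [pow_one] at this
    have hk : (0:ℝ) ≤ k := by positivity
    calc (k:ℝ) + c ≤ (1+c) * (k+1) := by nlinarith
      _ ≤ _ := by gcongr
  calc ((k:ℝ) + c) * ‖a k‖ ≤ ((1 + c) * (K * 4^k)) * (C * κ^(2*k)) :=
        mul_le_mul h1 (ha k) (norm_nonneg _) (by positivity)
    _ = _ := by rw [mul_pow, pow_mul 2 2 k]; norm_num; ring

lemma Ev_euler {κ C : ℝ} (hκ : 0 ≤ κ) {a : ℕ → ℂ} (ha : Bd κ C a) (c : ℝ) (hc : 0 ≤ c) (z : ℂ) :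
    Ev (fun k => ((k + c : ℝ) : ℂ) * a k) z = z / 2 * deriv (Ev a) z + c * Ev a z := by
  have h := Complex.hasSum_deriv_of_summable_norm
    (F := fun k z => a k * z^(2*k) / ((2*k).factorial : ℂ)) (U := Metric.ball (0:ℂ) (‖z‖+1))
    ((sum_cosh (κ * (‖z‖+1))).mul_left C)
    (fun l => by fun_prop) Metric.isOpen_ball
    (fun l w hw => Ev_term hκ ha l w (by
      rw [mem_ball_zero_iff] at hw; exact hw.le)) (z := z) (by simp)
  have h1 := (h.mul_left (z/2)).add ((Ev_summable hκ ha z).hasSum.mul_left (c:ℂ))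
  refine Eq.trans ?_ h1.tsum_eq
  refine tsum_congr fun k => ?_
  have hd : deriv (fun z : ℂ => a k * z^(2*k) / ((2*k).factorial : ℂ)) z = a k * ((2*k : ℕ) * z^(2*k-1)) / ((2*k).factorial : ℂ) := by
    have := (((hasDerivAt_pow (2*k) z).const_mul (a k)).div_const ((2*k).factorial : ℂ)).deriv
    exact this
  rw [hd]
  rcases k with _ | k
  · simp
  · rw [show 2*(k+1)-1 = 2*k+1 by omega, show 2*(k+1) = 2*k+1+1 by omega]
    push_cast
    ring

lemma class_euler {κ C M μ : ℝ} {j : ℕ} (hκ : 0 ≤ κ) (hμ : 0 ≤ μ) (hM : 0 ≤ M) {a : ℕ → ℂ} (ha : Bd κ C a) (c : ℝ) (hc : 0 ≤ c)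
    (h : ∀ z, ‖Ev a z‖ ≤ M * (1+‖z‖)^j * Real.exp (μ * |z.im|)) (z : ℂ) :
    ‖Ev (fun k => ((k + c : ℝ) : ℂ) * a k) z‖ ≤ ((2^j * Real.exp μ + c) * M) * (1+‖z‖)^(j+1) * Real.exp (μ * |z.im|) := by
  rw [Ev_euler hκ ha c hc]
  have h1 := class_deriv (Ev_diff hκ ha) hM hμ h z
  have h2 := h z
  have hz := norm_nonneg z
  have hn2 : ‖z / 2‖ ≤ 1 + ‖z‖ := by rw [norm_div]; norm_num; linarith
  refine (norm_add_le _ _).trans ?_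
  rw [norm_mul, norm_mul, Complex.norm_real, Real.norm_of_nonneg hc]
  have e1 := mul_le_mul hn2 h1 (norm_nonneg _) (by positivity)
  have e2 : c * ‖Ev a z‖ ≤ c * (M * (1+‖z‖)^(j+1) * Real.exp (μ * |z.im|)) := by
    refine mul_le_mul_of_nonneg_left (h2.trans ?_) hc
    gcongr
    · linarith
    · omega
  refine (add_le_add e1 e2).trans (le_of_eq ?_)
  rw [pow_succ]; ring

lemma class_euler_prod (n : ℕ) : ∃ D : ℝ, 0 < D ∧ ∀ (κ C M : ℝ) (a : ℕ → ℂ), 0 ≤ κ → 0 ≤ M → Bd κ C a →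
    (∀ z, ‖Ev a z‖ ≤ M * Real.exp (3/5 * |z.im|)) →
    ∃ κ' C' : ℝ, 0 ≤ κ' ∧ Bd κ' C' (fun k : ℕ => ((∏ i ∈ Finset.range n, ((k:ℝ) + (i + 1/2)) : ℝ) : ℂ) * a k) ∧
    ∀ z, ‖Ev (fun k : ℕ => ((∏ i ∈ Finset.range n, ((k:ℝ) + (i + 1/2)) : ℝ) : ℂ) * a k) z‖ ≤
      D * M * (1+‖z‖)^n * Real.exp (3/5 * |z.im|) := by
  induction n with
  | zero =>
    refine ⟨1, one_pos, fun κ C M a hκ hM ha h => ⟨κ, C, hκ, ?_, ?_⟩⟩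
    · simpa using ha
    · simpa using h
  | succ n ih =>
    obtain ⟨D, hD, ih⟩ := ih
    refine ⟨(2^n * Real.exp (3/5) + (n+1/2)) * D, by positivity, fun κ C M a hκ hM ha h => ?_⟩
    obtain ⟨κ', C', hκ', hb, hh⟩ := ih κ C M a hκ hM ha h
    obtain ⟨C'', hb'⟩ := Bd_euler hκ' hb (n + 1/2) (by positivity)
    have e : (fun k : ℕ => ((k + (n + 1/2) : ℝ) : ℂ) * (((∏ i ∈ Finset.range n, ((k:ℝ) + (i + 1/2)) : ℝ) : ℂ) * a k)) =
        fun k : ℕ => ((∏ i ∈ Finset.range (n+1), ((k:ℝ) + (i + 1/2)) : ℝ) : ℂ) * a k := by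
      ext k
      rw [Finset.prod_range_succ, Complex.ofReal_mul]; ring
    rw [e] at hb'
    refine ⟨2*κ', C'', by positivity, hb', fun z => ?_⟩
    have := class_euler hκ' (by norm_num : (0:ℝ) ≤ 3/5) (by positivity) hb (n+1/2) (by positivity) hh z
    rw [e] at this
    refine this.trans (le_of_eq (by ring))



/-- Beta weight -/
def bw (lam β : ℝ) (y : ℝ) : ℝ := y^(2*lam+1) * (1-y^2)^(β-1)

lemma bw_cont {lam β : ℝ} (hlam : -(1/2 : ℝ) < lam) (hβ : 1 < β) : Continuous (bw lam β) := by
  unfold bw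
  refine Continuous.mul ?_ ?_
  · exact continuous_id.rpow_const fun x => Or.inr (by linarith)
  · exact (by fun_prop : Continuous fun y : ℝ => 1 - y^2).rpow_const fun x => Or.inr (by linarith)

/-- Beta integrals -/
def bi (lam β : ℝ) (k : ℕ) : ℝ := ∫ y in (0:ℝ)..1, y^(2*k) * bw lam β y

lemma bw_nonneg (lam β : ℝ) {y : ℝ} (h0 : 0 ≤ y) (h1 : y ≤ 1) : 0 ≤ bw lam β y := by
  unfold bw
  have : 0 ≤ 1 - y^2 := by nlinarith
  positivity

lemma bi_pos {lam β : ℝ} (hlam : -(1/2 : ℝ) < lam) (hβ : 1 < β) (k : ℕ) : 0 < bi lam β k := by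
  refine intervalIntegral.intervalIntegral_pos_of_pos_on ?_ ?_ (by norm_num)
  · exact ((continuous_pow _).mul (bw_cont hlam hβ)).intervalIntegrable _ _
  · intro y hy
    have : 0 < 1 - y^2 := by nlinarith [hy.1, hy.2]
    have := hy.1
    unfold bw
    positivity

lemma bi_rec {lam β : ℝ} (hlam : -(1/2 : ℝ) < lam) (hβ : 1 < β) (k : ℕ) :
    (lam + 1 + k) * bi lam β k = (lam + 1 + k + β) * bi lam β (k+1) := by
  have hc := bw_cont hlam hβ
  have key : ∫ y in (0:ℝ)..1, ((2*lam+2+2*k) * (y^(2*k) * bw lam β y) - (2*lam+2+2*k+2*β) * (y^(2*(k+1)) * bw lam β y)) =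
      (fun y : ℝ => y^(2*k) * (y^(2*lam+2) * (1-y^2)^β)) 1 - (fun y : ℝ => y^(2*k) * (y^(2*lam+2) * (1-y^2)^β)) 0 := by
    refine intervalIntegral.integral_eq_sub_of_hasDerivAt_of_le (E := ℝ) (a := 0) (b := 1) (f := fun y : ℝ => y^(2*k) * (y^(2*lam+2) * (1-y^2)^β)) (f' := fun y : ℝ => (2*lam+2+2*k) * (y^(2*k) * bw lam β y) - (2*lam+2+2*k+2*β) * (y^(2*(k+1)) * bw lam β y)) zero_le_one ?_ ?_ ?_
    · refine Continuous.continuousOn ?_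
      refine (continuous_pow _).mul (Continuous.mul ?_ ?_)
      · exact continuous_id.rpow_const fun x => Or.inr (by linarith)
      · exact (by fun_prop : Continuous fun y : ℝ => 1 - y^2).rpow_const fun x => Or.inr (by linarith)
    · intro y hy
      have hy0 : 0 < y := hy.1
      have hp : 0 < 1 - y^2 := by nlinarith [hy.1, hy.2]
      have h1 : HasDerivAt (fun y : ℝ => y^(2*lam+2)) ((2*lam+2) * y^(2*lam+2-1)) y :=
        Real.hasDerivAt_rpow_const (Or.inl hy0.ne')
      have h2 : HasDerivAt (fun y : ℝ => 1 - y^2) (-(2*y)) y := by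
        have := (hasDerivAt_pow 2 y).const_sub 1
        refine this.congr_deriv (by norm_num)
      have h3 : HasDerivAt (fun y : ℝ => (1 - y^2)^β) (-(2*y) * β * (1-y^2)^(β-1)) y :=
        h2.rpow_const (Or.inl hp.ne')
      have h4 := (hasDerivAt_pow (2*k) y).mul (h1.mul h3)
      refine h4.congr_deriv ?_
      have e1 : (1-y^2)^β = (1-y^2) * (1-y^2)^(β-1) := by
        rw [Real.rpow_sub_one hp.ne']; field_simp
      have e2 : y^(2*lam+2) = y * y^(2*lam+1) := by
        rw [show 2*lam+2 = 2*lam+1+1 by ring, Real.rpow_add_one hy0.ne']; ring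
      have e3 : 2*lam+2-1 = 2*lam+1 := by ring
      simp only [Pi.mul_apply]
      rw [e1, e2, e3, bw]
      rcases k with _ | k
      · simp; ring
      · rw [show 2*(k+1)-1 = 2*k+1 by omega]
        push_cast
        ring
    · exact Continuous.intervalIntegrable (by fun_prop) _ _
  have z : (fun y : ℝ => y^(2*k) * (y^(2*lam+2) * (1-y^2)^β)) 1 - (fun y : ℝ => y^(2*k) * (y^(2*lam+2) * (1-y^2)^β)) 0 = 0 := by
    simp only
    rw [Real.zero_rpow (show 2*lam+2 ≠ 0 by linarith)]
    simp [Real.zero_rpow (show β ≠ 0 by linarith)]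
  rw [z, intervalIntegral.integral_sub, intervalIntegral.integral_const_mul, intervalIntegral.integral_const_mul] at key
  · unfold bi; linarith
  all_goals exact Continuous.intervalIntegrable (by fun_prop) _ _

/-- `1/ω'_k` as a beta moment times a polynomial -/
lemma al_beta {lam : ℝ} (hlam : -(1/2 : ℝ) < lam) : ∃ (n : ℕ) (β c : ℝ), 1 < β ∧ 0 < c ∧ ∀ k : ℕ,
    al lam k / ((2*k).factorial : ℝ) = c * (∏ i ∈ Finset.range n, ((k:ℝ) + (i + 1/2))) * bi lam β k := by
  obtain ⟨n, hn⟩ := exists_nat_gt (lam + 3/2)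
  have hβ : 1 < (n:ℝ) - lam - 1/2 := by linarith
  have hp : 0 < ∏ i ∈ Finset.range n, (((0:ℕ):ℝ) + (i + 1/2)) := Finset.prod_pos fun i _ => by positivity
  have hb := bi_pos hlam hβ 0
  refine ⟨n, n - lam - 1/2, ((∏ i ∈ Finset.range n, (((0:ℕ):ℝ) + (i + 1/2))) * bi lam (n - lam - 1/2) 0)⁻¹, hβ, by positivity, fun k => ?_⟩
  induction k with
  | zero =>
    rw [mul_assoc, inv_mul_cancel₀ (by positivity)]
    simp [al]
  | succ k ih =>
    have hrec := bi_rec hlam hβ k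
    rw [show lam + 1 + k + ((n:ℝ) - lam - 1/2) = k + n + 1/2 by ring] at hrec
    have e1 : ((k:ℝ) + 1/2) * ∏ i ∈ Finset.range n, (((k+1:ℕ):ℝ) + (i + 1/2)) =
        (k + n + 1/2) * ∏ i ∈ Finset.range n, ((k:ℝ) + (i + 1/2)) := by
      have h1 := Finset.prod_range_succ (fun i : ℕ => (k:ℝ) + (i + 1/2)) n
      have h2 := Finset.prod_range_succ' (fun i : ℕ => (k:ℝ) + (i + 1/2)) n
      rw [h1] at h2
      have h3 : ∏ i ∈ Finset.range n, ((k:ℝ) + (((i+1:ℕ):ℝ) + 1/2)) = ∏ i ∈ Finset.range n, (((k+1:ℕ):ℝ) + (i + 1/2)) :=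
        Finset.prod_congr rfl fun i _ => by push_cast; ring
      rw [h3] at h2
      push_cast at h2 ⊢
      linear_combination -h2
    have e2 : al lam (k+1) / ((2*(k+1)).factorial : ℝ) = (lam+1+k)/(k+1/2) * (al lam k / ((2*k).factorial : ℝ)) := by
      rw [al_succ, al', show 2*(k+1) = 2*k+1+1 by ring, Nat.factorial_succ, Nat.factorial_succ]
      push_cast
      field_simp
      ring
    rw [e2, ih]
    generalize ((∏ i ∈ Finset.range n, (((0:ℕ):ℝ) + (i + 1/2))) * bi lam (n - lam - 1/2) 0)⁻¹ = c
    have hk : (k:ℝ) + 1/2 ≠ 0 := by positivity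
    generalize (∏ i ∈ Finset.range n, (((k+1:ℕ):ℝ) + (i + 1/2))) = p1 at *
    generalize (∏ i ∈ Finset.range n, ((k:ℝ) + (i + 1/2))) = p0 at *
    generalize bi lam (n - lam - 1/2) k = b0 at *
    generalize bi lam (n - lam - 1/2) (k+1) = b1 at *
    rw [div_mul_eq_mul_div, div_eq_iff hk]
    linear_combination (c*p0) * hrec - c * b1 * e1

lemma bi_le {lam β : ℝ} (hlam : -(1/2 : ℝ) < lam) (hβ : 1 < β) (k : ℕ) : bi lam β k ≤ bi lam β 0 := by
  have hc := bw_cont hlam hβ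
  refine intervalIntegral.integral_mono_on zero_le_one (Continuous.intervalIntegrable (by fun_prop) _ _)
    (Continuous.intervalIntegrable (by fun_prop) _ _) fun y hy => ?_
  refine mul_le_mul_of_nonneg_right ?_ (bw_nonneg lam β hy.1 hy.2)
  simpa using pow_le_one₀ hy.1 hy.2

lemma Ev_beta {lam β : ℝ} (hlam : -(1/2 : ℝ) < lam) (hβ : 1 < β) {κ C : ℝ} (hκ : 0 ≤ κ) {u : ℕ → ℂ} (hu : Bd κ C u) (z : ℂ) :
    Ev (fun k => (bi lam β k : ℂ) * u k) z = ∫ y in (0:ℝ)..1, Ev u (z * y) * (bw lam β y : ℂ) := by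
  have hc := bw_cont hlam hβ
  have hC := hu.nonneg
  have hb0 := bi_pos hlam hβ 0
  have h := intervalIntegral.hasSum_integral_of_dominated_convergence (a := 0) (b := 1) (μ := volume)
    (F := fun (k:ℕ) (y:ℝ) => u k * (z * y)^(2*k) / ((2*k).factorial : ℂ) * (bw lam β y : ℂ))
    (f := fun y : ℝ => Ev u (z * y) * (bw lam β y : ℂ))
    (bound := fun k y => C * ((κ * ‖z‖)^(2*k) / (2*k).factorial) * |bw lam β y|) ?_ ?_ ?_ ?_ ?_
  · rw [← h.tsum_eq]
    refine tsum_congr fun k => ?_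
    have e : ∀ y : ℝ, u k * (z * y)^(2*k) / ((2*k).factorial : ℂ) * (bw lam β y : ℂ) =
      (u k * z^(2*k) / ((2*k).factorial : ℂ)) * ((y^(2*k) * bw lam β y : ℝ) : ℂ) := fun y => by
        push_cast; ring
    simp_rw [e]
    rw [intervalIntegral.integral_const_mul, intervalIntegral.integral_ofReal, ← bi]
    ring
  · intro k
    exact Continuous.aestronglyMeasurable (by fun_prop)
  · intro k
    refine Filter.Eventually.of_forall fun y hy => ?_
    rw [Set.uIoc_of_le zero_le_one] at hy
    rw [norm_mul, Complex.norm_real, Real.norm_eq_abs]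
    refine mul_le_mul_of_nonneg_right (Ev_term hκ hu k _ ?_) (abs_nonneg _)
    rw [norm_mul, Complex.norm_real, Real.norm_of_nonneg hy.1.le]
    exact mul_le_of_le_one_right (norm_nonneg _) hy.2
  · refine Filter.Eventually.of_forall fun y hy => ?_
    exact ((sum_cosh _).mul_left C).mul_right _
  · have e : (fun y => ∑' k : ℕ, C * ((κ * ‖z‖)^(2*k) / (2*k).factorial) * |bw lam β y|) =
        fun y => (∑' k : ℕ, C * ((κ * ‖z‖)^(2*k) / (2*k).factorial)) * |bw lam β y| := by
      ext y; rw [tsum_mul_right]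
    rw [e]
    exact Continuous.intervalIntegrable (by fun_prop) _ _
  · refine Filter.Eventually.of_forall fun y hy => ?_
    exact (Ev_summable hκ hu _).hasSum.mul_right _

lemma class_beta {lam β : ℝ} (hlam : -(1/2 : ℝ) < lam) (hβ : 1 < β) {κ C M : ℝ} (hκ : 0 ≤ κ) {u : ℕ → ℂ} (hu : Bd κ C u)
    (h : ∀ z, ‖Ev u z‖ ≤ M * Real.exp (3/5 * |z.im|)) (z : ℂ) :
    ‖Ev (fun k => (bi lam β k : ℂ) * u k) z‖ ≤ (bi lam β 0 * M) * Real.exp (3/5 * |z.im|) := by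
  have hc := bw_cont hlam hβ
  have hM : 0 ≤ M := by
    have := (norm_nonneg _).trans (h 0)
    simpa using this
  rw [Ev_beta hlam hβ hκ hu]
  have h1 : ‖∫ y in (0:ℝ)..1, Ev u (z * y) * (bw lam β y : ℂ)‖ ≤ ∫ y in (0:ℝ)..1, (M * Real.exp (3/5 * |z.im|)) * (y^(2*0) * bw lam β y) := by
    refine intervalIntegral.norm_integral_le_of_norm_le zero_le_one (Filter.Eventually.of_forall fun y hy => ?_)
      (Continuous.intervalIntegrable (by fun_prop) _ _)
    have hb := bw_nonneg lam β hy.1.le hy.2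
    rw [norm_mul, Complex.norm_real, Real.norm_of_nonneg hb, mul_zero, pow_zero, one_mul]
    refine mul_le_mul_of_nonneg_right ((h _).trans ?_) hb
    have hIm : |(z * (y:ℂ)).im| ≤ |z.im| := by
      rw [show (z * (y:ℂ)).im = z.im * y by simp, abs_mul, abs_of_pos hy.1]
      exact mul_le_of_le_one_right (abs_nonneg _) hy.2
    exact mul_le_mul_of_nonneg_left (Real.exp_le_exp.2 (mul_le_mul_of_nonneg_left hIm (by norm_num))) hM
  rw [intervalIntegral.integral_const_mul, ← bi] at h1
  refine h1.trans (le_of_eq (by ring))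

/-- the moments -/
def wk (lam : ℝ) (k : ℕ) : ℝ := w0 lam * (2*k).factorial / al lam k

lemma wk_pos {lam : ℝ} (hlam : -(1/2 : ℝ) < lam) (k : ℕ) : 0 < wk lam k := by
  have := w0_pos hlam
  have := al_pos hlam k
  unfold wk; positivity

lemma wk_le {lam : ℝ} (hlam : -(1/2 : ℝ) < lam) (k : ℕ) : wk lam k ≤ w0 lam := by
  have h0 := w0_pos hlam
  have h1 := al_pos hlam k
  have h2 := al_ge hlam k
  rw [wk, div_le_iff₀ h1]
  gcongr

lemma invert {lam : ℝ} (hlam : -(1/2 : ℝ) < lam) : ∃ (n : ℕ) (D : ℝ), 0 < D ∧ ∀ (F : ℕ → ℂ) (C M : ℝ),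
    Bd (3/5) C F → (∀ s : ℝ, ‖Ev (fun k => (wk lam k : ℂ) * F k) s‖ ≤ M) →
    ∀ z, ‖Ev F z‖ ≤ D * M * (1+‖z‖)^n * Real.exp (3/5 * |z.im|) := by
  obtain ⟨n, β, c, hβ, hc, hal⟩ := al_beta hlam
  obtain ⟨D, hD, hprod⟩ := class_euler_prod n
  have hw := w0_pos hlam
  have hb0 := bi_pos hlam hβ 0
  refine ⟨n, D * (bi lam β 0 * (c / w0 lam)), by positivity, fun F C M hF hM z => ?_⟩
  have hC := hF.nonneg
  have hM0 : 0 ≤ M := (norm_nonneg _).trans (hM 0)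
  have hκ : (0:ℝ) ≤ 3/5 := by norm_num
  have hu : Bd (3/5) (w0 lam * C) (fun k => (wk lam k : ℂ) * F k) := fun k => by
    rw [norm_mul, Complex.norm_real, Real.norm_of_nonneg (wk_pos hlam k).le, mul_assoc]
    exact mul_le_mul (wk_le hlam k) (hF k) (norm_nonneg _) hw.le
  have h1 := PL hκ hu hM
  have h2 := class_beta hlam hβ hκ hu h1
  have hu2 : Bd (3/5) (bi lam β 0 * (w0 lam * C)) (fun k => (bi lam β k : ℂ) * ((wk lam k : ℂ) * F k)) := fun k => by
    rw [norm_mul, Complex.norm_real, Real.norm_of_nonneg (bi_pos hlam hβ k).le, mul_assoc (bi lam β 0)]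
    exact mul_le_mul (bi_le hlam hβ k) (hu k) (norm_nonneg _) hb0.le
  obtain ⟨κ', C', hκ', hb', h3⟩ := hprod _ _ _ _ hκ (by positivity) hu2 h2
  have h4 := h3 z
  have e : Ev F z = ((c / w0 lam : ℝ) : ℂ) * Ev (fun k : ℕ => ((∏ i ∈ Finset.range n, ((k:ℝ) + (i + 1/2)) : ℝ) : ℂ) * ((bi lam β k : ℂ) * ((wk lam k : ℂ) * F k))) z := by
    unfold Ev
    rw [← tsum_mul_left]
    refine tsum_congr fun k => ?_
    have e1 : (c / w0 lam) * ((∏ i ∈ Finset.range n, ((k:ℝ) + (i + 1/2))) * (bi lam β k * wk lam k)) = 1 := by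
      have h5 := hal k
      have h6 := al_pos hlam k
      rw [div_eq_iff (by positivity)] at h5
      rw [wk]
      generalize (∏ i ∈ Finset.range n, ((k:ℝ) + (i + 1/2))) = Q at *
      have hf : (0:ℝ) < ((2*k).factorial : ℝ) := by positivity
      generalize ((2*k).factorial : ℝ) = A at *
      field_simp
      linear_combination -h5
    have e2 : (((c / w0 lam : ℝ) : ℂ) * (((∏ i ∈ Finset.range n, ((k:ℝ) + (i + 1/2)) : ℝ) : ℂ) * ((bi lam β k : ℂ) * (wk lam k : ℂ)))) = 1 := by
      exact_mod_cast congrArg (fun x : ℝ => (x:ℂ)) e1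
    linear_combination -(F k * z^(2*k) / ((2*k).factorial : ℂ)) * e2
  rw [e, norm_mul, Complex.norm_real, Real.norm_of_nonneg (by positivity)]
  refine (mul_le_mul_of_nonneg_left h4 (by positivity)).trans (le_of_eq (by ring))

/-! ### Addition formula -/

lemma sum_even_odd (f : ℕ → ℂ) (N : ℕ) : ∑ i ∈ Finset.range (2*N+1), f i =
    ∑ k ∈ Finset.range (N+1), f (2*k) + ∑ k ∈ Finset.range N, f (2*k+1) := by
  induction N with
  | zero => simp
  | succ N ih =>
    rw [show 2*(N+1)+1 = (2*N+1)+1+1 by ring, Finset.sum_range_succ, Finset.sum_range_succ, ih,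
      Finset.sum_range_succ (fun k => f (2*k)) (N+1), Finset.sum_range_succ (fun k => f (2*k+1)) N]
    rw [show 2*(N+1) = 2*N+1+1 by ring]
    ring

lemma even_binom (s z : ℂ) (N : ℕ) : ∑ p ∈ Finset.HasAntidiagonal.antidiagonal N,
      s^(2*p.1) * z^(2*p.2) / (((2*p.1).factorial : ℂ) * ((2*p.2).factorial : ℂ)) =
      ((s+z)^(2*N) + (s-z)^(2*N)) / 2 / ((2*N).factorial : ℂ) := by
  have hN : ((2*N).factorial : ℂ) ≠ 0 := by exact_mod_cast (Nat.factorial_pos _).ne'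
  rw [sub_eq_add_neg, add_pow, add_pow, ← Finset.sum_add_distrib, sum_even_odd, Finset.Nat.sum_antidiagonal_eq_sum_range_succ_mk]
  have e1 : ∑ k ∈ Finset.range N, (s ^ (2*k+1) * z ^ (2*N-(2*k+1)) * ((2*N).choose (2*k+1) : ℂ) +
      s ^ (2*k+1) * (-z) ^ (2*N-(2*k+1)) * ((2*N).choose (2*k+1) : ℂ)) = 0 := by
    refine Finset.sum_eq_zero fun k hk => ?_
    have hk := Finset.mem_range.1 hk
    rw [show 2*N-(2*k+1) = 2*(N-k-1)+1 by omega, Odd.neg_pow (by simp)]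
    ring
  rw [e1, add_zero, Finset.sum_div, Finset.sum_div]
  refine Finset.sum_congr rfl fun k hk => ?_
  have hk : k ≤ N := by have := Finset.mem_range.1 hk; omega
  rw [show 2*N-2*k = 2*(N-k) by omega, Even.neg_pow (by simp)]
  have hch := Nat.choose_mul_factorial_mul_factorial (show 2*k ≤ 2*N by omega)
  rw [show 2*N-2*k = 2*(N-k) by omega] at hch
  have hch' : ((2*N).choose (2*k) : ℂ) * ((2*k).factorial : ℂ) * ((2*(N-k)).factorial : ℂ) = ((2*N).factorial : ℂ) := by
    exact_mod_cast hch
  have f1 : ((2*k).factorial : ℂ) ≠ 0 := by exact_mod_cast (Nat.factorial_pos _).ne'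
  have f2 : ((2*(N-k)).factorial : ℂ) ≠ 0 := by exact_mod_cast (Nat.factorial_pos _).ne'
  rw [← hch'] at hN ⊢
  simp only
  generalize ((2*k).factorial : ℂ) = A at *
  generalize ((2*(N-k)).factorial : ℂ) = B at *
  generalize ((2*N).choose (2*k) : ℂ) = D at *
  have hD : D ≠ 0 := by
    intro h; simp [h] at hN
  field_simp
  ring

lemma dbl_bound {κ C : ℝ} (hκ : 0 ≤ κ) {a : ℕ → ℂ} (ha : Bd κ C a) (s z : ℂ) {S Z : ℝ} (hs : ‖s‖ ≤ S) (hz : ‖z‖ ≤ Z) (p : ℕ × ℕ) :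
    ‖a (p.1+p.2) * (s^(2*p.1) * z^(2*p.2) / (((2*p.1).factorial : ℂ) * ((2*p.2).factorial : ℂ)))‖ ≤
      C * (((κ * S)^(2*p.1) / (2*p.1).factorial) * ((κ * Z)^(2*p.2) / (2*p.2).factorial)) := by
  have hC := ha.nonneg
  have hS := (norm_nonneg _).trans hs
  have hZ := (norm_nonneg _).trans hz
  rw [norm_mul, norm_div, norm_mul, norm_mul, norm_pow, norm_pow, Complex.norm_natCast, Complex.norm_natCast]
  calc _ ≤ (C * κ^(2*(p.1+p.2))) * (S^(2*p.1) * Z^(2*p.2) / ((2*p.1).factorial * (2*p.2).factorial)) := by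
        gcongr; exact ha _
    _ = _ := by rw [mul_add, pow_add, mul_pow, mul_pow]; field_simp

lemma dbl_sum {κ S Z C : ℝ} (hκ : 0 ≤ κ) (hS : 0 ≤ S) (hZ : 0 ≤ Z) : Summable fun p : ℕ × ℕ =>
      C * (((κ * S)^(2*p.1) / (2*p.1).factorial) * ((κ * Z)^(2*p.2) / (2*p.2).factorial)) :=
  (Summable.mul_of_nonneg (sum_cosh (κ*S)) (sum_cosh (κ*Z)) (fun k => by simp only [Pi.zero_apply]; positivity)
    (fun k => by simp only [Pi.zero_apply]; positivity)).mul_left C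

lemma addition {κ C : ℝ} (hκ : 0 ≤ κ) {a : ℕ → ℂ} (ha : Bd κ C a) (s z : ℂ) :
    HasSum (fun p : ℕ × ℕ => a (p.1+p.2) * (s^(2*p.1) * z^(2*p.2) / (((2*p.1).factorial : ℂ) * ((2*p.2).factorial : ℂ))))
      ((Ev a (s+z) + Ev a (s-z)) / 2) := by
  have hsum : Summable (fun p : ℕ × ℕ => a (p.1+p.2) * (s^(2*p.1) * z^(2*p.2) / (((2*p.1).factorial : ℂ) * ((2*p.2).factorial : ℂ)))) :=
    Summable.of_norm_bounded (dbl_sum hκ (norm_nonneg s) (norm_nonneg z)) (dbl_bound hκ ha s z le_rfl le_rfl)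
  have h1 := hasSum_antidiag hsum
  have h2 := ((Ev_summable hκ ha (s+z)).hasSum.add (Ev_summable hκ ha (s-z)).hasSum).div_const 2
  have h3 := hs_congr h1 (g := fun k => (a k * (s+z)^(2*k) / ((2*k).factorial : ℂ) + a k * (s-z)^(2*k) / ((2*k).factorial : ℂ)) / 2) (fun N => by
    have e : ∀ p ∈ Finset.HasAntidiagonal.antidiagonal N, a (p.1+p.2) * (s^(2*p.1) * z^(2*p.2) / (((2*p.1).factorial : ℂ) * ((2*p.2).factorial : ℂ))) =
      a N * (s^(2*p.1) * z^(2*p.2) / (((2*p.1).factorial : ℂ) * ((2*p.2).factorial : ℂ))) := fun p hp => by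
        rw [Finset.HasAntidiagonal.mem_antidiagonal.1 hp]
    rw [Finset.sum_congr rfl e, ← Finset.mul_sum, even_binom]
    ring)
  have h4 := h3.unique h2
  have h5 := hsum.hasSum
  rw [h4] at h5
  exact h5

lemma Ev_tr {lam : ℝ} (hlam : -(1/2 : ℝ) < lam) {κ C : ℝ} (hκ : 0 ≤ κ) {a : ℕ → ℂ} (ha : Bd κ C a) (r : ℝ) (s : ℂ) :
    Ev (tr lam r a) s = ∫ φ, (Ev a (s + (r * Real.cos φ : ℝ)) + Ev a (s - (r * Real.cos φ : ℝ))) / 2 ∂(om lam) := by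
  have := om_finite hlam
  have h := hasSum_integral_of_dominated_convergence (μ := om lam)
    (F := fun (p : ℕ × ℕ) φ => a (p.1+p.2) * (s^(2*p.1) * ((r * Real.cos φ : ℝ) : ℂ)^(2*p.2) / (((2*p.1).factorial : ℂ) * ((2*p.2).factorial : ℂ))))
    (f := fun φ => (Ev a (s + (r * Real.cos φ : ℝ)) + Ev a (s - (r * Real.cos φ : ℝ))) / 2)
    (bound := fun p _ => C * (((κ * ‖s‖)^(2*p.1) / (2*p.1).factorial) * ((κ * |r|)^(2*p.2) / (2*p.2).factorial))) ?_ ?_ ?_ ?_ ?_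
  · have e : ∀ p : ℕ × ℕ, ∫ φ, a (p.1+p.2) * (s^(2*p.1) * ((r * Real.cos φ : ℝ) : ℂ)^(2*p.2) / (((2*p.1).factorial : ℂ) * ((2*p.2).factorial : ℂ))) ∂(om lam)
        = s^(2*p.1) / ((2*p.1).factorial : ℂ) * (((w0 lam * (r^(2*p.2) / al lam p.2) : ℝ) : ℂ) * a (p.1 + p.2)) := fun p => by
      have e1 : ∀ φ, a (p.1+p.2) * (s^(2*p.1) * ((r * Real.cos φ : ℝ) : ℂ)^(2*p.2) / (((2*p.1).factorial : ℂ) * ((2*p.2).factorial : ℂ))) =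
        (a (p.1+p.2) * (s^(2*p.1) * (r:ℂ)^(2*p.2) / (((2*p.1).factorial : ℂ) * ((2*p.2).factorial : ℂ)))) * ((Real.cos φ ^ (2*p.2) : ℝ) : ℂ) := fun φ => by
          push_cast; ring
      simp_rw [e1]
      rw [integral_const_mul, integral_complex_ofReal, moment hlam]
      have f2 : ((2*p.2).factorial : ℂ) ≠ 0 := by exact_mod_cast (Nat.factorial_pos _).ne'
      have f1 : ((2*p.1).factorial : ℂ) ≠ 0 := by exact_mod_cast (Nat.factorial_pos _).ne'
      have f3 : (al lam p.2 : ℂ) ≠ 0 := by exact_mod_cast (al_pos hlam p.2).ne'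
      push_cast
      generalize ((2*p.2).factorial : ℂ) = A at *
      generalize ((2*p.1).factorial : ℂ) = B at *
      field_simp
    simp_rw [e] at h
    rw [← h.tsum_eq, h.summable.tsum_prod]
    unfold Ev tr
    refine tsum_congr fun k => ?_
    refine Eq.trans ?_ (tsum_mul_left (a := s^(2*k) / ((2*k).factorial : ℂ))).symm
    ring
  · intro p
    exact Continuous.aestronglyMeasurable (by fun_prop)
  · intro p
    refine Filter.Eventually.of_forall fun φ => dbl_bound hκ ha s _ le_rfl ?_ p
    rw [Complex.norm_real, norm_mul, Real.norm_eq_abs, Real.norm_eq_abs]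
    exact mul_le_of_le_one_right (abs_nonneg _) (Real.abs_cos_le_one φ)
  · exact Filter.Eventually.of_forall fun φ => dbl_sum hκ (norm_nonneg s) (abs_nonneg r)
  · exact integrable_const _
  · exact Filter.Eventually.of_forall fun φ => addition hκ ha s _



/-- entire cardinal sine -/
def Sc : ℂ → ℂ := dslope Complex.sin 0

lemma Sc_mul (w : ℂ) : w * Sc w = Complex.sin w := by
  have := sub_smul_dslope Complex.sin 0 w
  simpa [Sc] using this

lemma Sc_zero : Sc 0 = 1 := by
  rw [Sc, dslope_same, (Complex.hasDerivAt_sin 0).deriv, Complex.cos_zero]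

lemma Sc_diff : Differentiable ℂ Sc := by
  rw [← differentiableOn_univ]
  exact (Complex.differentiableOn_dslope Filter.univ_mem).2 Complex.differentiable_sin.differentiableOn

lemma Sc_cont : Continuous Sc := Sc_diff.continuous

lemma Sc_real (x : ℝ) : Sc x = (Real.sinc x : ℂ) := by
  rcases eq_or_ne x 0 with rfl | hx
  · simp [Sc_zero]
  · rw [Real.sinc_of_ne_zero hx]
    have h := Sc_mul x
    have hx' : (x:ℂ) ≠ 0 := by exact_mod_cast hx
    push_cast
    rw [← h]; field_simp

lemma norm_sin_le (w : ℂ) : ‖Complex.sin w‖ ≤ Real.exp |w.im| := by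
  have e : Complex.sin w = (Complex.exp (-w * Complex.I) - Complex.exp (w * Complex.I)) * Complex.I / 2 := rfl
  rw [e, norm_div, norm_mul, Complex.norm_I, mul_one]
  have h1 : ‖Complex.exp (-w * Complex.I)‖ ≤ Real.exp |w.im| := by
    rw [Complex.norm_exp]
    refine Real.exp_le_exp.2 ?_
    simpa using le_abs_self w.im
  have h2 : ‖Complex.exp (w * Complex.I)‖ ≤ Real.exp |w.im| := by
    rw [Complex.norm_exp]
    refine Real.exp_le_exp.2 ?_
    simpa using neg_abs_le w.im |> neg_le_neg |> (by simpa using ·)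
  have h3 := norm_sub_le (Complex.exp (-w * Complex.I)) (Complex.exp (w * Complex.I))
  have h4 : ‖(2:ℂ)‖ = 2 := by norm_num
  rw [h4]
  linarith

lemma Sc_bound : ∃ B : ℝ, 1 ≤ B ∧ ∀ w : ℂ, ‖Sc w‖ * (1 + ‖w‖) ≤ B * Real.exp |w.im| := by
  obtain ⟨B, hB⟩ := (isCompact_closedBall (0:ℂ) 1).exists_bound_of_continuousOn Sc_cont.continuousOn
  have hB0 : 1 ≤ B := by simpa [Sc_zero] using hB 0 (by simp)
  refine ⟨2*B, by linarith, fun w => ?_⟩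
  have he : 1 ≤ Real.exp |w.im| := Real.one_le_exp (abs_nonneg _)
  rcases le_total ‖w‖ 1 with h | h
  · have h1 := hB w (by simpa using h)
    nlinarith [norm_nonneg w, norm_nonneg (Sc w)]
  · have h1 := norm_sin_le w
    rw [← Sc_mul, norm_mul] at h1
    nlinarith [norm_nonneg w, norm_nonneg (Sc w)]

/-- difference coefficients -/
def cf (m : ℕ) (r : ℤ) : ℂ :=
  ((Nat.choose (2 * m) m : ℂ))⁻¹ * ((-1 : ℂ) ^ r * (Nat.choose (2 * m) ((m : ℤ) - r).toNat : ℂ))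

lemma J_id (m : ℕ) (x : ℂ) : ∑ r ∈ Finset.Icc (-(m:ℤ)) m, cf m r * Complex.exp (Complex.I * (r * x)) =
    ((Nat.choose (2 * m) m : ℂ))⁻¹ * (2 * Complex.sin (x/2))^(2*m) := by
  unfold cf
  simp_rw [mul_assoc, ← Finset.mul_sum]
  congr 1
  have e : ∑ r ∈ Finset.Icc (-(m:ℤ)) m, ((-1 : ℂ) ^ r * ((Nat.choose (2 * m) ((m : ℤ) - r).toNat : ℂ) * Complex.exp (Complex.I * (r * x)))) =
    ∑ j ∈ Finset.range (2*m+1), (-1:ℂ)^m * ((-Complex.exp (-(x/2) * Complex.I))^j * (Complex.exp ((x/2) * Complex.I))^(2*m-j) * (Nat.choose (2*m) j : ℂ)) := by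
    refine Finset.sum_nbij' (fun r => ((m:ℤ) - r).toNat) (fun j => (m:ℤ) - j) ?_ ?_ ?_ ?_ ?_
    · intro r hr
      rw [Finset.mem_Icc] at hr
      rw [Finset.mem_range]; omega
    · intro j hj
      rw [Finset.mem_range] at hj
      rw [Finset.mem_Icc]; omega
    · intro r hr
      rw [Finset.mem_Icc] at hr
      omega
    · intro j hj
      omega
    · intro r hr
      rw [Finset.mem_Icc] at hr
      obtain ⟨j, hj⟩ : ∃ j : ℕ, (m:ℤ) - r = j := ⟨((m:ℤ) - r).toNat, by omega⟩
      have hr' : r = (m:ℤ) - j := by omega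
      have hj2 : j ≤ 2*m := by omega
      rw [hr']
      rw [show ((m:ℤ) - ((m:ℤ) - j)).toNat = j by omega]
      rw [neg_pow (Complex.exp _) j, ← Complex.exp_nat_mul, ← Complex.exp_nat_mul]
      rw [show ∀ a b c d e : ℂ, a * (b * c * d * e) = (a * b) * (e * (c * d)) by intros; ring, ← Complex.exp_add]
      have e1 : (-1:ℂ)^((m:ℤ) - (j:ℤ)) = (-1)^m * (-1)^j := by
        rw [zpow_sub₀ (by norm_num), zpow_natCast, zpow_natCast]
        rcases neg_one_pow_eq_or ℂ j with h | h <;> rw [h] <;> field_simp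
      rw [e1]
      congr 3
      push_cast [Nat.cast_sub hj2]
      ring
  rw [e, ← Finset.mul_sum, ← add_pow]
  have e2 : -Complex.exp (-(x/2) * Complex.I) + Complex.exp ((x/2) * Complex.I) = Complex.I * (2 * Complex.sin (x/2)) := by
    rw [show Complex.sin (x/2) = (Complex.exp (-(x/2) * Complex.I) - Complex.exp ((x/2) * Complex.I)) * Complex.I / 2 from rfl]
    linear_combination (-(Complex.exp (-(x/2) * Complex.I)) + Complex.exp ((x/2) * Complex.I)) * Complex.I_mul_I
  rw [e2, mul_pow, pow_mul Complex.I, Complex.I_sq, ← mul_assoc, ← pow_add, ← two_mul, pow_mul (-1:ℂ)]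
  norm_num

/-- the reduced multiplier -/
def Gc (lam : ℝ) (m : ℕ) (v : ℂ) : ℂ :=
  ∫ φ, ((Real.cos φ : ℂ) * Sc (v * ((Real.cos φ / 2 : ℝ) : ℂ)))^(2*m) ∂(om lam)

lemma Gc_diff {lam : ℝ} (hlam : -(1/2 : ℝ) < lam) (m : ℕ) : Differentiable ℂ (Gc lam m) := by
  intro v
  have hS := Sc_cont
  have hS' : Continuous (deriv Sc) := (Sc_diff.contDiff (n := 1)).continuous_deriv le_rfl
  refine (om_hasDerivAt (𝕜 := ℂ) hlam (q := fun v φ => ((Real.cos φ : ℂ) * Sc (v * ((Real.cos φ / 2 : ℝ) : ℂ)))^(2*m))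
    (q' := fun v φ => ((2*m : ℕ):ℂ) * ((Real.cos φ : ℂ) * Sc (v * ((Real.cos φ / 2 : ℝ) : ℂ)))^(2*m-1) *
      ((Real.cos φ : ℂ) * (deriv Sc (v * ((Real.cos φ / 2 : ℝ) : ℂ)) * ((Real.cos φ / 2 : ℝ) : ℂ)))) ?_ ?_ ?_ v).differentiableAt
  · intro x; fun_prop
  · fun_prop
  · intro x φ
    have h1 : HasDerivAt (fun x : ℂ => x * ((Real.cos φ / 2 : ℝ) : ℂ)) (((Real.cos φ / 2 : ℝ) : ℂ)) x := by
      simpa using (hasDerivAt_id x).mul_const ((Real.cos φ / 2 : ℝ) : ℂ)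
    have h2 := HasDerivAt.comp x (Sc_diff _).hasDerivAt h1
    exact (h2.const_mul (Real.cos φ : ℂ)).pow (2*m)

lemma Gc_ne {lam : ℝ} (hlam : -(1/2 : ℝ) < lam) (m : ℕ) {v : ℝ} (hv : |v| ≤ 2) : Gc lam m v ≠ 0 := by
  have e : Gc lam m v = ((∫ φ, (Real.cos φ * Real.sinc (v * (Real.cos φ / 2)))^(2*m) ∂(om lam) : ℝ) : ℂ) := by
    rw [Gc, ← integral_complex_ofReal]
    congr 1; ext φ
    rw [← Complex.ofReal_mul, Sc_real]
    push_cast; rfl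
  rw [e]
  have hs := Real.continuous_sinc
  have h := om_pos_integral hlam (q := fun φ => (Real.cos φ * Real.sinc (v * (Real.cos φ / 2)))^(2*m)) (by fun_prop)
    (fun φ => by rw [pow_mul]; positivity) (fun φ hφ => by
      have hc : 0 < Real.cos φ := Real.cos_pos_of_mem_Ioo ⟨by linarith [hφ.1, Real.pi_pos], by linarith [hφ.2, Real.pi_gt_three]⟩
      have hsn : 0 < Real.sinc (v * (Real.cos φ / 2)) := by
        have h1 : |v * (Real.cos φ / 2)| ≤ 1 := by
          rw [abs_mul, abs_of_pos (show 0 < Real.cos φ / 2 by positivity)]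
          have := Real.cos_le_one φ
          nlinarith [abs_nonneg v]
        generalize v * (Real.cos φ / 2) = y at h1
        have pos : ∀ y : ℝ, 0 < y → y ≤ 1 → 0 < Real.sinc y := fun y h0 h1 => by
          rw [Real.sinc_of_ne_zero h0.ne']
          exact div_pos (Real.sin_pos_of_pos_of_lt_pi h0 (by linarith [Real.pi_gt_three])) h0
        rcases lt_trichotomy y 0 with h | h | h
        · rw [← Real.sinc_neg]
          exact pos _ (by linarith) (by linarith [(abs_le.1 h1).1])
        · rw [h]; simp
        · exact pos _ h (abs_le.1 h1).2
      positivity)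
  exact_mod_cast h.ne'

lemma J_G {lam : ℝ} (hlam : -(1/2 : ℝ) < lam) (m : ℕ) (v : ℂ) :
    ∑ r ∈ Finset.Icc (-(m:ℤ)) m, cf m r * ∫ φ, (Complex.exp (Complex.I * (r * (v * Real.cos φ))) + Complex.exp (-(Complex.I * (r * (v * Real.cos φ))))) / 2 ∂(om lam)
      = ((Nat.choose (2 * m) m : ℂ))⁻¹ * (v^(2*m) * Gc lam m v) := by
  have hS := Sc_cont
  simp_rw [← integral_const_mul]
  rw [← integral_finsetSum _ (fun r _ => om_integrable hlam (by fun_prop)), Gc, ← integral_const_mul, ← integral_const_mul]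
  congr 1; ext φ
  have h1 := J_id m (v * Real.cos φ)
  have h2 := J_id m (-(v * Real.cos φ))
  have e : ∑ r ∈ Finset.Icc (-(m:ℤ)) m, cf m r * ((Complex.exp (Complex.I * (r * (v * Real.cos φ))) + Complex.exp (-(Complex.I * (r * (v * Real.cos φ))))) / 2) =
    (∑ r ∈ Finset.Icc (-(m:ℤ)) m, cf m r * Complex.exp (Complex.I * (r * (v * Real.cos φ))) + 
    ∑ r ∈ Finset.Icc (-(m:ℤ)) m, cf m r * Complex.exp (Complex.I * (r * (-(v * Real.cos φ)))) ) / 2 := by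
    rw [← Finset.sum_add_distrib, Finset.sum_div]
    refine Finset.sum_congr rfl fun r _ => ?_
    rw [show Complex.I * (r * (-(v * Real.cos φ))) = -(Complex.I * (r * (v * Real.cos φ))) by ring]
    ring
  rw [e, h1, h2]
  have e3 : 2 * Complex.sin (v * Real.cos φ / 2) = v * ((Real.cos φ : ℂ) * Sc (v * ((Real.cos φ / 2 : ℝ) : ℂ))) := by
    have := Sc_mul (v * ((Real.cos φ / 2 : ℝ) : ℂ))
    rw [show v * (Real.cos φ : ℂ) / 2 = v * ((Real.cos φ / 2 : ℝ) : ℂ) by push_cast; ring, ← this]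
    push_cast; ring
  rw [neg_div, Complex.sin_neg, mul_neg, Even.neg_pow (by simp), e3, mul_pow]
  ring

lemma exists_h {lam : ℝ} (hlam : -(1/2 : ℝ) < lam) (m : ℕ) : ∃ h : ℝ → ℂ, ContDiff ℝ (⊤ : ℕ∞) h ∧ HasCompactSupport h ∧
    ∀ u : ℝ, |2*Real.pi*u| ≤ 3/4 → ((Nat.choose (2 * m) m : ℂ))⁻¹ * Gc lam m ((2*Real.pi*u : ℝ) : ℂ) * h u = 1 := by
  have hpi := Real.pi_pos
  have hCh : (Nat.choose (2 * m) m : ℂ) ≠ 0 := by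
    exact_mod_cast (Nat.choose_pos (by omega)).ne'
  let χ : ContDiffBump (0:ℝ) := ⟨3/(8*Real.pi), 1/(2*Real.pi), by positivity, by
    rw [div_lt_div_iff₀ (by positivity) (by positivity)]; nlinarith⟩
  let g : ℝ → ℂ := fun u => ((Nat.choose (2 * m) m : ℂ))⁻¹ * Gc lam m ((2*Real.pi*u : ℝ) : ℂ)
  have hg : ContDiff ℝ (⊤ : ℕ∞) g := by
    have h1 : ContDiff ℂ (⊤ : ℕ∞) (Gc lam m) := (Gc_diff hlam m).contDiff
    have h2 : ContDiff ℝ (⊤ : ℕ∞) (fun u : ℝ => ((2*Real.pi*u : ℝ) : ℂ)) :=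
      Complex.ofRealCLM.contDiff.comp (contDiff_const.mul contDiff_id)
    exact contDiff_const.mul ((h1.restrict_scalars ℝ).comp h2)
  have hg0 : ∀ u : ℝ, |2*Real.pi*u| ≤ 2 → g u ≠ 0 := fun u hu =>
    mul_ne_zero (inv_ne_zero hCh) (Gc_ne hlam m hu)
  have hχ : ContDiff ℝ (⊤ : ℕ∞) (fun u => ((χ u : ℝ) : ℂ)) := Complex.ofRealCLM.contDiff.comp χ.contDiff
  have habs : ∀ u : ℝ, |2*Real.pi*u| = 2*Real.pi*|u| := fun u => by
    rw [abs_mul, abs_of_pos (by positivity)]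
  refine ⟨fun u => (χ u : ℂ) / g u, ?_, ?_, ?_⟩
  · rw [contDiff_iff_contDiffAt]
    intro u
    by_cases hu : |2*Real.pi*u| ≤ 2
    · simp only [div_eq_mul_inv]
      exact hχ.contDiffAt.mul (hg.contDiffAt.inv (hg0 u hu))
    · have hz : (fun u => (χ u : ℂ) / g u) =ᶠ[nhds u] fun _ => 0 := by
        have ho : IsOpen {u : ℝ | 2 < |2*Real.pi*u|} := isOpen_lt continuous_const (by fun_prop)
        filter_upwards [ho.mem_nhds (lt_of_not_ge hu)] with y hy
        have : χ y = 0 := by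
          refine χ.zero_of_le_dist ?_
          have hy' : 2 < |2*Real.pi*y| := hy
          rw [habs] at hy'
          show 1/(2*Real.pi) ≤ dist y 0
          rw [Real.dist_0_eq_abs, div_le_iff₀ (by positivity)]
          linarith
        simp [this]
      exact contDiffAt_const.congr_of_eventuallyEq hz
  · refine HasCompactSupport.intro (isCompact_closedBall (0:ℝ) (1/(2*Real.pi))) fun x hx => ?_
    have : χ x = 0 := χ.zero_of_le_dist (by
      rw [Metric.mem_closedBall, not_le] at hx
      exact hx.le)
    simp [this]
  · intro u hu
    have h1 : χ u = 1 := χ.one_of_mem_closedBall (by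
      rw [habs] at hu
      rw [Metric.mem_closedBall, Real.dist_0_eq_abs]
      show |u| ≤ 3/(8*Real.pi)
      rw [le_div_iff₀ (by positivity)]
      linarith)
    have h2 := hg0 u (by linarith)
    show g u * ((χ u : ℂ) / g u) = 1
    rw [h1]
    field_simp
    simp



lemma FT_dual {h Y : ℝ → ℂ} (hh : Integrable h) (hY : Integrable Y) :
    ∫ s, Y s * FourierTransform.fourier h s = ∫ u, FourierTransform.fourier Y u * h u := by
  have := VectorFourier.integral_fourierIntegral_smul_eq_flip (L := innerₗ ℝ) (μ := volume) (ν := volume)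
      Real.continuous_fourierChar continuous_inner hY hh
  have e : (innerₗ ℝ : ℝ →ₗ[ℝ] ℝ →ₗ[ℝ] ℝ).flip = innerₗ ℝ := by
    ext; simp
  rw [e] at this
  exact this.symm

lemma FT_trans (Y : ℝ → ℂ) (c u : ℝ) : FourierTransform.fourier (fun s => Y (s + c)) u =
    Complex.exp (Complex.I * (c * ((2*Real.pi*u : ℝ) : ℂ))) * FourierTransform.fourier Y u := by
  rw [Real.fourier_real_eq_integral_exp_smul, Real.fourier_real_eq_integral_exp_smul, ← integral_const_mul]
  symm
  rw [← integral_add_right_eq_self _ c]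
  congr 1; ext s
  rw [smul_eq_mul, smul_eq_mul, ← mul_assoc, ← Complex.exp_add]
  congr 2
  push_cast
  ring

lemma fub {lam : ℝ} (hlam : -(1/2 : ℝ) < lam) {q : ℝ → ℝ → ℂ} (hq : Continuous (fun p : ℝ × ℝ => q p.1 p.2)) {B : ℝ}
    (hb : ∀ s φ, ‖q s φ‖ ≤ B) {H : ℝ → ℂ} (hH : Integrable H) :
    Integrable (fun s => (∫ φ, q s φ ∂(om lam)) * H s) ∧
    ∫ s, (∫ φ, q s φ ∂(om lam)) * H s = ∫ φ, (∫ s, q s φ * H s) ∂(om lam) := by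
  have := om_finite hlam
  have h1 : Integrable (fun p : ℝ × ℝ => H p.1 * (1:ℂ)) (volume.prod (om lam)) := hH.mul_prod (integrable_const (1:ℂ))
  have h2 : Integrable (fun p : ℝ × ℝ => q p.1 p.2 * (H p.1 * 1)) (volume.prod (om lam)) :=
    h1.bdd_mul hq.aestronglyMeasurable (Filter.Eventually.of_forall fun p => hb p.1 p.2)
  simp only [mul_one] at h2
  simp_rw [← integral_mul_const]
  exact ⟨h2.integral_prod_left, integral_integral_swap h2⟩

lemma Y_int {Y : ℝ → ℂ} (hY : ContDiff ℝ (⊤ : ℕ∞) Y) {A ρ : ℝ} 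
    (hb : ∀ (j : ℕ) (s : ℝ), ‖iteratedDeriv j Y s‖ ≤ A * ρ^j * (1+s^2)⁻¹) (j : ℕ) :
    Integrable (iteratedDeriv j Y) ∧ ∀ u, ‖FourierTransform.fourier (iteratedDeriv j Y) u‖ ≤ A * ρ^j * Real.pi := by
  have hc : Continuous (iteratedDeriv j Y) := hY.continuous_iteratedDeriv j (by exact_mod_cast le_top)
  have hi : Integrable (fun s : ℝ => A * ρ^j * (1+s^2)⁻¹) := integrable_inv_one_add_sq.const_mul _
  refine ⟨hi.mono' hc.aestronglyMeasurable (Filter.Eventually.of_forall (hb j)), fun u => ?_⟩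
  rw [Real.fourier_real_eq_integral_exp_smul]
  refine (norm_integral_le_of_norm_le hi (Filter.Eventually.of_forall fun s => ?_)).trans (le_of_eq ?_)
  · rw [norm_smul, show (((-2 * Real.pi * s * u : ℝ) : ℂ) * Complex.I) = (((-2 * Real.pi * s * u : ℝ)) : ℂ) * Complex.I from rfl,
      Complex.norm_exp_ofReal_mul_I, one_mul]
    exact hb j s
  · rw [integral_const_mul, integral_univ_inv_one_add_sq]

lemma FT_main {lam : ℝ} (hlam : -(1/2 : ℝ) < lam) (m : ℕ) {h : ℝ → ℂ} (hc : ContDiff ℝ (⊤ : ℕ∞) h) (hs : HasCompactSupport h)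
    (hh : ∀ u : ℝ, |2*Real.pi*u| ≤ 3/4 → ((Nat.choose (2 * m) m : ℂ))⁻¹ * Gc lam m ((2*Real.pi*u : ℝ) : ℂ) * h u = 1)
    (hH : Integrable (FourierTransform.fourier h))
    {Y : ℝ → ℂ} (hY : ContDiff ℝ (⊤ : ℕ∞) Y) {A ρ : ℝ} (hρ : 0 < ρ) (hρ' : ρ ≤ 3/4)
    (hb : ∀ (j : ℕ) (s : ℝ), ‖iteratedDeriv j Y s‖ ≤ A * ρ^j * (1+s^2)⁻¹) :
    ∫ s, (∑ r ∈ Finset.Icc (-(m:ℤ)) m, cf m r * ∫ φ, (Y (s + r * Real.cos φ) + Y (s - r * Real.cos φ))/2 ∂(om lam)) * FourierTransform.fourier h s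
      = (-1)^m * iteratedDeriv (2*m) Y 0 := by
  have hintg := fun j => (Y_int hY hb j).1
  have hbd := fun j => (Y_int hY hb j).2
  have hYi : Integrable Y := by simpa using hintg 0
  have hYc : Continuous Y := hY.continuous
  have hYb : ∀ s, ‖Y s‖ ≤ A := fun s => by
    have h0 := hb 0 s
    have hA : 0 ≤ A := by have := (norm_nonneg _).trans (hb 0 0); simpa using this
    rw [iteratedDeriv_zero, pow_zero, mul_one] at h0
    refine h0.trans (mul_le_of_le_one_right hA (inv_le_one_of_one_le₀ (by nlinarith)))
  have hhi : Integrable h := hc.continuous.integrable_of_hasCompactSupport hs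
  set η := FourierTransform.fourier Y with hη
  have hηc : Continuous η := by
    have := VectorFourier.fourierIntegral_continuous (L := innerₗ ℝ) (μ := volume) Real.continuous_fourierChar continuous_inner hYi
    exact this
  have hder : ∀ j : ℕ, ∀ u : ℝ, FourierTransform.fourier (iteratedDeriv j Y) u = (2 * Real.pi * Complex.I * u)^j * η u := fun j u => by
    rw [Real.fourier_iteratedDeriv hY (fun n _ => hintg n) (by exact_mod_cast le_top)]
    rfl
  have hpi := Real.pi_pos
  have hη0 : ∀ u : ℝ, 3/4 < |2*Real.pi*u| → η u = 0 := by
    intro u hu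
    have hpos : 0 < |2*Real.pi*u| := by linarith
    have h1 : ∀ j : ℕ, ‖η u‖ ≤ A * Real.pi * (ρ / |2*Real.pi*u|)^j := fun j => by
      have h2 := hbd j u
      rw [hder, norm_mul, norm_pow] at h2
      have e : ‖(2 * Real.pi * Complex.I * u : ℂ)‖ = |2*Real.pi*u| := by
        simp [abs_mul]
      rw [e] at h2
      rw [div_pow, mul_div_assoc', le_div_iff₀ (by positivity)]
      linarith
    have h3 : Filter.Tendsto (fun j : ℕ => A * Real.pi * (ρ / |2*Real.pi*u|)^j) Filter.atTop (nhds (A * Real.pi * 0)) :=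
      (tendsto_pow_atTop_nhds_zero_of_lt_one (by positivity) (by rw [div_lt_one hpos]; linarith)).const_mul _
    rw [mul_zero] at h3
    have h4 := ge_of_tendsto' h3 h1
    exact norm_le_zero_iff.1 h4
  have hηb : ∀ u, ‖η u‖ ≤ A * Real.pi := fun u => by simpa using hbd 0 u
  have hηh : Integrable (fun u => η u * h u) := hhi.bdd_mul hηc.aestronglyMeasurable (Filter.Eventually.of_forall hηb)
  have hηs : HasCompactSupport η := by
    refine HasCompactSupport.intro (isCompact_closedBall (0:ℝ) 1) fun x hx => hη0 x ?_
    rw [Metric.mem_closedBall, not_le, Real.dist_0_eq_abs] at hx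
    rw [abs_mul, abs_of_pos (by positivity)]
    nlinarith [Real.pi_gt_three]
  -- translation
  have hK : ∀ c : ℝ, ∫ s, (Y (s + c) + Y (s - c))/2 * FourierTransform.fourier h s =
      ∫ u, (Complex.exp (Complex.I * (c * ((2*Real.pi*u : ℝ) : ℂ))) + Complex.exp (-(Complex.I * (c * ((2*Real.pi*u : ℝ) : ℂ))))) / 2 * (η u * h u) := by
    intro c
    have i1 : Integrable (fun s => Y (s + c)) := hYi.comp_add_right c
    have i2 : Integrable (fun s => Y (s + -c)) := hYi.comp_add_right (-c)
    have i3 : Integrable (fun s => (Y (s + c) + Y (s - c))/2) := by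
      simpa [sub_eq_add_neg] using (i1.add i2).div_const 2
    rw [FT_dual hhi i3]
    congr 1; ext u
    have e : FourierTransform.fourier (fun s => (Y (s + c) + Y (s - c))/2) u =
        (FourierTransform.fourier (fun s => Y (s + c)) u + FourierTransform.fourier (fun s => Y (s + -c)) u) / 2 := by
      rw [Real.fourier_real_eq_integral_exp_smul, Real.fourier_real_eq_integral_exp_smul, Real.fourier_real_eq_integral_exp_smul,
        ← integral_add, ← integral_div]
      · congr 1; ext s
        simp only [smul_eq_mul, sub_eq_add_neg]
        ring
      · exact i1.bdd_mul (c := 1) (Continuous.aestronglyMeasurable (by fun_prop)) (Filter.Eventually.of_forall fun s => by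
          rw [Complex.norm_exp_ofReal_mul_I])
      · exact i2.bdd_mul (c := 1) (Continuous.aestronglyMeasurable (by fun_prop)) (Filter.Eventually.of_forall fun s => by
          rw [Complex.norm_exp_ofReal_mul_I])
    rw [e, FT_trans, FT_trans]
    rw [show Complex.I * (((-c : ℝ) : ℂ) * ((2*Real.pi*u : ℝ) : ℂ)) = -(Complex.I * (c * ((2*Real.pi*u : ℝ) : ℂ))) by push_cast; ring]
    ring
  have f1 := fun r : ℤ => fub hlam (q := fun s φ => (Y (s + r * Real.cos φ) + Y (s - r * Real.cos φ))/2) (by fun_prop) (B := A)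
    (fun s φ => by
      rw [norm_div]
      have := norm_add_le (Y (s + r * Real.cos φ)) (Y (s - r * Real.cos φ))
      have h1 := hYb (s + r * Real.cos φ)
      have h2 := hYb (s - r * Real.cos φ)
      have h4 : ‖(2:ℂ)‖ = 2 := by norm_num
      rw [h4]
      linarith) hH
  have f2 := fun r : ℤ => fub hlam (q := fun u φ => (Complex.exp (Complex.I * (r * ((2*Real.pi*u : ℝ) * Real.cos φ))) + Complex.exp (-(Complex.I * (r * ((2*Real.pi*u : ℝ) * Real.cos φ))))) / 2) (by fun_prop) (B := 1)
    (fun u φ => by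
      rw [norm_div]
      have := norm_add_le (Complex.exp (Complex.I * (r * ((2*Real.pi*u : ℝ) * Real.cos φ)))) (Complex.exp (-(Complex.I * (r * ((2*Real.pi*u : ℝ) * Real.cos φ)))))
      have h1 : ‖Complex.exp (Complex.I * (r * ((2*Real.pi*u : ℝ) * Real.cos φ)))‖ = 1 := by
        rw [show Complex.I * (r * ((2*Real.pi*u : ℝ) * Real.cos φ)) = ((r * ((2*Real.pi*u : ℝ) * Real.cos φ) : ℝ) : ℂ) * Complex.I by push_cast; ring]
        exact Complex.norm_exp_ofReal_mul_I _
      have h2 : ‖Complex.exp (-(Complex.I * (r * ((2*Real.pi*u : ℝ) * Real.cos φ))))‖ = 1 := by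
        rw [show -(Complex.I * (r * ((2*Real.pi*u : ℝ) * Real.cos φ))) = ((-(r * ((2*Real.pi*u : ℝ) * Real.cos φ)) : ℝ) : ℂ) * Complex.I by push_cast; ring]
        exact Complex.norm_exp_ofReal_mul_I _
      have h4 : ‖(2:ℂ)‖ = 2 := by norm_num
      rw [h4]
      linarith) hηh
  simp_rw [Finset.sum_mul, mul_assoc]
  rw [integral_finsetSum _ (fun r _ => ((f1 r).1.const_mul _))]
  have e1 : ∀ r : ℤ, ∫ s, cf m r * ((∫ φ, (Y (s + r * Real.cos φ) + Y (s - r * Real.cos φ))/2 ∂(om lam)) * FourierTransform.fourier h s) =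
      ∫ u, cf m r * ((∫ φ, (Complex.exp (Complex.I * (r * ((2*Real.pi*u : ℝ) * Real.cos φ))) + Complex.exp (-(Complex.I * (r * ((2*Real.pi*u : ℝ) * Real.cos φ))))) / 2 ∂(om lam)) * (η u * h u)) := by
    intro r
    rw [integral_const_mul, integral_const_mul, (f1 r).2, (f2 r).2]
    congr 2; ext φ
    rw [hK]
    congr 1; ext u
    rw [show Complex.I * (((r * Real.cos φ : ℝ) : ℂ) * ((2*Real.pi*u : ℝ) : ℂ)) = Complex.I * (r * ((2*Real.pi*u : ℝ) * Real.cos φ)) by push_cast; ring]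
  simp_rw [e1]
  rw [← integral_finsetSum _ (fun r _ => ((f2 r).1.const_mul _))]
  have e2 : ∀ u : ℝ, ∑ r ∈ Finset.Icc (-(m:ℤ)) m, cf m r * ((∫ φ, (Complex.exp (Complex.I * (r * ((2*Real.pi*u : ℝ) * Real.cos φ))) + Complex.exp (-(Complex.I * (r * ((2*Real.pi*u : ℝ) * Real.cos φ))))) / 2 ∂(om lam)) * (η u * h u)) =
      (-1)^m * FourierTransform.fourier (iteratedDeriv (2*m) Y) u := by
    intro u
    simp_rw [← mul_assoc (cf m _), ← Finset.sum_mul]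
    rw [J_G hlam, hder]
    by_cases hu : |2*Real.pi*u| ≤ 3/4
    · have h1 := hh u hu
      have h2 : (2 * Real.pi * Complex.I * u : ℂ)^(2*m) = (-1)^m * ((2*Real.pi*u : ℝ) : ℂ)^(2*m) := by
        rw [show (2 * Real.pi * Complex.I * u : ℂ) = Complex.I * ((2*Real.pi*u : ℝ) : ℂ) by push_cast; ring, mul_pow, pow_mul Complex.I, Complex.I_sq]
      have h3 : ((-1:ℂ)^m)*(-1)^m = 1 := by rw [← pow_add, ← two_mul, pow_mul]; norm_num
      rw [h2]
      linear_combination (((2*Real.pi*u : ℝ) : ℂ)^(2*m) * η u) * h1 - (((2*Real.pi*u : ℝ) : ℂ)^(2*m) * η u) * h3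
    · rw [hη0 u (lt_of_not_ge hu)]; simp
  simp_rw [e2]
  rw [integral_const_mul]
  congr 1
  have hcd0 : ∀ j : ℕ, Continuous (iteratedDeriv j Y) := fun j => hY.continuous_iteratedDeriv j (by exact_mod_cast le_top)
  have hcd := hcd0 (2*m)
  have hfi : Integrable (FourierTransform.fourier (iteratedDeriv (2*m) Y)) := by
    have : FourierTransform.fourier (iteratedDeriv (2*m) Y) = fun u : ℝ => (2 * Real.pi * Complex.I * u : ℂ)^(2*m) * η u := funext (hder _)
    rw [this]
    exact Continuous.integrable_of_hasCompactSupport (by fun_prop) hηs.mul_left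
  have hinv := congrFun (hcd.fourierInv_fourier_eq (hintg _) hfi) 0
  rw [← hinv, Real.fourierInv_eq]
  simp



lemma iter_real {Y : ℂ → ℂ} (hY : Differentiable ℂ Y) (j : ℕ) :
    iteratedDeriv j (fun s : ℝ => Y s) = fun s : ℝ => iteratedDeriv j Y s := by
  induction j with
  | zero => simp
  | succ j ih =>
    ext s
    rw [iteratedDeriv_succ, ih, iteratedDeriv_succ]
    have hd : Differentiable ℂ (iteratedDeriv j Y) :=
      (hY.contDiff (n := (⊤:ℕ∞))).differentiable_iteratedDeriv j (by exact_mod_cast ENat.natCast_lt_top j)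
    exact (hd s).hasDerivAt.comp_ofReal.deriv

lemma damp_deriv {Y : ℂ → ℂ} (hY : Differentiable ℂ Y) {B : ℝ}
    (hb : ∀ z, ‖Y z‖ * (1+‖z‖)^2 ≤ B * Real.exp (13/20 * |z.im|)) (j : ℕ) (s : ℝ) :
    ‖iteratedDeriv j Y s‖ ≤ (B * 80^2 * 28) * (7/10)^j * (1+s^2)⁻¹ := by
  have hB : 0 ≤ B := by
    have := hb 0
    simp at this
    exact (norm_nonneg _).trans this
  have hs1 : 0 < 1 + s^2 := by positivity
  have h1 : ∀ r : ℝ, 0 < r → (‖iteratedDeriv j Y s‖ / j.factorial) * r^j ≤ (B * 80^2 * (1+s^2)⁻¹) * Real.exp (27/40 * r) := by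
    intro r hr
    have hC := Complex.norm_iteratedDeriv_le_of_forall_mem_sphere_norm_le (C := (B * 80^2 * (1+s^2)⁻¹) * Real.exp (27/40 * r)) j hr hY.diffContOnCl (c := (s:ℂ)) ?_
    · have hj : (0:ℝ) < j.factorial := by positivity
      rw [div_mul_eq_mul_div, div_le_iff₀ hj]
      rw [le_div_iff₀ (by positivity)] at hC
      linarith
    · intro z hz
      rw [mem_sphere_iff_norm] at hz
      have him : |z.im| ≤ r := by
        have := Complex.abs_im_le_norm (z - s)
        rw [hz] at this; simpa using this
      have hss : |s| ≤ ‖z‖ + r := by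
        have := norm_sub_le z (z - s)
        rw [hz] at this
        simpa using this
      have h80 : 1 + r ≤ 80 * Real.exp (r/80) := by
        have := Real.add_one_le_exp (r/80)
        linarith
      have hz0 := norm_nonneg z
      have h2 : 1 + s^2 ≤ ((1+‖z‖) * (1+r))^2 := by
        have : 1 + |s| ≤ (1+‖z‖) * (1+r) := by nlinarith
        have h3 : 1 + s^2 ≤ (1+|s|)^2 := by nlinarith [sq_abs s, abs_nonneg s]
        exact h3.trans (by gcongr)
      have h4 : (1+r)^2 ≤ 80^2 * Real.exp (r/40) := by
        have : Real.exp (r/40) = Real.exp (r/80)^2 := by rw [← Real.exp_nat_mul]; congr 1; push_cast; ring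
        rw [this, ← mul_pow]; gcongr
      have h5 : Real.exp (27/40*r) = Real.exp (13/20*r) * Real.exp (r/40) := by
        rw [← Real.exp_add]; congr 1; ring
      have h6 : ‖Y z‖ * (1+‖z‖)^2 ≤ B * Real.exp (13/20 * r) :=
        (hb z).trans (mul_le_mul_of_nonneg_left (Real.exp_le_exp.2 (mul_le_mul_of_nonneg_left him (by norm_num))) hB)
      rw [h5, mul_right_comm, ← div_eq_mul_inv, le_div_iff₀ hs1]
      calc ‖Y z‖ * (1+s^2) ≤ ‖Y z‖ * ((1+‖z‖) * (1+r))^2 := by gcongr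
        _ = (‖Y z‖ * (1+‖z‖)^2) * (1+r)^2 := by ring
        _ ≤ (B * Real.exp (13/20 * r)) * (80^2 * Real.exp (r/40)) := by gcongr
        _ = _ := by ring
  have h2 := fact_of_exp (κ := 27/40) (ρ := 7/10) (by norm_num) (by norm_num) j h1
  have hj : (0:ℝ) < j.factorial := by positivity
  rw [div_mul_cancel₀ _ hj.ne'] at h2
  refine h2.trans (le_of_eq ?_)
  norm_num
  ring

lemma Ev_taylor {κ C : ℝ} (hκ : 0 ≤ κ) {a : ℕ → ℂ} (ha : Bd κ C a) (m : ℕ) : iteratedDeriv (2*m) (Ev a) 0 = a m := by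
  let q : ℕ → ℂ := fun n => if Even n then a (n/2) / (n.factorial : ℂ) else 0
  have h1 : HasFPowerSeriesAt (Ev a) (FormalMultilinearSeries.ofScalars ℂ q) 0 := by
    rw [hasFPowerSeriesAt_iff]
    refine Filter.Eventually.of_forall fun z => ?_
    rw [zero_add]
    have h := (Ev_summable hκ ha z).hasSum
    have hinj : Function.Injective (fun k : ℕ => 2*k) := fun x y h => by simpa using h
    refine (hinj.hasSum_iff (f := fun n => z ^ n • (FormalMultilinearSeries.ofScalars ℂ q).coeff n) ?_).1 ?_
    · intro n hn
      have : ¬ Even n := fun he => hn (by obtain ⟨k, hk⟩ := he; exact ⟨k, by simp; omega⟩)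
      simp [FormalMultilinearSeries.coeff_ofScalars, q, this]
    · refine hs_congr h fun k => ?_
      simp [FormalMultilinearSeries.coeff_ofScalars, q]
      ring
  have h2 := (Ev_diff hκ ha).analyticAt 0 |>.hasFPowerSeriesAt
  have h3 := congrArg (fun p => FormalMultilinearSeries.coeff p (2*m)) (h1.eq_formalMultilinearSeries h2)
  simp only [FormalMultilinearSeries.coeff_ofScalars] at h3
  have f1 : ((2*m).factorial : ℂ) ≠ 0 := by exact_mod_cast (Nat.factorial_pos _).ne'
  simp only [q, even_two_mul, if_true] at h3
  rw [show 2*m/2 = m by omega] at h3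
  field_simp at h3
  exact h3.symm

lemma Ev_sum {ι : Type*} (S : Finset ι) {κ : ℝ} {C : ι → ℝ} (hκ : 0 ≤ κ) {b : ι → ℕ → ℂ} (c : ι → ℂ) (hb : ∀ i, Bd κ (C i) (b i)) (z : ℂ) :
    Ev (fun k => ∑ i ∈ S, c i * b i k) z = ∑ i ∈ S, c i * Ev (b i) z := by
  have h := hasSum_sum (s := S) (fun i _ => ((Ev_summable hκ (hb i) z).hasSum.mul_left (c i)))
  refine Eq.trans ?_ h.tsum_eq
  unfold Ev
  refine tsum_congr fun k => ?_
  rw [Finset.sum_mul, Finset.sum_div]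
  exact Finset.sum_congr rfl fun i _ => by ring

lemma one_add_pow_integrable (g : SchwartzMap ℝ ℂ) (n : ℕ) : Integrable (fun s : ℝ => (1+|s|)^n * ‖g s‖) := by
  have h1 := g.integrable_pow_mul volume 0
  have h2 := g.integrable_pow_mul volume n
  refine ((h1.add h2).const_mul (2^(n-1))).mono' (Continuous.aestronglyMeasurable (by have := g.continuous; fun_prop)) (Filter.Eventually.of_forall fun s => ?_)
  rw [Real.norm_of_nonneg (by positivity)]
  have := add_pow_le zero_le_one (abs_nonneg s) n
  simp only [Pi.add_apply, Real.norm_eq_abs, pow_zero]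
  rw [one_pow] at this
  calc _ ≤ (2^(n-1) * (1 + |s|^n)) * ‖g s‖ := by gcongr
    _ = _ := by ring



lemma damp_bd {B : ℝ} (hB : ∀ w, ‖Sc w‖ * (1+‖w‖) ≤ B * Real.exp |w.im|) {y : ℂ → ℂ} {M : ℝ} {n : ℕ} (hM : 0 ≤ M)
    (hb : ∀ z, ‖y z‖ ≤ M * (1+‖z‖)^n * Real.exp (3/5 * |z.im|)) {δ : ℝ} (hδ : 0 < δ) (hδ1 : δ ≤ 1)
    (hδN : ((n+2 : ℕ):ℝ) * δ ≤ 1/20) (z : ℂ) :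
    ‖y z * Sc (δ * z)^(n+2)‖ * (1+‖z‖)^2 ≤ (M * B^(n+2) / δ^(n+2)) * Real.exp (13/20 * |z.im|) := by
  have h1 : ‖Sc (δ*z)‖ * (δ * (1+‖z‖)) ≤ B * Real.exp (δ * |z.im|) := by
    have h := hB (δ*z)
    have e1 : ‖(δ:ℂ)*z‖ = δ * ‖z‖ := by rw [norm_mul, Complex.norm_real, Real.norm_of_nonneg hδ.le]
    have e2 : |((δ:ℂ)*z).im| = δ * |z.im| := by simp [abs_mul, abs_of_pos hδ]
    rw [e1, e2] at h
    refine le_trans ?_ h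
    gcongr
    nlinarith
  have h2 := pow_le_pow_left₀ (by positivity) h1 (n+2)
  have h3 : Real.exp (δ * |z.im|)^(n+2) ≤ Real.exp (1/20 * |z.im|) := by
    rw [← Real.exp_nat_mul]
    apply Real.exp_le_exp.2
    rw [← mul_assoc]; gcongr
  have hB0 : 0 ≤ B := by
    have := (mul_nonneg (norm_nonneg (Sc 0)) (by positivity)).trans (hB 0)
    simpa using this
  rw [norm_mul, norm_pow, div_mul_eq_mul_div, le_div_iff₀ (by positivity)]
  have h5 : Real.exp (13/20*|z.im|) = Real.exp (3/5*|z.im|) * Real.exp (1/20*|z.im|) := by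
    rw [← Real.exp_add]; congr 1; ring
  calc ‖y z‖ * ‖Sc (δ*z)‖^(n+2) * (1+‖z‖)^2 * δ^(n+2)
      ≤ (M * (1+‖z‖)^n * Real.exp (3/5 * |z.im|)) * ‖Sc (δ*z)‖^(n+2) * (1+‖z‖)^2 * δ^(n+2) := by gcongr; exact hb z
    _ = M * Real.exp (3/5 * |z.im|) * (‖Sc (δ*z)‖ * (δ * (1+‖z‖)))^(n+2) := by rw [mul_pow, mul_pow]; ring
    _ ≤ M * Real.exp (3/5 * |z.im|) * (B * Real.exp (δ * |z.im|))^(n+2) := by gcongr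
    _ = M * Real.exp (3/5 * |z.im|) * B^(n+2) * Real.exp (δ * |z.im|)^(n+2) := by rw [mul_pow]; ring
    _ ≤ M * Real.exp (3/5 * |z.im|) * B^(n+2) * Real.exp (1/20 * |z.im|) := by gcongr
    _ = _ := by rw [h5]; ring

/-- the averaged difference -/
def Th (lam : ℝ) (m : ℕ) (Y : ℝ → ℂ) (s : ℝ) : ℂ :=
  ∑ r ∈ Finset.Icc (-(m:ℤ)) m, cf m r * ∫ φ, (Y (s + r * Real.cos φ) + Y (s - r * Real.cos φ))/2 ∂(om lam)

lemma Th_meas {lam : ℝ} (hlam : -(1/2 : ℝ) < lam) (m : ℕ) {Y : ℝ → ℂ} (hY : Continuous Y) : StronglyMeasurable (Th lam m Y) := by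
  have := om_finite hlam
  unfold Th
  refine Finset.stronglyMeasurable_fun_sum _ fun r _ => ?_
  refine StronglyMeasurable.const_mul ?_ _
  refine StronglyMeasurable.integral_prod_right (f := fun s φ => (Y (s + r * Real.cos φ) + Y (s - r * Real.cos φ))/2) ?_
  exact Continuous.stronglyMeasurable (by unfold Function.uncurry; fun_prop)

lemma arg_bd {m : ℕ} {r : ℤ} (hr : r ∈ Finset.Icc (-(m:ℤ)) m) (φ : ℝ) : |(r:ℝ) * Real.cos φ| ≤ m := by
  rw [abs_mul]
  have h1 : |(r:ℝ)| ≤ m := by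
    rw [Finset.mem_Icc] at hr
    rw [abs_le]; exact ⟨by exact_mod_cast hr.1, by exact_mod_cast hr.2⟩
  have := Real.abs_cos_le_one φ
  have := abs_nonneg (r:ℝ)
  have := abs_nonneg (Real.cos φ)
  nlinarith

lemma pt_bd {n m : ℕ} {Y : ℝ → ℂ} {M : ℝ} (hM : 0 ≤ M) (hb : ∀ s, ‖Y s‖ ≤ M * (1+|s|)^n) (s u : ℝ) (hu : |u| ≤ m) :
    ‖(Y (s + u) + Y (s - u))/2‖ ≤ M * ((1+m)*(1+|s|))^n := by
  have h1 : ∀ v : ℝ, |v| ≤ m → ‖Y (s+v)‖ ≤ M * ((1+m)*(1+|s|))^n := fun v hv => by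
    refine (hb _).trans ?_
    have : 1 + |s+v| ≤ (1+m)*(1+|s|) := by
      have := abs_add_le s v
      have := abs_nonneg s
      have : (0:ℝ) ≤ m := Nat.cast_nonneg m
      nlinarith
    gcongr
  have h2 := h1 u hu
  have h3 := h1 (-u) (by rwa [abs_neg])
  rw [← sub_eq_add_neg] at h3
  rw [norm_div]
  have := norm_add_le (Y (s+u)) (Y (s-u))
  simp only [Complex.norm_ofNat]
  linarith

lemma Th_bd {lam : ℝ} (hlam : -(1/2 : ℝ) < lam) (m : ℕ) : ∃ K : ℝ, 0 ≤ K ∧ ∀ (n : ℕ) (Y : ℝ → ℂ) (M : ℝ), 0 ≤ M → (∀ s, ‖Y s‖ ≤ M * (1+|s|)^n) →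
    ∀ s, ‖Th lam m Y s‖ ≤ K * (M * ((1+m)*(1+|s|))^n) := by
  have := om_finite hlam
  refine ⟨∑ r ∈ Finset.Icc (-(m:ℤ)) m, ‖cf m r‖ * (om lam).real Set.univ, by positivity, fun n Y M hM hb s => ?_⟩
  unfold Th
  rw [Finset.sum_mul]
  refine (norm_sum_le _ _).trans (Finset.sum_le_sum fun r hr => ?_)
  rw [norm_mul, mul_assoc]
  gcongr
  refine (norm_integral_le_of_norm_le_const (C := M * ((1+m)*(1+|s|))^n) (Filter.Eventually.of_forall fun φ => pt_bd hM hb s _ (arg_bd hr φ))).trans ?_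
  rw [mul_comm]

lemma Th_lim {lam : ℝ} (hlam : -(1/2 : ℝ) < lam) (m : ℕ) {n : ℕ} {Y : ℝ → ℂ} {Yj : ℕ → ℝ → ℂ} {M : ℝ} (hM : 0 ≤ M)
    (hb : ∀ j s, ‖Yj j s‖ ≤ M * (1+|s|)^n) (hc : ∀ j, Continuous (Yj j))
    (hl : ∀ s, Filter.Tendsto (fun j => Yj j s) Filter.atTop (nhds (Y s))) (s : ℝ) :
    Filter.Tendsto (fun j => Th lam m (Yj j) s) Filter.atTop (nhds (Th lam m Y s)) := by
  have := om_finite hlam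
  unfold Th
  refine tendsto_finsetSum _ fun r hr => ?_
  refine Filter.Tendsto.const_mul _ ?_
  refine tendsto_integral_of_dominated_convergence (fun _ => M * ((1+m)*(1+|s|))^n) ?_ (integrable_const _) ?_ ?_
  · intro j
    have := hc j
    exact Continuous.aestronglyMeasurable (by fun_prop)
  · exact fun j => Filter.Eventually.of_forall fun φ => pt_bd hM (hb j) s _ (arg_bd hr φ)
  · exact Filter.Eventually.of_forall fun φ => ((hl _).add (hl _)).div_const 2

lemma iter_lim {y : ℂ → ℂ} {yj : ℕ → ℂ → ℂ} (hy : Differentiable ℂ y) (hyj : ∀ j, Differentiable ℂ (yj j))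
    (hl : TendstoUniformlyOn yj y Filter.atTop (Metric.sphere 0 1)) (k : ℕ) :
    Filter.Tendsto (fun j => iteratedDeriv k (yj j) 0) Filter.atTop (nhds (iteratedDeriv k y 0)) := by
  rw [Metric.tendsto_atTop]
  intro ε hε
  rw [Metric.tendstoUniformlyOn_iff] at hl
  have hk : (0:ℝ) < k.factorial := by positivity
  obtain ⟨N, hN⟩ := Filter.eventually_atTop.1 (hl (ε/2/k.factorial) (by positivity))
  refine ⟨N, fun j hj => ?_⟩
  rw [dist_eq_norm]
  have e : iteratedDeriv k (yj j) 0 - iteratedDeriv k y 0 = iteratedDeriv k (yj j - y) 0 := by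
    rw [iteratedDeriv_sub ((hyj j).contDiff.contDiffAt) (hy.contDiff.contDiffAt)]
  rw [e]
  have h := Complex.norm_iteratedDeriv_le_of_forall_mem_sphere_norm_le (C := ε/2/k.factorial) k one_pos
    ((hyj j).sub hy).diffContOnCl (c := 0) (fun z hz => by
      have := hN j hj z hz
      rw [dist_comm, dist_eq_norm] at this
      exact this.le)
  refine h.trans_lt ?_
  rw [one_pow, div_one, mul_div_cancel₀ _ hk.ne']
  linarith

lemma FT_lim {lam : ℝ} (hlam : -(1/2 : ℝ) < lam) (m : ℕ) {h : ℝ → ℂ} (hc : ContDiff ℝ (⊤ : ℕ∞) h) (hs : HasCompactSupport h)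
    (hh : ∀ u : ℝ, |2*Real.pi*u| ≤ 3/4 → ((Nat.choose (2 * m) m : ℂ))⁻¹ * Gc lam m ((2*Real.pi*u : ℝ) : ℂ) * h u = 1)
    (hH : Integrable (FourierTransform.fourier h)) {n : ℕ} (hHn : Integrable (fun s : ℝ => (1+|s|)^n * ‖FourierTransform.fourier h s‖))
    {y : ℂ → ℂ} (hy : Differentiable ℂ y) {M : ℝ} (hM : 0 ≤ M)
    (hb : ∀ z, ‖y z‖ ≤ M * (1+‖z‖)^n * Real.exp (3/5 * |z.im|)) :
    ∫ s, Th lam m (fun s => y s) s * FourierTransform.fourier h s = (-1)^m * iteratedDeriv (2*m) y 0 := by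
  obtain ⟨B, hB1, hB⟩ := Sc_bound
  let δ : ℕ → ℝ := fun j => 1/(20*(n+2)*(j+1))
  have hδ0 : ∀ j, 0 < δ j := fun j => by simp only [δ]; positivity
  have hδ1 : ∀ j, δ j ≤ 1 := fun j => by
    simp only [δ]; rw [div_le_one (by positivity)]
    have : (0:ℝ) ≤ n := Nat.cast_nonneg n
    have : (0:ℝ) ≤ j := Nat.cast_nonneg j
    nlinarith [mul_nonneg ‹(0:ℝ) ≤ n› ‹(0:ℝ) ≤ j›]
  have hδN : ∀ j, ((n+2 : ℕ):ℝ) * δ j ≤ 1/20 := fun j => by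
    simp only [δ]
    push_cast
    have : ((n:ℝ)+2) * (1/(20*(n+2)*(j+1))) = 1/20 * (1/(j+1)) := by
      field_simp
    rw [this]
    have : 1/((j:ℝ)+1) ≤ 1 := by rw [div_le_one (by positivity)]; linarith [(Nat.cast_nonneg j : (0:ℝ) ≤ j)]
    linarith
  have hδl : Filter.Tendsto δ Filter.atTop (nhds 0) := by
    have h1 := (tendsto_one_div_add_atTop_nhds_zero_nat (𝕜 := ℝ)).const_mul (1/(20*((n:ℝ)+2)))
    rw [mul_zero] at h1
    refine h1.congr fun j => ?_
    simp only [δ]; field_simp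
  let yj : ℕ → ℂ → ℂ := fun j z => y z * Sc (δ j * z)^(n+2)
  have hyj : ∀ j, Differentiable ℂ (yj j) := fun j =>
    hy.mul ((Sc_diff.comp (by fun_prop : Differentiable ℂ fun z : ℂ => (δ j:ℂ) * z)).pow _)
  have hbr : ∀ s : ℝ, ‖y s‖ ≤ M * (1+|s|)^n := fun s => by
    have := hb s; simpa using this
  have hbj : ∀ j (s : ℝ), ‖yj j s‖ ≤ M * (1+|s|)^n := fun j s => by
    have h1 : ‖Sc (δ j * s)‖ ≤ 1 := by
      rw [← Complex.ofReal_mul, Sc_real, Complex.norm_real]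
      exact Real.abs_sinc_le_one _
    simp only [yj]
    rw [norm_mul, norm_pow]
    calc _ ≤ ‖y s‖ * 1 := by gcongr; exact pow_le_one₀ (norm_nonneg _) h1
      _ ≤ _ := by rw [mul_one]; exact hbr s
  have hlz : ∀ z : ℂ, Filter.Tendsto (fun j => yj j z) Filter.atTop (nhds (y z)) := fun z => by
    have h1 : Filter.Tendsto (fun j => (δ j:ℂ) * z) Filter.atTop (nhds 0) := by
      have := ((Complex.continuous_ofReal.tendsto 0).comp hδl).mul_const z
      simpa using this
    have h2 := ((Sc_cont.tendsto 0).comp h1).pow (n+2)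
    rw [Sc_zero, one_pow] at h2
    have := h2.const_mul (y z)
    rw [mul_one] at this
    exact this
  have hmain : ∀ j, ∫ s, Th lam m (fun s => yj j s) s * FourierTransform.fourier h s = (-1)^m * iteratedDeriv (2*m) (yj j) 0 := fun j => by
    have hd := damp_deriv (hyj j) (damp_bd hB hM hb (hδ0 j) (hδ1 j) (hδN j))
    have hfm := FT_main hlam m hc hs hh hH (Y := fun s : ℝ => yj j s) (A := M * B^(n+2) / (δ j)^(n+2) * 80^2 * 28) (ρ := 7/10) ?_ (by norm_num) (by norm_num) ?_
    · rw [iter_real (hyj j)] at hfm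
      simp only [Complex.ofReal_zero] at hfm
      exact hfm
    · have h1 : ContDiff ℂ (⊤:ℕ∞) (yj j) := (hyj j).contDiff
      exact (h1.restrict_scalars ℝ).comp Complex.ofRealCLM.contDiff
    · intro k s
      rw [iter_real (hyj j)]
      exact hd k s
  obtain ⟨K, hK, hTh⟩ := Th_bd hlam m
  have hL : Filter.Tendsto (fun j => ∫ s, Th lam m (fun s => yj j s) s * FourierTransform.fourier h s) Filter.atTop
      (nhds (∫ s, Th lam m (fun s => y s) s * FourierTransform.fourier h s)) := by
    refine tendsto_integral_of_dominated_convergence (fun s => (K * (M * (1+m)^n)) * ((1+|s|)^n * ‖FourierTransform.fourier h s‖)) ?_ (hHn.const_mul _) ?_ ?_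
    · intro j
      refine AEStronglyMeasurable.mul ?_ hH.aestronglyMeasurable
      exact (Th_meas hlam m ((hyj j).continuous.comp Complex.continuous_ofReal)).aestronglyMeasurable
    · intro j
      refine Filter.Eventually.of_forall fun s => ?_
      rw [norm_mul]
      have := hTh n (fun s => yj j s) M hM (hbj j) s
      calc _ ≤ (K * (M * ((1+m)*(1+|s|))^n)) * ‖FourierTransform.fourier h s‖ := by gcongr
        _ = _ := by rw [mul_pow]; ring
    · refine Filter.Eventually.of_forall fun s => ?_
      refine Filter.Tendsto.mul_const _ ?_
      exact Th_lim hlam m hM hbj (fun j => (hyj j).continuous.comp Complex.continuous_ofReal) (fun s => hlz s) s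
  have hu : TendstoUniformlyOn yj y Filter.atTop (Metric.sphere 0 1) := by
    have hcs : IsCompact (Metric.sphere (0:ℂ) 1) := isCompact_sphere _ _
    obtain ⟨Y0, hY0⟩ := hcs.exists_bound_of_continuousOn hy.continuous.continuousOn
    have hY0' : 0 ≤ Y0 := (norm_nonneg _).trans (hY0 1 (by simp))
    rw [Metric.tendstoUniformlyOn_iff]
    intro ε hε
    have hcon : ContinuousAt (fun w => Sc w^(n+2)) 0 := (Sc_cont.pow _).continuousAt
    obtain ⟨η, hη, hη'⟩ := Metric.continuousAt_iff.1 hcon (ε/(Y0+1)) (by positivity)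
    filter_upwards [hδl.eventually (gt_mem_nhds hη)] with j hj z hz
    have hz1 : ‖z‖ = 1 := by simpa using hz
    have := hη' (x := δ j * z) (by
      rw [dist_zero_right, norm_mul, hz1, mul_one, Complex.norm_real, Real.norm_of_nonneg (hδ0 j).le]; exact hj)
    rw [Sc_zero, one_pow, dist_comm, dist_eq_norm] at this
    rw [dist_eq_norm]
    have e : y z - yj j z = y z * (1 - Sc (δ j * z)^(n+2)) := by simp only [yj]; ring
    rw [e, norm_mul]
    rw [lt_div_iff₀ (by positivity)] at this
    have h5 := hY0 z hz
    have h6 := norm_nonneg (1 - Sc (δ j * z)^(n+2))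
    nlinarith
  have hR := (iter_lim hy hyj hu (2*m)).const_mul ((-1:ℂ)^m)
  simp only [hmain] at hL
  exact tendsto_nhds_unique hL hR

lemma SC {lam : ℝ} (hlam : -(1/2 : ℝ) < lam) (m : ℕ) : ∃ C : ℝ, 0 < C ∧ ∀ (a : ℕ → ℂ) (Ca M0 M : ℝ), Bd (3/5) Ca a →
    (∀ s : ℝ, ‖Ev (fun k => (wk lam k : ℂ) * a k) s‖ ≤ M0) →
    (∀ s : ℝ, ‖Ev (fun k => (wk lam k : ℂ) * ∑ r ∈ Finset.Icc (-(m:ℤ)) m, cf m r * tr lam r a k) s‖ ≤ M) → ‖a m‖ ≤ C * M := by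
  obtain ⟨n, D, hD, hinv⟩ := invert hlam
  obtain ⟨h, hc, hs, hh⟩ := exists_h hlam m
  let g : SchwartzMap ℝ ℂ := hs.toSchwartzMap hc
  have hg : ∀ x, (FourierTransform.fourier g : SchwartzMap ℝ ℂ) x = FourierTransform.fourier h x := fun x => rfl
  have hH : Integrable (FourierTransform.fourier h) := (FourierTransform.fourier g : SchwartzMap ℝ ℂ).integrable
  have hHn : Integrable (fun s : ℝ => (1+|s|)^n * ‖FourierTransform.fourier h s‖) := one_add_pow_integrable (FourierTransform.fourier g) n
  have hI : 0 ≤ ∫ s, (1+|s|)^n * ‖FourierTransform.fourier h s‖ := integral_nonneg fun s => by positivity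
  refine ⟨D * (∫ s, (1+|s|)^n * ‖FourierTransform.fourier h s‖) + 1, by positivity, fun a Ca M0 M ha h0 h1 => ?_⟩
  have hM0 : 0 ≤ M0 := (norm_nonneg _).trans (h0 0)
  have hM : 0 ≤ M := (norm_nonneg _).trans (h1 0)
  have hκ : (0:ℝ) ≤ 3/5 := by norm_num
  have hy := Ev_diff hκ ha
  have hyb := hinv a Ca M0 ha h0
  have htr : ∀ r : ℤ, Bd (3/5) _ (tr lam r a) := fun r => tr_Bd hlam hκ ha r
  have hF := Bd_sum (Finset.Icc (-(m:ℤ)) m) hκ (cf m) htr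
  have hFb := hinv _ _ M hF h1
  have hlim := FT_lim hlam m hc hs hh hH hHn hy (by positivity) hyb
  have hTh : ∀ s : ℝ, Th lam m (fun s => Ev a s) s = Ev (fun k => ∑ r ∈ Finset.Icc (-(m:ℤ)) m, cf m r * tr lam r a k) s := fun s => by
    rw [Ev_sum _ hκ _ htr]
    unfold Th
    refine Finset.sum_congr rfl fun r _ => ?_
    rw [Ev_tr hlam hκ ha]
    congr 1
    refine integral_congr_ae (Filter.Eventually.of_forall fun φ => ?_)
    simp
  rw [Ev_taylor hκ ha] at hlim
  have e : ‖a m‖ = ‖(-1:ℂ)^m * a m‖ := by simp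
  rw [e, ← hlim]
  have hb2 : ∀ s : ℝ, ‖Th lam m (fun s => Ev a s) s * FourierTransform.fourier h s‖ ≤ (D * M) * ((1+|s|)^n * ‖FourierTransform.fourier h s‖) := fun s => by
    rw [norm_mul, hTh]
    have := hFb s
    simp only [Complex.ofReal_im, abs_zero, mul_zero, Real.exp_zero, mul_one, Complex.norm_real, Real.norm_eq_abs] at this
    calc _ ≤ (D * M * (1+|s|)^n) * ‖FourierTransform.fourier h s‖ := by gcongr
      _ = _ := by ring
  refine (norm_integral_le_of_norm_le (hHn.const_mul (D*M)) (Filter.Eventually.of_forall hb2)).trans ?_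
  rw [integral_const_mul]
  nlinarith



/-- test functions -/
structure Tst (R G : ℝ) (g : ℝ → ℂ) : Prop where
  meas : Measurable g
  hR : 0 ≤ R
  bd : ∀ x, ‖g x‖ ≤ G
  supp : ∀ x, R < |x| → g x = 0

lemma μw_locfin {lam : ℝ} (hlam : -(1/2 : ℝ) < lam) : IsLocallyFiniteMeasure (μw lam) := by
  unfold μw
  refine IsLocallyFiniteMeasure.withDensity_ofReal ?_
  exact continuous_const.mul (continuous_abs.rpow_const fun x => Or.inr (by linarith))

lemma Tst.memLp {lam : ℝ} (hlam : -(1/2 : ℝ) < lam) {R G : ℝ} {g : ℝ → ℂ} (hg : Tst R G g) (q : ℝ≥0∞) : MemLp g q (μw lam) := by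
  have := μw_locfin hlam
  have hfin : μw lam (Set.Icc (-R) R) ≠ ⊤ := isCompact_Icc.measure_ne_top
  have h1 : MemLp ((Set.Icc (-R) R).indicator (fun _ => G)) q (μw lam) :=
    memLp_indicator_const q measurableSet_Icc G (Or.inr hfin)
  refine h1.mono hg.meas.aestronglyMeasurable (Filter.Eventually.of_forall fun x => ?_)
  by_cases hx : x ∈ Set.Icc (-R) R
  · rw [Set.indicator_of_mem hx]
    exact (hg.bd x).trans (le_abs_self _)
  · have : g x = 0 := hg.supp x (by rw [Set.mem_Icc, ← abs_le] at hx; exact not_le.1 hx)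
    rw [this]; simp

lemma Tst.int {lam : ℝ} (hlam : -(1/2 : ℝ) < lam) {R G : ℝ} {g : ℝ → ℂ} (hg : Tst R G g) : Integrable g (μw lam) :=
  memLp_one_iff_integrable.1 (hg.memLp hlam 1)

lemma sh_sh (j k : ℕ) (b : ℕ → ℂ) : sh j (sh k b) = sh (k+j) b := by
  ext l; simp only [sh]; congr 1; ring

/-- paired coefficients -/
def Ak (lam : ℝ) (b d : ℕ → ℂ) (g : ℝ → ℂ) (k : ℕ) : ℂ := ∫ x, P lam (sh k b) (sh k d) x * g x ∂(μw lam)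

lemma Ak_pt {lam : ℝ} (hlam : -(1/2 : ℝ) < lam) {ρ C : ℝ} (hρ : 0 ≤ ρ) {b d : ℕ → ℂ} (hb : Bd ρ C b)
    (hd : Bd ρ C d) {R G : ℝ} {g : ℝ → ℂ} (hg : Tst R G g) (k : ℕ) (x : ℝ) :
    ‖P lam (sh k b) (sh k d) x * g x‖ ≤ (C * ρ^(2*k) * (1+R) * Real.cosh (ρ*R)) * ‖g x‖ := by
  rw [norm_mul]
  rcases le_or_gt |x| R with h | h
  · gcongr
    exact P_bound hlam hρ (hb.sh k) (hd.sh k) x (by simpa using h)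
  · rw [hg.supp x h]; simp

lemma Ak_int {lam : ℝ} (hlam : -(1/2 : ℝ) < lam) {ρ C : ℝ} (hρ : 0 ≤ ρ) {b d : ℕ → ℂ} (hb : Bd ρ C b)
    (hd : Bd ρ C d) {R G : ℝ} {g : ℝ → ℂ} (hg : Tst R G g) (k : ℕ) :
    Integrable (fun x : ℝ => P lam (sh k b) (sh k d) x * g x) (μw lam) :=
  ((hg.int hlam).norm.const_mul (C * ρ^(2*k) * (1+R) * Real.cosh (ρ*R))).mono'
    ((P_cont hlam hρ (hb.sh k) (hd.sh k)).measurable.mul hg.meas).aestronglyMeasurable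
    (Filter.Eventually.of_forall fun x => Ak_pt hlam hρ hb hd hg k x)

lemma Ak_Bd {lam : ℝ} (hlam : -(1/2 : ℝ) < lam) {ρ C : ℝ} (hρ : 0 ≤ ρ) {b d : ℕ → ℂ} (hb : Bd ρ C b)
    (hd : Bd ρ C d) {R G : ℝ} {g : ℝ → ℂ} (hg : Tst R G g) :
    Bd ρ (C * (1+R) * Real.cosh (ρ*R) * ∫ x, ‖g x‖ ∂(μw lam)) (Ak lam b d g) := by
  intro k
  refine (norm_integral_le_of_norm_le ((hg.int hlam).norm.const_mul (C * ρ^(2*k) * (1+R) * Real.cosh (ρ*R)))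
    (Filter.Eventually.of_forall fun x => Ak_pt hlam hρ hb hd hg k x)).trans ?_
  rw [integral_const_mul]
  exact le_of_eq (by ring)

lemma int_T {lam : ℝ} (hlam : -(1/2 : ℝ) < lam) {ρ C : ℝ} (hρ : 0 ≤ ρ) {b d : ℕ → ℂ} (hb : Bd ρ C b)
    (hd : Bd ρ C d) {R G : ℝ} {g : ℝ → ℂ} (hg : Tst R G g) (t : ℝ) :
    ∫ x, T lam t (fun x => P lam b d x) x * g x ∂(μw lam) =
      ∑' k, ((w0 lam * (t^(2*k) / al lam k) : ℝ) : ℂ) * Ak lam b d g k := by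
  have hw := w0_pos hlam
  have hC := hb.nonneg
  have hpt : ∀ k, 0 ≤ w0 lam * (t^(2*k) / al lam k) ∧ w0 lam * (t^(2*k) / al lam k) ≤ w0 lam * (t^(2*k) / (2*k).factorial) := fun k => by
    have h0 : 0 ≤ t^(2*k) := by rw [pow_mul]; positivity
    have h1 := al_pos hlam k
    have h2 := al_ge hlam k
    have h3 : (0:ℝ) < (2*k).factorial := by positivity
    exact ⟨by positivity, by gcongr⟩
  let bnd : ℕ → ℝ → ℝ := fun k x => (w0 lam * C * (1+R) * Real.cosh (ρ*R)) * ((ρ*t)^(2*k) / (2*k).factorial) * ‖g x‖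
  have hbd : ∀ k (x : ℝ), ‖((w0 lam * (t^(2*k) / al lam k) : ℝ) : ℂ) * (P lam (sh k b) (sh k d) x * g x)‖ ≤ bnd k x := fun k x => by
    rw [norm_mul, Complex.norm_real, Real.norm_of_nonneg (hpt k).1]
    have h1 := Ak_pt hlam hρ hb hd hg k x
    calc _ ≤ (w0 lam * (t^(2*k) / (2*k).factorial)) * ((C * ρ^(2*k) * (1+R) * Real.cosh (ρ*R)) * ‖g x‖) := by
          refine mul_le_mul (hpt k).2 h1 (norm_nonneg _) ((hpt k).1.trans (hpt k).2)
      _ = _ := by simp only [bnd]; rw [mul_pow]; ring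
  have hsx : ∀ x, Summable fun k => bnd k x := fun x => ((sum_cosh (ρ*t)).mul_left _).mul_right _
  have h := hasSum_integral_of_dominated_convergence (μ := μw lam)
    (F := fun k (x:ℝ) => ((w0 lam * (t^(2*k) / al lam k) : ℝ) : ℂ) * (P lam (sh k b) (sh k d) x * g x))
    (f := fun x => T lam t (fun x => P lam b d x) x * g x) bnd
    (fun k => ((Ak_int hlam hρ hb hd hg k).const_mul _).aestronglyMeasurable)
    (fun k => Filter.Eventually.of_forall (hbd k))
    (Filter.Eventually.of_forall hsx)
    (by
      have e : ∀ x, ∑' k, bnd k x = (∑' k : ℕ, (w0 lam * C * (1+R) * Real.cosh (ρ*R)) * ((ρ*t)^(2*k) / (2*k).factorial)) * ‖g x‖ := fun x => tsum_mul_right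
      simp only [e]
      exact (hg.int hlam).norm.const_mul _)
    (Filter.Eventually.of_forall fun x => by
      have hsum : Summable fun k => ((w0 lam * (t^(2*k) / al lam k) : ℝ) : ℂ) * (P lam (sh k b) (sh k d) x * g x) :=
        Summable.of_norm_bounded (hsx x) (fun k => hbd k x)
      rw [T_sum1 hlam hρ hb hd, ← tsum_mul_right]
      simp only [mul_assoc] at hsum ⊢
      exact hsum.hasSum)
  rw [← h.tsum_eq]
  refine tsum_congr fun k => ?_
  rw [integral_const_mul]; rfl

lemma int_T_Ev {lam : ℝ} (hlam : -(1/2 : ℝ) < lam) {ρ C : ℝ} (hρ : 0 ≤ ρ) {b d : ℕ → ℂ} (hb : Bd ρ C b)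
    (hd : Bd ρ C d) {R G : ℝ} {g : ℝ → ℂ} (hg : Tst R G g) (t s : ℝ) :
    Ev (fun k => (wk lam k : ℂ) * ((t:ℂ)^(2*k) * Ak lam b d g k)) s = ∫ x, T lam (t*s) (fun x => P lam b d x) x * g x ∂(μw lam) := by
  rw [int_T hlam hρ hb hd hg, Ev]
  refine tsum_congr fun k => ?_
  have h1 : (al lam k : ℂ) ≠ 0 := by exact_mod_cast (al_pos hlam k).ne'
  have f1 : ((2*k).factorial : ℂ) ≠ 0 := by exact_mod_cast (Nat.factorial_pos _).ne'
  rw [wk]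
  push_cast
  generalize ((2*k).factorial : ℂ) = F at f1 ⊢
  field_simp
  rw [mul_pow]; ring

lemma symm_P {lam : ℝ} (hlam : -(1/2 : ℝ) < lam) {ρ C : ℝ} (hρ : 0 ≤ ρ) {b d : ℕ → ℂ} (hb : Bd ρ C b)
    (hd : Bd ρ C d) (m : ℕ) (t x : ℝ) :
    symmDiff lam m t (fun x : ℝ => P lam b d x) x =
      P lam (fun l => ∑ r ∈ Finset.Icc (-(m:ℤ)) m, cf m r * tr lam (r*t) b l) (fun l => ∑ r ∈ Finset.Icc (-(m:ℤ)) m, cf m r * tr lam (r*t) d l) x := by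
  rw [P_sum _ hlam hρ (cf m) (fun r : ℤ => tr_Bd hlam hρ hb (r*t)) (fun r : ℤ => tr_Bd hlam hρ hd (r*t)), symmDiff, Finset.mul_sum]
  refine Finset.sum_congr rfl fun r _ => ?_
  rw [T_sum2 hlam hρ hb hd, cf]
  ring

lemma Ak_symm {lam : ℝ} (hlam : -(1/2 : ℝ) < lam) {ρ C : ℝ} (hρ : 0 ≤ ρ) {b d : ℕ → ℂ} (hb : Bd ρ C b)
    (hd : Bd ρ C d) {R G : ℝ} {g : ℝ → ℂ} (hg : Tst R G g) (m : ℕ) (t : ℝ) (k : ℕ) :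
    (t:ℂ)^(2*k) * Ak lam (fun l => ∑ r ∈ Finset.Icc (-(m:ℤ)) m, cf m r * tr lam (r*t) b l) (fun l => ∑ r ∈ Finset.Icc (-(m:ℤ)) m, cf m r * tr lam (r*t) d l) g k
      = ∑ r ∈ Finset.Icc (-(m:ℤ)) m, cf m r * tr lam r (fun k => (t:ℂ)^(2*k) * Ak lam b d g k) k := by
  have hbk := hb.sh k
  have hdk := hd.sh k
  have e1 : ∀ x : ℝ, P lam (sh k (fun l => ∑ r ∈ Finset.Icc (-(m:ℤ)) m, cf m r * tr lam (r*t) b l)) (sh k (fun l => ∑ r ∈ Finset.Icc (-(m:ℤ)) m, cf m r * tr lam (r*t) d l)) x * g x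
      = ∑ r ∈ Finset.Icc (-(m:ℤ)) m, cf m r * (T lam (r*t) (fun x => P lam (sh k b) (sh k d) x) x * g x) := fun x => by
    have h := P_sum (Finset.Icc (-(m:ℤ)) m) hlam hρ (cf m) (fun r : ℤ => tr_Bd hlam hρ hbk (r*t)) (fun r : ℤ => tr_Bd hlam hρ hdk (r*t)) x
    simp only [← sh_tr] at h
    have h' : P lam (sh k (fun l => ∑ r ∈ Finset.Icc (-(m:ℤ)) m, cf m r * tr lam (r*t) b l)) (sh k (fun l => ∑ r ∈ Finset.Icc (-(m:ℤ)) m, cf m r * tr lam (r*t) d l)) x = _ := h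
    rw [h', Finset.sum_mul]
    refine Finset.sum_congr rfl fun r _ => ?_
    rw [T_sum2 hlam hρ hbk hdk, sh_tr, sh_tr]
    ring
  have hi : ∀ r : ℤ, Integrable (fun x => T lam (r*t) (fun x => P lam (sh k b) (sh k d) x) x * g x) (μw lam) := fun r => by
    have h := Ak_int hlam hρ (tr_Bd hlam hρ hbk (r*t)) (tr_Bd hlam hρ hdk (r*t)) hg 0
    refine h.congr (Filter.Eventually.of_forall fun x => ?_)
    simp only [T_sum2 hlam hρ hbk hdk]; rfl
  rw [Ak]
  simp only [e1]
  rw [integral_finsetSum _ (fun r _ => (hi r).const_mul _), Finset.mul_sum]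
  refine Finset.sum_congr rfl fun r _ => ?_
  rw [integral_const_mul, int_T hlam hρ hbk hdk hg, mul_left_comm]
  congr 1
  rw [tr, ← tsum_mul_left]
  refine tsum_congr fun j => ?_
  have e2 : Ak lam (sh k b) (sh k d) g j = Ak lam b d g (k+j) := by
    simp only [Ak, sh_sh]
  rw [e2]
  push_cast
  ring

lemma dual_bd {lam : ℝ} (hlam : -(1/2 : ℝ) < lam) (m : ℕ) : ∃ C : ℝ, 0 < C ∧ ∀ (σ : ℝ), 0 < σ → ∀ (b d : ℕ → ℂ) (C0 : ℝ),
    Bd (6/5*σ) C0 b → Bd (6/5*σ) C0 d → ∀ (p q : ℝ≥0∞) [ENNReal.HolderTriple p q 1], 1 ≤ p → 1 ≤ q →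
    eLpNorm (fun x : ℝ => P lam b d x) p (μw lam) ≠ ⊤ → ∀ t : ℝ, 0 < t → t ≤ 1/(2*σ) →
    eLpNorm (symmDiff lam m t (fun x : ℝ => P lam b d x)) p (μw lam) ≠ ⊤ →
    ∀ (R G : ℝ) (g : ℝ → ℂ), Tst R G g →
    ‖∫ x, P lam (sh m b) (sh m d) x * g x ∂(μw lam)‖ₑ ≤
      (ENNReal.ofReal (C / t^(2*m)) * eLpNorm (symmDiff lam m t (fun x : ℝ => P lam b d x)) p (μw lam)) * eLpNorm g q (μw lam) := by
  obtain ⟨C, hC, hSC⟩ := SC hlam m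
  obtain ⟨K, hK, hpair⟩ := pairing hlam
  refine ⟨C * K, by positivity, fun σ hσ b d C0 hb hd p q _ hp hq hf t ht htσ hsf R G g hg => ?_⟩
  have hρ : 0 ≤ 6/5*σ := by positivity
  have htρ : t * (6/5*σ) ≤ 3/5 := by
    rw [le_div_iff₀ (by positivity)] at htσ
    linarith
  have hgq : eLpNorm g q (μw lam) ≠ ⊤ := (hg.memLp hlam q).2.ne
  let bF : ℕ → ℂ := fun l => ∑ r ∈ Finset.Icc (-(m:ℤ)) m, cf m r * tr lam (r*t) b l
  let dF : ℕ → ℂ := fun l => ∑ r ∈ Finset.Icc (-(m:ℤ)) m, cf m r * tr lam (r*t) d l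
  have hbF : Bd (6/5*σ) _ bF := Bd_sum _ hρ (cf m) (fun r : ℤ => tr_Bd hlam hρ hb (r*t))
  have hdF : Bd (6/5*σ) _ dF := Bd_sum _ hρ (cf m) (fun r : ℤ => tr_Bd hlam hρ hd (r*t))
  have esym : symmDiff lam m t (fun x : ℝ => P lam b d x) = fun x : ℝ => P lam bF dF x := funext fun x => symm_P hlam hρ hb hd m t x
  rw [esym] at hsf ⊢
  let N0 : ℝ≥0∞ := ENNReal.ofReal K * eLpNorm (fun x : ℝ => P lam b d x) p (μw lam) * eLpNorm g q (μw lam)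
  let N1 : ℝ≥0∞ := ENNReal.ofReal K * eLpNorm (fun x : ℝ => P lam bF dF x) p (μw lam) * eLpNorm g q (μw lam)
  have hN0 : N0 ≠ ⊤ := ENNReal.mul_ne_top (ENNReal.mul_ne_top ENNReal.ofReal_ne_top hf) hgq
  have hN1 : N1 ≠ ⊤ := ENNReal.mul_ne_top (ENNReal.mul_ne_top ENNReal.ofReal_ne_top hsf) hgq
  have hA := Ak_Bd hlam hρ hb hd hg
  have ha : Bd (3/5) (C0 * (1+R) * Real.cosh (6/5*σ*R) * ∫ x, ‖g x‖ ∂(μw lam)) (fun k => (t:ℂ)^(2*k) * Ak lam b d g k) := by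
    intro k
    have hn := hA.nonneg
    rw [norm_mul, norm_pow, Complex.norm_real, Real.norm_of_nonneg ht.le]
    calc _ ≤ t^(2*k) * ((C0 * (1+R) * Real.cosh (6/5*σ*R) * ∫ x, ‖g x‖ ∂(μw lam)) * (6/5*σ)^(2*k)) := by
            gcongr; exact hA k
      _ = (C0 * (1+R) * Real.cosh (6/5*σ*R) * ∫ x, ‖g x‖ ∂(μw lam)) * (t * (6/5*σ))^(2*k) := by rw [mul_pow]; ring
      _ ≤ _ := by gcongr
  have key := hSC _ _ N0.toReal N1.toReal ha ?_ ?_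
  · have e : (C * K / t^(2*m)) * 1 = C / t^(2*m) * K := by ring
    have h2 : ‖Ak lam b d g m‖ ≤ C / t^(2*m) * N1.toReal := by
      rw [norm_mul, norm_pow, Complex.norm_real, Real.norm_of_nonneg ht.le] at key
      rw [div_mul_eq_mul_div, le_div_iff₀ (by positivity)]
      linarith
    have h3 : ‖Ak lam b d g m‖ₑ ≤ ENNReal.ofReal (C / t^(2*m)) * N1 := by
      rw [← ofReal_norm]
      refine (ENNReal.ofReal_le_ofReal h2).trans ?_
      rw [ENNReal.ofReal_mul (by positivity), ENNReal.ofReal_toReal hN1]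
    refine h3.trans (le_of_eq ?_)
    rw [show C * K / t^(2*m) = C / t^(2*m) * K by ring, ENNReal.ofReal_mul (by positivity)]
    simp only [N1]
    ring
  · intro s
    rw [int_T_Ev hlam hρ hb hd hg]
    have := hpair _ (P_cont hlam hρ hb hd) g hg.meas p q hp hq (t*s)
    rw [← ENNReal.toReal_le_toReal enorm_ne_top hN0, toReal_enorm] at this
    exact this
  · intro s
    simp only [← Ak_symm hlam hρ hb hd hg m t]
    have hcb : Bd (6/5*σ) (∑ r ∈ Finset.Icc (-(m:ℤ)) m, ‖cf m r‖ * (w0 lam * C0 * Real.cosh (6/5*σ*(r*t)))) bF := hbF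
    rw [int_T_Ev hlam hρ hbF hdF hg]
    have := hpair _ (P_cont hlam hρ hbF hdF) g hg.meas p q hp hq (t*s)
    rw [← ENNReal.toReal_le_toReal enorm_ne_top hN1, toReal_enorm] at this
    exact this



/-- conjugate sign -/
def sg (z : ℂ) : ℂ := (starRingEnd ℂ) z / (‖z‖ : ℂ)

lemma sg_mul (z : ℂ) : z * sg z = (‖z‖ : ℂ) := by
  unfold sg
  by_cases h : z = 0
  · simp [h]
  · have : (‖z‖ : ℂ) ≠ 0 := by simpa using h
    rw [← mul_div_assoc, Complex.mul_conj', sq, mul_div_assoc, div_self this, mul_one]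

lemma sg_norm (z : ℂ) : ‖sg z‖ ≤ 1 := by
  unfold sg
  rw [norm_div, RCLike.norm_conj, Complex.norm_real, norm_norm]
  exact div_self_le_one _

lemma sg_meas : Measurable sg := by
  unfold sg
  exact (Complex.continuous_conj.measurable).div (Complex.measurable_ofReal.comp measurable_norm)

lemma dual_core {lam : ℝ} (hlam : -(1/2 : ℝ) < lam) {v : ℝ → ℂ} (hv : Continuous v) {q Q : ℝ≥0∞}
    (H : ∀ (R G : ℝ) (g : ℝ → ℂ), Tst R G g → ‖∫ x, v x * g x ∂(μw lam)‖ₑ ≤ Q * eLpNorm g q (μw lam))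
    {R G : ℝ} (hR : 0 ≤ R) {S : Set ℝ} (hS : MeasurableSet S) (hSR : S ⊆ Set.Icc (-R) R) {φ : ℝ → ℝ} (hφ : Measurable φ)
    (hφ0 : ∀ x, 0 ≤ φ x) (hG : 0 ≤ G) (hφG : ∀ x ∈ S, φ x ≤ G) :
    ∫⁻ x in S, ‖v x‖ₑ * ENNReal.ofReal (φ x) ∂(μw lam) ≤ Q * eLpNorm φ q ((μw lam).restrict S) := by
  let g : ℝ → ℂ := S.indicator (fun x => sg (v x) * (φ x : ℂ))
  have hgn : ∀ x, ‖g x‖ ≤ S.indicator φ x := fun x => by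
    by_cases hx : x ∈ S
    · simp only [g, Set.indicator_of_mem hx]
      rw [norm_mul, Complex.norm_real, Real.norm_of_nonneg (hφ0 x)]
      have := sg_norm (v x)
      nlinarith [hφ0 x]
    · simp [g, hx]
  have hT : Tst R G g := by
    refine ⟨Measurable.indicator ((sg_meas.comp hv.measurable).mul (Complex.measurable_ofReal.comp hφ)) hS, hR, fun x => ?_, fun x hx => ?_⟩
    · refine (hgn x).trans ?_
      by_cases hx : x ∈ S
      · rw [Set.indicator_of_mem hx]; exact hφG x hx
      · rw [Set.indicator_of_notMem hx]; exact hG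
    · refine Set.indicator_of_notMem (fun h => ?_) _
      have := hSR h
      rw [Set.mem_Icc, ← abs_le] at this
      linarith
  have h1 := H R G g hT
  have e1 : ∀ x, v x * g x = ((S.indicator (fun x => ‖v x‖ * φ x) x : ℝ) : ℂ) := fun x => by
    by_cases hx : x ∈ S
    · simp only [g, Set.indicator_of_mem hx]
      rw [← mul_assoc, sg_mul]; push_cast; rfl
    · simp [g, hx]
  have hw0 : ∀ x, 0 ≤ S.indicator (fun x => ‖v x‖ * φ x) x := fun x =>
    Set.indicator_nonneg (fun x _ => mul_nonneg (norm_nonneg _) (hφ0 x)) x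
  have hwint : Integrable (S.indicator (fun x => ‖v x‖ * φ x)) (μw lam) := by
    obtain ⟨V, hV⟩ := (isCompact_Icc (a := -R) (b := R)).exists_bound_of_continuousOn hv.continuousOn
    refine ((hT.int hlam).norm.const_mul V).mono' ((hv.norm.measurable.mul hφ).indicator hS).aestronglyMeasurable (Filter.Eventually.of_forall fun x => ?_)
    have e2 : ‖S.indicator (fun x => ‖v x‖ * φ x) x‖ = ‖v x * g x‖ := by rw [e1, Complex.norm_real]
    rw [e2, norm_mul]
    by_cases hx : x ∈ S
    · gcongr; exact hV x (hSR hx)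
    · simp [g, hx]
  simp only [e1] at h1
  rw [integral_complex_ofReal] at h1
  rw [← ofReal_norm, Complex.norm_real, Real.norm_of_nonneg (integral_nonneg hw0),
    ofReal_integral_eq_lintegral_ofReal hwint (Filter.Eventually.of_forall hw0)] at h1
  have e3 : ∀ x, ENNReal.ofReal (S.indicator (fun x => ‖v x‖ * φ x) x) = S.indicator (fun x => ‖v x‖ₑ * ENNReal.ofReal (φ x)) x := fun x => by
    by_cases hx : x ∈ S
    · simp only [Set.indicator_of_mem hx]
      rw [ENNReal.ofReal_mul (norm_nonneg _), ofReal_norm]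
    · simp [hx]
  simp only [e3] at h1
  rw [lintegral_indicator hS] at h1
  refine h1.trans ?_
  gcongr
  rw [← eLpNorm_indicator_eq_eLpNorm_restrict hS]
  refine eLpNorm_mono fun x => (hgn x).trans (le_abs_self _)

lemma dual {lam : ℝ} (hlam : -(1/2 : ℝ) < lam) {v : ℝ → ℂ} (hv : Continuous v) {p Q : ℝ≥0∞} (hp : 1 ≤ p)
    (H : ∀ q : ℝ≥0∞, ENNReal.HolderTriple p q 1 → 1 ≤ q → ∀ (R G : ℝ) (g : ℝ → ℂ), Tst R G g →
      ‖∫ x, v x * g x ∂(μw lam)‖ₑ ≤ Q * eLpNorm g q (μw lam)) :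
    eLpNorm v p (μw lam) ≤ Q := by
  have hlf := μw_locfin hlam
  have hB : ∀ n : ℕ, MeasurableSet (Set.Icc (-(n:ℝ)) n) := fun n => measurableSet_Icc
  have hU : (⋃ n : ℕ, Set.Icc (-(n:ℝ)) n) = Set.univ := by
    refine Set.eq_univ_of_forall fun x => Set.mem_iUnion.2 ?_
    obtain ⟨n, hn⟩ := exists_nat_ge |x|
    exact ⟨n, by rw [Set.mem_Icc, ← abs_le]; exact hn⟩
  by_cases hpt : p = ⊤
  · subst hpt
    have H1 := H 1 inferInstance le_rfl
    rw [eLpNorm_exponent_top, eLpNormEssSup]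
    refine le_of_forall_gt_imp_ge_of_dense fun a ha => ?_
    refine essSup_le_of_ae_le _ ?_
    have hnull : ∀ n : ℕ, μw lam ({x | a < ‖v x‖ₑ} ∩ Set.Icc (-(n:ℝ)) n) = 0 := fun n => by
      have hSm : MeasurableSet ({x | a < ‖v x‖ₑ} ∩ Set.Icc (-(n:ℝ)) n) :=
        (measurableSet_lt measurable_const hv.measurable.enorm).inter (hB n)
      have h := dual_core hlam hv H1 (R := n) (G := 1) (Nat.cast_nonneg n) hSm Set.inter_subset_right (φ := fun _ => 1) measurable_const
        (fun _ => zero_le_one) zero_le_one (fun _ _ => le_rfl)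
      have hfin : μw lam ({x | a < ‖v x‖ₑ} ∩ Set.Icc (-(n:ℝ)) n) ≠ ⊤ :=
        ((measure_mono Set.inter_subset_right).trans_lt (isCompact_Icc (a := -(n:ℝ)) (b := n)).measure_lt_top).ne
      have h2 : a * μw lam ({x | a < ‖v x‖ₑ} ∩ Set.Icc (-(n:ℝ)) n) ≤ ∫⁻ x in ({x | a < ‖v x‖ₑ} ∩ Set.Icc (-(n:ℝ)) n), ‖v x‖ₑ * ENNReal.ofReal 1 ∂(μw lam) := by
        rw [← setLIntegral_const]
        refine setLIntegral_mono' hSm fun x hx => ?_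
        rw [ENNReal.ofReal_one, mul_one]
        exact le_of_lt hx.1
      have h3 : eLpNorm (fun _ : ℝ => (1:ℝ)) 1 ((μw lam).restrict ({x | a < ‖v x‖ₑ} ∩ Set.Icc (-(n:ℝ)) n)) = μw lam ({x | a < ‖v x‖ₑ} ∩ Set.Icc (-(n:ℝ)) n) := by
        rw [eLpNorm_one_eq_lintegral_enorm]; simp
      rw [h3] at h
      by_contra hne
      have h4 := h2.trans h
      rw [ENNReal.mul_le_mul_iff_left hne hfin] at h4
      exact absurd ha (not_lt.2 h4)
    rw [Filter.EventuallyLE, ae_iff]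
    simp only [not_le]
    rw [← Set.inter_univ {x | a < ‖v x‖ₑ}, ← hU, Set.inter_iUnion]
    exact measure_iUnion_null hnull
  · have hp0 : p ≠ 0 := (zero_lt_one.trans_le hp).ne'
    have hpr : 1 ≤ p.toReal := by
      rw [← ENNReal.toReal_one]; exact (ENNReal.toReal_le_toReal ENNReal.one_ne_top hpt).2 hp
    have key : ∀ n : ℕ, eLpNorm v p ((μw lam).restrict (Set.Icc (-(n:ℝ)) n)) ≤ Q := fun n => by
      obtain ⟨V, hV⟩ := (isCompact_Icc (a := -(n:ℝ)) (b := n)).exists_bound_of_continuousOn hv.continuousOn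
      have hV0 : 0 ≤ V := (norm_nonneg _).trans (hV 0 (by simp))
      rcases eq_or_lt_of_le hp with h1 | h1
      · subst h1
        have H1 := H ⊤ inferInstance le_top
        have h := dual_core hlam hv H1 (R := n) (G := 1) (Nat.cast_nonneg n) (hB n) le_rfl (φ := fun _ => 1) measurable_const
          (fun _ => zero_le_one) zero_le_one (fun _ _ => le_rfl)
        have h3 : eLpNorm (fun _ : ℝ => (1:ℝ)) ⊤ ((μw lam).restrict (Set.Icc (-(n:ℝ)) n)) ≤ 1 := by
          rw [eLpNorm_exponent_top]
          refine (eLpNormEssSup_le_of_ae_bound (C := 1) (Filter.Eventually.of_forall fun x => by simp)).trans (by simp)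
        rw [eLpNorm_one_eq_lintegral_enorm]
        simp only [ENNReal.ofReal_one, mul_one] at h
        refine h.trans ?_
        calc Q * _ ≤ Q * 1 := by gcongr
          _ = Q := mul_one _
      · have hpr1 : 1 < p.toReal := by
          rw [← ENNReal.toReal_one]; exact (ENNReal.toReal_lt_toReal ENNReal.one_ne_top hpt).2 h1
        have hc := Real.HolderConjugate.conjExponent hpr1
        have hq0 : 0 ≤ p.toReal.conjExponent := hc.symm.nonneg
        have hq1 : 1 < p.toReal.conjExponent := hc.symm.lt
        have hconj : ENNReal.HolderConjugate p (ENNReal.ofReal p.toReal.conjExponent) := by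
          rw [← ENNReal.HolderConjugate.toReal_iff hpr1, ENNReal.toReal_ofReal hq0]; exact hc
        have H1 := H (ENNReal.ofReal p.toReal.conjExponent) hconj (by
          rw [← ENNReal.ofReal_one]; exact ENNReal.ofReal_le_ofReal hq1.le)
        have hs : 0 < p.toReal - 1 := by linarith
        have h := dual_core hlam hv H1 (R := n) (G := V^(p.toReal-1)) (Nat.cast_nonneg n) (hB n) le_rfl (φ := fun x => ‖v x‖^(p.toReal-1))
          (hv.norm.measurable.pow_const _) (fun _ => by positivity) (by positivity) (fun x hx => by
            exact Real.rpow_le_rpow (norm_nonneg _) (hV x hx) hs.le)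
        have eexp : ENNReal.ofReal p.toReal.conjExponent * ENNReal.ofReal (p.toReal-1) = p := by
          rw [← ENNReal.ofReal_mul hq0, mul_comm, hc.sub_one_mul_conj, ENNReal.ofReal_toReal hpt]
        rw [eLpNorm_norm_rpow _ hs, eexp] at h
        have e2 : ∀ x, ‖v x‖ₑ * ENNReal.ofReal (‖v x‖^(p.toReal-1)) = ‖v x‖ₑ^p.toReal := fun x => by
          rw [← ENNReal.ofReal_rpow_of_nonneg (norm_nonneg _) hs.le, ofReal_norm]
          nth_rewrite 1 [← ENNReal.rpow_one ‖v x‖ₑ]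
          rw [← ENNReal.rpow_add_of_nonneg _ _ zero_le_one hs.le]
          congr 1; ring
        simp only [e2] at h
        have e3 : ∫⁻ x in Set.Icc (-(n:ℝ)) n, ‖v x‖ₑ^p.toReal ∂(μw lam) = eLpNorm v p ((μw lam).restrict (Set.Icc (-(n:ℝ)) n)) ^ p.toReal := by
          rw [eLpNorm_eq_lintegral_rpow_enorm_toReal hp0 hpt, ← ENNReal.rpow_mul, one_div, inv_mul_cancel₀ (by linarith), ENNReal.rpow_one]
        rw [e3] at h
        have hNt : eLpNorm v p ((μw lam).restrict (Set.Icc (-(n:ℝ)) n)) ≠ ⊤ := by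
          have : IsFiniteMeasure ((μw lam).restrict (Set.Icc (-(n:ℝ)) n)) := ⟨by
            rw [Measure.restrict_apply_univ]; exact isCompact_Icc.measure_lt_top⟩
          refine (MemLp.of_bound (C := V) hv.aestronglyMeasurable ?_).2.ne
          exact (ae_restrict_iff' (hB n)).2 (Filter.Eventually.of_forall hV)
        generalize eLpNorm v p ((μw lam).restrict (Set.Icc (-(n:ℝ)) n)) = N at h hNt
        by_cases hN0 : N = 0
        · rw [hN0]; exact zero_le
        have e4 : N^p.toReal = N * N^(p.toReal-1) := by
          nth_rewrite 2 [← ENNReal.rpow_one N]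
          rw [← ENNReal.rpow_add_of_nonneg _ _ zero_le_one hs.le]
          congr 1; ring
        rw [e4, ENNReal.mul_le_mul_iff_left (by simp [hN0, hNt]) (ENNReal.rpow_ne_top_of_nonneg hs.le hNt)] at h
        exact h
    have hpp : 0 < p.toReal := by linarith
    rw [eLpNorm_eq_lintegral_rpow_enorm_toReal hp0 hpt, one_div, ENNReal.rpow_inv_le_iff hpp,
      ← setLIntegral_univ, ← hU, setLIntegral_iUnion_of_directed]
    · refine iSup_le fun n => ?_
      have := key n
      rw [eLpNorm_eq_lintegral_rpow_enorm_toReal hp0 hpt, one_div, ENNReal.rpow_inv_le_iff hpp] at this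
      exact this
    · refine Monotone.directed_le (f := fun n : ℕ => Set.Icc (-(n:ℝ)) n) fun i j hij => ?_
      have : (i:ℝ) ≤ j := by exact_mod_cast hij
      exact Set.Icc_subset_Icc (by linarith) this

lemma μw_zero (lam : ℝ) : ∀ᵐ x ∂(μw lam), x ≠ 0 := by
  have h : μw lam {0} = 0 := withDensity_absolutelyContinuous _ _ (by simp)
  rw [ae_iff]
  simpa using h

/-- Nikolskii–Stechkin-type inequality: for `λ > −1/2` and `m ∈ ℕ` there is a
constant `C`, depending only on `λ` and `m`, such that for every `σ > 0`, `1 ≤ p ≤ ∞`, every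
entire function `f` of exponential type at most `σ` with finite `L^p(ℝ,dμ)` norm, and every
`0 < t ≤ 1/(2σ)`, `‖Δ_λ^m f‖_{L^p(ℝ,dμ)} ≤ C t^{−2m} ‖**Δ_t^m f‖_{L^p(ℝ,dμ)}`. -/
theorem stmt14 (lam : ℝ) (hlam : -(1/2 : ℝ) < lam) (m : ℕ) (hm : 0 < m) :
    ∃ C : ℝ, 0 < C ∧ ∀ σ : ℝ, 0 < σ → ∀ p : ℝ≥0∞, 1 ≤ p →
      ∀ f : ℂ → ℂ, IsExpType σ f →
        eLpNorm (fun x : ℝ => f (x : ℂ)) p (μw lam) < ⊤ →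
        ∀ t : ℝ, 0 < t → t ≤ 1 / (2 * σ) →
        eLpNorm (lapIter lam m fun x : ℝ => f (x : ℂ)) p (μw lam) ≤
          ENNReal.ofReal (C / t ^ (2 * m)) *
            eLpNorm (symmDiff lam m t fun x : ℝ => f (x : ℂ)) p (μw lam) := by
  obtain ⟨C, hC, hmain⟩ := dual_bd hlam m
  refine ⟨C, hC, fun σ hσ p hp f hf hfp t ht htσ => ?_⟩
  obtain ⟨b, d, C0, hb, hd, he⟩ := expand hlam hσ hf
  have ef : (fun x : ℝ => f (x:ℂ)) = fun x : ℝ => P lam b d x := funext fun x => he x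
  rw [ef] at hfp ⊢
  have hρ : 0 ≤ 6/5*σ := by positivity
  by_cases hsf : eLpNorm (symmDiff lam m t (fun x : ℝ => P lam b d x)) p (μw lam) = ⊤
  · rw [hsf, ENNReal.mul_top]
    · exact le_top
    · simp only [ne_eq, ENNReal.ofReal_eq_zero, not_le]; positivity
  have hae : lapIter lam m (fun x : ℝ => P lam b d x) =ᵐ[μw lam] fun x : ℝ => P lam (sh m b) (sh m d) x := by
    filter_upwards [μw_zero lam] with x hx
    exact lapIter_P hlam hρ hb hd m hx
  rw [eLpNorm_congr_ae hae]
  refine dual hlam (P_cont hlam hρ (hb.sh m) (hd.sh m)) hp fun q hq hq1 R G g hg => ?_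
  exact hmain σ hσ b d C0 hb hd p q hp hq1 hfp.ne t ht htσ hsf R G g hg



end Dunkl1DStmt14
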